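/- Let k ≥ 1 and let α = (α₁,…,α_m) be a partition of k with m parts. Then the genus-one Hurwitz number over the sphere is given by μ_{0,m}^{1,k}(α) = (|c_α|/(24·k!))·(k + m)!·(Π_{i=1}^m α_i^{α_i}/(α_i − 1)!)·(k^m − k^{m−1} − Σ_{i=2}^m (i − 2)!·e_i·k^{m−i}), where e_i is the i-th elementary symmetric polynomial evaluated at (α₁,…,α_m). -/

import Mathlib

/-!
Formula (1.8) for genus-one Hurwitz numbers over the sphere:
`μ_{0,m}^{1,k}(α) = (|c_α|/(24·k!))·(k+m)!·(Π α_i^{α_i}/(α_i-1)!)·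
(k^m - k^{m-1} - Σ_{i=2}^m (i-2)!·e_i·k^{m-i})`.
-/

/-- The cycle type of a permutation of `Fin k`, counting fixed points as
cycles of length 1. -/
def fullCycleType {k : ℕ} (σ : Equiv.Perm (Fin k)) : Multiset ℕ :=
  σ.cycleType + Multiset.replicate (k - σ.support.card) 1

/-- The number of tuples `(t₁,…,t_r,σ)` in `S_k` such that each `t_i` is a
transposition, `σ` has cycle type `α` (fixed points counted as 1-cycles),
`t₁⋯t_r·σ = 1`, and the generated subgroup is transitive on `{1,…,k}`. -/
noncomputable def hurwitzCount0 (k r : ℕ) (α : Multiset ℕ) : ℕ :=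
  Nat.card {T : (Fin r → Equiv.Perm (Fin k)) × Equiv.Perm (Fin k) //
    (∀ i, (T.1 i).IsSwap) ∧
    fullCycleType T.2 = α ∧
    (List.ofFn T.1).prod * T.2 = 1 ∧
    ∀ x y : Fin k, ∃ g ∈ Subgroup.closure (Set.range T.1 ∪ {T.2}), g x = y}

/-- The Hurwitz number `μ_{0,m}^{g,k}(α)` over the sphere (`h = 0`), with
`m = α.card` and `r = k + m - 2 + 2g` transpositions. -/
noncomputable def hurwitzSphere (g k : ℕ) (α : Multiset ℕ) : ℚ :=
  (hurwitzCount0 k (k + α.card - 2 + 2 * g) α : ℚ) / k.factorial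

/-- `|c_α|`, the cardinality of the conjugacy class of `S_k` of cycle type
`α`: `k!/(Π_i α_i · Π_j m_j!)` where `m_j` is the multiplicity of `j` in `α`. -/
noncomputable def conjClassCard (k : ℕ) (α : Multiset ℕ) : ℚ :=
  (k.factorial : ℚ) /
    ((α.prod : ℚ) * ∏ j ∈ α.toFinset, ((α.count j).factorial : ℚ))

namespace HurwitzGenusOne

open PowerSeries Finset

section Lagrange

variable {R : Type*} [CommRing R]

/-- The Euler operator `z d/dz` on formal power series. -/
noncomputable def euler : Derivation R R⟦X⟧ R⟦X⟧ := (X : R⟦X⟧) • PowerSeries.derivative R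

@[simp] lemma coeff_euler (f : R⟦X⟧) (n : ℕ) : coeff n (euler f) = n * coeff n f := by
  cases n with
  | zero => simp [euler]
  | succ n => simp [euler, coeff_succ_X_mul, coeff_derivative, mul_comm]

lemma euler_mul (f g : R⟦X⟧) : euler (f * g) = euler f * g + f * euler g := by
  rw [Derivation.leibniz, smul_eq_mul, smul_eq_mul]; ring

lemma euler_X_pow (n : ℕ) : euler (X ^ n : R⟦X⟧) = (n : R⟦X⟧) * X ^ n := by
  ext k
  rw [coeff_euler, ← map_natCast (C (R := R)), coeff_C_mul, coeff_X_pow]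
  split_ifs with h
  · rw [h]
  · simp

lemma euler_pow (f : R⟦X⟧) (n : ℕ) : f * euler (f ^ n) = (n : R⟦X⟧) * f ^ n * euler f := by
  cases n with
  | zero => simp
  | succ n =>
    rw [Derivation.leibniz_pow, nsmul_eq_mul, smul_eq_mul, Nat.add_sub_cancel]; ring

/-- The composition of `g` with the solution `s` of `s = z exp (ψ s)`, given through Lagrange's
formula `[z^k] g(s) = [z^k] g (1 - zψ') E^k`, where `E = exp ψ`. -/
noncomputable def lagrange (ψ E g : R⟦X⟧) : R⟦X⟧ :=
  PowerSeries.mk fun k => coeff k (g * (1 - euler ψ) * E ^ k)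

variable {ψ E Y : R⟦X⟧}

lemma coeff_lagrange (g : R⟦X⟧) (k : ℕ) :
    coeff k (lagrange ψ E g) = coeff k (g * (1 - euler ψ) * E ^ k) := coeff_mk _ _

lemma lagrange_add (g h : R⟦X⟧) : lagrange ψ E (g + h) = lagrange ψ E g + lagrange ψ E h := by
  ext k; simp [coeff_lagrange, add_mul]

lemma lagrange_sub (g h : R⟦X⟧) : lagrange ψ E (g - h) = lagrange ψ E g - lagrange ψ E h := by
  ext k; simp [coeff_lagrange, sub_mul]

lemma lagrange_C_mul (r : R) (g : R⟦X⟧) : lagrange ψ E (C r * g) = C r * lagrange ψ E g := by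
  ext k; simp [coeff_lagrange, mul_assoc]

lemma lagrange_X_pow_dvd {a : ℕ} {g : R⟦X⟧} (h : X ^ a ∣ g) : X ^ a ∣ lagrange ψ E g := by
  rw [X_pow_dvd_iff]
  intro m hm
  rw [coeff_lagrange]
  exact X_pow_dvd_iff.1 (Dvd.dvd.mul_right (Dvd.dvd.mul_right h _) _) m hm

lemma coeff_lagrange_X_pow_self (hE0 : constantCoeff E = 1) (a : ℕ) :
    coeff a (lagrange ψ E (X ^ a)) = 1 := by
  rw [coeff_lagrange, mul_assoc]
  have := coeff_X_pow_mul ((1 - euler ψ) * E ^ a) a 0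
  rw [zero_add] at this
  rw [this]
  have h0 : constantCoeff (euler ψ) = 0 := by
    rw [← coeff_zero_eq_constantCoeff_apply, coeff_euler]; simp
  simp [hE0, h0]

set_option maxHeartbeats 1600000 in
lemma coeff_lagrange_mul_of_succ (k a b : ℕ)
    (ihl : ∀ g h : R⟦X⟧, coeff k (lagrange ψ E (X ^ (a + 1) * g * (X ^ b * h)))
      = coeff k (lagrange ψ E (X ^ (a + 1) * g) * lagrange ψ E (X ^ b * h)))
    (ihr : ∀ g h : R⟦X⟧, coeff k (lagrange ψ E (X ^ a * g * (X ^ (b + 1) * h)))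
      = coeff k (lagrange ψ E (X ^ a * g) * lagrange ψ E (X ^ (b + 1) * h)))
    (base : coeff k (lagrange ψ E (X ^ a * X ^ b))
      = coeff k (lagrange ψ E (X ^ a) * lagrange ψ E (X ^ b))) (g h : R⟦X⟧) :
    coeff k (lagrange ψ E (X ^ a * g * (X ^ b * h)))
      = coeff k (lagrange ψ E (X ^ a * g) * lagrange ψ E (X ^ b * h)) := by
  obtain ⟨g1, hg1⟩ : X ∣ g - C (constantCoeff g) := by rw [X_dvd_iff]; simp
  obtain ⟨h1, hh1⟩ : X ∣ h - C (constantCoeff h) := by rw [X_dvd_iff]; simp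
  have hg : X ^ a * g = C (constantCoeff g) * X ^ a + X ^ (a + 1) * g1 := by
    linear_combination (X ^ a) * hg1
  have hh : X ^ b * h = C (constantCoeff h) * X ^ b + X ^ (b + 1) * h1 := by
    linear_combination (X ^ b) * hh1
  have i1 := ihl g1 h
  have i2 := ihr 1 h1
  rw [mul_one] at i2
  rw [hg, add_mul, lagrange_add, lagrange_add, add_mul, map_add, map_add, i1]
  congr 1
  rw [hh, mul_add, lagrange_add, lagrange_add, mul_add, map_add, map_add]
  congr 1
  · rw [show C (constantCoeff g) * X ^ a * (C (constantCoeff h) * X ^ b)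
        = C (constantCoeff g) * (C (constantCoeff h) * (X ^ a * X ^ b)) by ring,
      lagrange_C_mul, lagrange_C_mul, lagrange_C_mul, lagrange_C_mul, coeff_C_mul, coeff_C_mul,
      base, mul_assoc, mul_left_comm _ (C (constantCoeff h)), coeff_C_mul, coeff_C_mul]
  · rw [mul_assoc, lagrange_C_mul, lagrange_C_mul, coeff_C_mul, i2, mul_assoc, coeff_C_mul]

variable [IsDomain R] [CharZero R]

lemma coeff_euler_mul_pow (hE : euler E = euler ψ * E) (hE0 : constantCoeff E = 1)
    (g : R⟦X⟧) (k : ℕ) :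
    coeff k (euler g * E ^ k) = k * coeff k (lagrange ψ E g) := by
  have hE1 : E ≠ 0 := by rintro rfl; simp at hE0
  have h1 : euler (E ^ k) = (k : R⟦X⟧) * euler ψ * E ^ k := by
    apply mul_left_cancel₀ hE1
    rw [euler_pow, hE]; ring
  have h2 : coeff k (euler (g * E ^ k)) = k * coeff k (g * E ^ k) := coeff_euler _ _
  rw [euler_mul, h1] at h2
  rw [coeff_lagrange, show g * (1 - euler ψ) * E ^ k = g * E ^ k - g * euler ψ * E ^ k by ring,
    map_sub, mul_sub, ← h2]
  rw [show g * ((k : R⟦X⟧) * euler ψ * E ^ k) = C (k : R) * (g * euler ψ * E ^ k) by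
    rw [map_natCast]; ring]
  rw [map_add, coeff_C_mul]; ring

lemma euler_lagrange (hE : euler E = euler ψ * E) (hE0 : constantCoeff E = 1)
    {g h : R⟦X⟧} (hgh : euler g = h * (1 - euler ψ)) :
    euler (lagrange ψ E g) = lagrange ψ E h := by
  ext k
  rw [coeff_euler, ← coeff_euler_mul_pow hE hE0, hgh, coeff_lagrange]

lemma coeff_lagrange_X_pow_mul_X_pow (hE : euler E = euler ψ * E)
    (hE0 : constantCoeff E = 1) (hY : (1 - euler ψ) * (1 + X * Y) = 1) (k a b : ℕ)
    (ihl : ∀ g h : R⟦X⟧, coeff k (lagrange ψ E (X ^ (a + 1) * g * (X ^ b * h)))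
      = coeff k (lagrange ψ E (X ^ (a + 1) * g) * lagrange ψ E (X ^ b * h)))
    (ihr : ∀ g h : R⟦X⟧, coeff k (lagrange ψ E (X ^ a * g * (X ^ (b + 1) * h)))
      = coeff k (lagrange ψ E (X ^ a * g) * lagrange ψ E (X ^ (b + 1) * h))) :
    coeff k (lagrange ψ E (X ^ a * X ^ b))
      = coeff k (lagrange ψ E (X ^ a) * lagrange ψ E (X ^ b)) := by
  by_cases hlt : k < a + b
  · have h1 : X ^ (a + b) ∣ lagrange ψ E (X ^ a * X ^ b) :=
      lagrange_X_pow_dvd ⟨1, by ring⟩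
    have h2 : X ^ (a + b) ∣ lagrange ψ E (X ^ a) * lagrange ψ E (X ^ b) := by
      rw [pow_add]
      exact mul_dvd_mul (lagrange_X_pow_dvd dvd_rfl) (lagrange_X_pow_dvd dvd_rfl)
    rw [X_pow_dvd_iff.1 h1 k hlt, X_pow_dvd_iff.1 h2 k hlt]
  by_cases heq : k = a + b
  · subst heq
    rw [← pow_add, coeff_lagrange_X_pow_self hE0]
    obtain ⟨u, hu⟩ := lagrange_X_pow_dvd (ψ := ψ) (E := E) (dvd_refl (X ^ a : R⟦X⟧))
    obtain ⟨v, hv⟩ := lagrange_X_pow_dvd (ψ := ψ) (E := E) (dvd_refl (X ^ b : R⟦X⟧))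
    have hu' := coeff_lagrange_X_pow_self (ψ := ψ) hE0 a
    have hv' := coeff_lagrange_X_pow_self (ψ := ψ) hE0 b
    rw [hu] at hu' ⊢
    rw [hv] at hv' ⊢
    have e1 := coeff_X_pow_mul u a 0
    have e2 := coeff_X_pow_mul v b 0
    have e3 := coeff_X_pow_mul (u * v) (a + b) 0
    rw [zero_add] at e1 e2 e3
    rw [show X ^ a * u * (X ^ b * v) = X ^ (a + b) * (u * v) by ring, e3]
    rw [e1] at hu'
    rw [e2] at hv'
    simp only [coeff_zero_eq_constantCoeff, map_mul] at hu' hv' ⊢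
    rw [hu', hv', one_mul]
  have hder : ∀ n : ℕ, euler (X ^ n : R⟦X⟧)
      = (C (n : R) * X ^ n + X ^ (n + 1) * (C (n : R) * Y)) * (1 - euler ψ) := by
    intro n
    rw [euler_X_pow, map_natCast]
    linear_combination (-(n : R⟦X⟧) * X ^ n) * hY
  have d1 := congrArg (coeff k) (euler_lagrange hE hE0 (hder a))
  have hprod : euler (X ^ a * X ^ b : R⟦X⟧)
      = ((C (a : R) * X ^ a + X ^ (a + 1) * (C (a : R) * Y)) * X ^ b
        + X ^ a * (C (b : R) * X ^ b + X ^ (b + 1) * (C (b : R) * Y))) * (1 - euler ψ) := by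
    rw [euler_mul, hder a, hder b]; ring
  have e1 := congrArg (coeff k) (euler_lagrange hE hE0 hprod)
  have e2 : coeff k (euler (lagrange ψ E (X ^ a) * lagrange ψ E (X ^ b)))
      = k * coeff k (lagrange ψ E (X ^ a) * lagrange ψ E (X ^ b)) := coeff_euler _ _
  rw [euler_mul, euler_lagrange hE hE0 (hder a), euler_lagrange hE hE0 (hder b)] at e2
  have i1 := ihl (C (a : R) * Y) 1
  have i2 := ihr 1 (C (b : R) * Y)
  simp only [mul_one] at i1 i2
  rw [coeff_euler, show (C (a : R) * X ^ a + X ^ (a + 1) * (C (a : R) * Y)) * X ^ b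
        + X ^ a * (C (b : R) * X ^ b + X ^ (b + 1) * (C (b : R) * Y))
        = C (a : R) * (X ^ a * X ^ b) + X ^ (a + 1) * (C (a : R) * Y) * X ^ b
        + (C (b : R) * (X ^ a * X ^ b) + X ^ a * (X ^ (b + 1) * (C (b : R) * Y))) by ring,
    lagrange_add, lagrange_add, lagrange_add, lagrange_C_mul, lagrange_C_mul, map_add,
    map_add, map_add, i1, i2, coeff_C_mul, coeff_C_mul] at e1
  rw [lagrange_add, lagrange_add, lagrange_C_mul, lagrange_C_mul, add_mul, mul_add, mul_assoc,
    mul_left_comm _ (C (b : R)), map_add, map_add, map_add, coeff_C_mul, coeff_C_mul] at e2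
  have hne : (k : R) - a - b ≠ 0 := by
    intro h0
    have : (k : R) = ((a + b : ℕ) : R) := by push_cast; linear_combination h0
    exact heq (Nat.cast_injective this)
  apply mul_left_cancel₀ hne
  linear_combination e1 + e2

lemma lagrange_mul (hE : euler E = euler ψ * E) (hE0 : constantCoeff E = 1) (g h : R⟦X⟧) :
    lagrange ψ E (g * h) = lagrange ψ E g * lagrange ψ E h := by
  ext k
  obtain ⟨Y, hY⟩ : ∃ Y : R⟦X⟧, (1 - euler ψ) * (1 + X * Y) = 1 := by
    have h0 : constantCoeff (1 - euler ψ) = 1 := by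
      have : constantCoeff (euler ψ) = 0 := by
        rw [← coeff_zero_eq_constantCoeff_apply, coeff_euler]; simp
      simp [this]
    have h1 : (1 - euler ψ) * invOfUnit (1 - euler ψ) 1 = 1 :=
      mul_invOfUnit _ _ (by simp [h0])
    have h2 : X ∣ invOfUnit (1 - euler ψ) 1 - 1 := by
      rw [X_dvd_iff]; simp
    obtain ⟨Y, hY⟩ := h2
    exact ⟨Y, by rw [← hY]; simpa using h1⟩
  have key : ∀ d a b : ℕ, k < a + b + d → ∀ g h : R⟦X⟧,
      coeff k (lagrange ψ E (X ^ a * g * (X ^ b * h)))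
        = coeff k (lagrange ψ E (X ^ a * g) * lagrange ψ E (X ^ b * h)) := by
    intro d
    induction d with
    | zero =>
      intro a b hab g h
      have h1 : X ^ (a + b) ∣ lagrange ψ E (X ^ a * g * (X ^ b * h)) :=
        lagrange_X_pow_dvd ⟨g * h, by ring⟩
      have h2 : X ^ (a + b) ∣ lagrange ψ E (X ^ a * g) * lagrange ψ E (X ^ b * h) := by
        rw [pow_add]
        exact mul_dvd_mul (lagrange_X_pow_dvd ⟨g, rfl⟩) (lagrange_X_pow_dvd ⟨h, rfl⟩)
      rw [X_pow_dvd_iff.1 h1 k (by omega), X_pow_dvd_iff.1 h2 k (by omega)]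
    | succ d ih =>
      intro a b hab g h
      have ihl : ∀ g h : R⟦X⟧, coeff k (lagrange ψ E (X ^ (a + 1) * g * (X ^ b * h)))
          = coeff k (lagrange ψ E (X ^ (a + 1) * g) * lagrange ψ E (X ^ b * h)) :=
        ih (a + 1) b (by omega)
      have ihr : ∀ g h : R⟦X⟧, coeff k (lagrange ψ E (X ^ a * g * (X ^ (b + 1) * h)))
          = coeff k (lagrange ψ E (X ^ a * g) * lagrange ψ E (X ^ (b + 1) * h)) :=
        ih a (b + 1) (by omega)
      have base := coeff_lagrange_X_pow_mul_X_pow hE hE0 hY k a b ihl ihr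
      exact coeff_lagrange_mul_of_succ k a b ihl ihr base g h
  simpa using key (k + 1) 0 0 (by omega) g h

end Lagrange

end HurwitzGenusOne

namespace HurwitzGenusOne

open PowerSeries Finset

section TreeFunction

/-- The numbers `n^n/n!`, except that the value at `0` is `0`. -/
noncomputable def treeCoeff (n : ℕ) : ℚ := if n = 0 then 0 else (n : ℚ) ^ n / n.factorial

local notation "u" => treeCoeff

@[simp] lemma treeCoeff_zero : u 0 = 0 := by simp [treeCoeff]

lemma treeCoeff_of_ne_zero {n : ℕ} (h : n ≠ 0) : u n = (n : ℚ) ^ n / n.factorial := by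
  simp [treeCoeff, h]

/-- The generating function of `n^n/n!`, `n ≥ 1`. -/
noncomputable def treeU : ℚ⟦X⟧ := PowerSeries.mk treeCoeff

/-- Cayley's tree function, the generating function of `n^(n-1)/n!`. -/
noncomputable def treeT : ℚ⟦X⟧ := PowerSeries.mk fun n => u n / n

lemma euler_exp : euler (exp ℚ) = euler X * exp ℚ := by
  ext n
  have : (euler X : ℚ⟦X⟧) = X := by simpa using euler_X_pow (R := ℚ) 1
  rw [this, coeff_euler]
  cases n with
  | zero => simp
  | succ n =>
    rw [coeff_succ_X_mul, coeff_exp, coeff_exp, Nat.factorial_succ]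
    simp only [eq_ratCast, Rat.cast_id]
    push_cast
    field_simp

lemma coeff_exp_pow (k n : ℕ) : coeff n (exp ℚ ^ k) = (k : ℚ) ^ n / n.factorial := by
  rw [exp_pow_eq_rescale_exp, coeff_rescale, coeff_exp]
  simp [div_eq_mul_inv]

/-- The substitution `z ↦ T(z)`, where `T = z exp T`. -/
noncomputable def treeSubst (g : ℚ⟦X⟧) : ℚ⟦X⟧ := lagrange X (exp ℚ) g

lemma treeSubst_mul (g h : ℚ⟦X⟧) : treeSubst (g * h) = treeSubst g * treeSubst h :=
  lagrange_mul euler_exp (by simp) g h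

lemma euler_X : (euler X : ℚ⟦X⟧) = X := by simpa using euler_X_pow (R := ℚ) 1

lemma treeSubst_one : treeSubst 1 = 1 := by
  ext k
  rcases Nat.eq_zero_or_pos k with rfl | hk
  · simp [treeSubst, coeff_lagrange, euler_X]
  · have := coeff_euler_mul_pow euler_exp (by simp) (1 : ℚ⟦X⟧) k
    have hk' : (k : ℚ) ≠ 0 := by positivity
    rw [show euler (1 : ℚ⟦X⟧) = 0 from Derivation.map_one_eq_zero _] at this
    rw [coeff_one, if_neg hk.ne']
    simpa [hk', treeSubst] using this.symm

lemma treeSubst_of_mul_eq {g h : ℚ⟦X⟧} (hg : g * (1 - X) = h) (k : ℕ) :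
    coeff k (treeSubst g) = coeff k (h * exp ℚ ^ k) := by
  rw [treeSubst, coeff_lagrange, euler_X, hg]

lemma treeSubst_X : treeSubst X = treeT := by
  ext k
  rcases Nat.eq_zero_or_pos k with rfl | hk
  · simp [treeSubst, coeff_lagrange, euler_X, treeT]
  · have := coeff_euler_mul_pow euler_exp (by simp) (X : ℚ⟦X⟧) k
    have hk' : (k : ℚ) ≠ 0 := by positivity
    obtain ⟨m, rfl⟩ := Nat.exists_eq_succ_of_ne_zero hk.ne'
    rw [euler_X, coeff_succ_X_mul, coeff_exp_pow] at this
    rw [treeT, coeff_mk, treeCoeff_of_ne_zero (by omega), treeSubst,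
      ← mul_right_inj' hk', ← this, Nat.factorial_succ]
    push_cast
    field_simp
    rw [pow_succ']

lemma exists_inv_one_sub_X : ∃ g : ℚ⟦X⟧, g * (1 - X) = 1 :=
  ⟨invOfUnit (1 - X) 1, by rw [mul_comm]; exact mul_invOfUnit _ _ (by simp)⟩

lemma treeSubst_inv {g : ℚ⟦X⟧} (hg : g * (1 - X) = 1) : treeSubst g = 1 + treeU := by
  ext k
  rw [treeSubst_of_mul_eq hg, one_mul, coeff_exp_pow, map_add, treeU, coeff_mk, coeff_one]
  rcases Nat.eq_zero_or_pos k with rfl | hk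
  · simp
  · rw [treeCoeff_of_ne_zero hk.ne', if_neg hk.ne', zero_add]

lemma one_add_treeU_mul : (1 + treeU) * (1 - treeT) = 1 := by
  obtain ⟨g, hg⟩ := exists_inv_one_sub_X
  rw [← treeSubst_inv hg, ← treeSubst_X, ← treeSubst_one, treeSubst, treeSubst, treeSubst,
    ← lagrange_sub]
  exact (treeSubst_mul g (1 - X)).symm.trans (by rw [hg]; rfl)

lemma euler_treeT : euler treeT = treeU := by
  ext n
  rw [coeff_euler, treeT, treeU, coeff_mk, coeff_mk]
  rcases Nat.eq_zero_or_pos n with rfl | hk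
  · simp
  · field_simp

lemma euler_treeU : euler treeU = (1 + treeU) ^ 2 * treeU := by
  have h := congrArg euler one_add_treeU_mul
  have h1 : euler (1 : ℚ⟦X⟧) = 0 := Derivation.map_one_eq_zero _
  rw [euler_mul, map_add, map_sub, h1, euler_treeT] at h
  have h2 := one_add_treeU_mul
  linear_combination (1 + treeU) * h - euler treeU * h2

lemma treeT_mul_treeU : treeT * treeU = treeU - treeT := by
  linear_combination -one_add_treeU_mul

lemma treeT_mul_euler_treeU : treeT * euler treeU = euler treeU - treeU ^ 2 - treeU := by
  rw [euler_treeU]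
  linear_combination (treeU + treeU ^ 2) * treeT_mul_treeU

lemma euler_euler_treeU :
    euler (euler treeU) = (1 + treeU) * (1 + 3 * treeU) * euler treeU := by
  have h1 : euler (1 : ℚ⟦X⟧) = 0 := Derivation.map_one_eq_zero _
  have h2 : euler treeU = treeU + 2 * (treeU * treeU) + treeU * (treeU * treeU) := by
    rw [euler_treeU]; ring
  have h3 : euler (2 : ℚ⟦X⟧) = 0 := by
    rw [show (2 : ℚ⟦X⟧) = 1 + 1 by norm_num, map_add, h1, add_zero]
  conv_lhs => rw [h2]
  simp only [map_add, euler_mul, h3]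
  ring

lemma twelve_mul_euler_treeU_sq :
    12 * (euler treeU * euler treeU) = euler (C (3 / 2) * euler (treeU ^ 2) + 2 * euler treeU
      - treeU ^ 2 - 2 * treeU) := by
  have h1 : euler (1 : ℚ⟦X⟧) = 0 := Derivation.map_one_eq_zero _
  have h3 : euler (2 : ℚ⟦X⟧) = 0 := by
    rw [show (2 : ℚ⟦X⟧) = 1 + 1 by norm_num, map_add, h1, add_zero]
  have h4 : euler (C (3 / 2 : ℚ)) = 0 := by
    ext n; rw [coeff_euler, coeff_C]; split_ifs with h <;> simp [h]
  have h5 : 2 * C (3 / 2 : ℚ) = 3 := by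
    rw [← map_ofNat C 2, ← map_mul, ← map_ofNat C 3]; norm_num
  rw [show treeU ^ 2 = treeU * treeU by ring]
  simp only [map_add, map_sub, euler_mul, h3, h4, euler_euler_treeU]
  linear_combination -(euler treeU * euler treeU
    + treeU * ((1 + treeU) * (1 + 3 * treeU) * euler treeU)) * h5 + 9 * euler treeU * euler_treeU

lemma treeT_mul_euler_euler_sub :
    treeT * (euler (euler treeU) - euler treeU) = euler (euler treeU) - treeU
      - (C (3 / 2) * euler (treeU ^ 2) + 2 * euler treeU - treeU ^ 2 - 2 * treeU) := by
  have h5 : 2 * C (3 / 2 : ℚ) = 3 := by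
    rw [← map_ofNat C 2, ← map_mul, ← map_ofNat C 3]; norm_num
  have h6 := treeT_mul_euler_treeU
  rw [show treeU ^ 2 = treeU * treeU by ring, euler_mul, euler_euler_treeU]
  linear_combination ((1 + treeU) * (1 + 3 * treeU) - 1) * h6 + (treeU * euler treeU) * h5
    + (1 + 3 * treeU) * euler_treeU

/-- The coefficients of the square of `∑ n^n/n! zⁿ`. -/
noncomputable def treeSq (n : ℕ) : ℚ := ∑ p ∈ antidiagonal n, u p.1 * u p.2

local notation "r" => treeSq

lemma coeff_treeU_sq (n : ℕ) : coeff n (treeU ^ 2) = r n := by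
  rw [sq, coeff_mul]; simp [treeU, treeSq]

/-- Twelve times the coefficients of the primitive of the square of `∑ n·n^n/n! zⁿ`. -/
noncomputable def treePrim (n : ℕ) : ℚ := 3 / 2 * (n * r n) + 2 * (n * u n) - r n - 2 * u n

lemma coeff_treePrim (n : ℕ) :
    coeff n (C (3 / 2) * euler (treeU ^ 2) + 2 * euler treeU - treeU ^ 2 - 2 * treeU)
      = treePrim n := by
  rw [← map_ofNat C 2]
  simp only [map_add, map_sub, coeff_C_mul, coeff_euler, coeff_treeU_sq, treePrim]
  simp [treeU]

lemma coeff_treeU (n : ℕ) : coeff n treeU = u n := coeff_mk _ _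

@[simp] lemma constantCoeff_treeU : constantCoeff treeU = 0 := by
  rw [← coeff_zero_eq_constantCoeff_apply, coeff_treeU, treeCoeff_zero]

lemma coeff_treeT (n : ℕ) : coeff n treeT = u n / n := coeff_mk _ _

lemma sum_div_mul (n : ℕ) :
    ∑ p ∈ antidiagonal n, u p.1 / p.1 * u p.2 = u n - u n / n := by
  have := congrArg (coeff n) treeT_mul_treeU
  rw [coeff_mul] at this
  simpa only [map_sub, coeff_treeU, coeff_treeT] using this

lemma sum_div_mul_id (n : ℕ) :
    ∑ p ∈ antidiagonal n, u p.1 / p.1 * (p.2 * u p.2) = n * u n - r n - u n := by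
  have := congrArg (coeff n) treeT_mul_euler_treeU
  rw [coeff_mul] at this
  simpa only [map_sub, coeff_euler, coeff_treeU, coeff_treeT, coeff_treeU_sq] using this

lemma sum_div_mul_sq (n : ℕ) :
    ∑ p ∈ antidiagonal n, u p.1 / p.1 * (p.2 * (p.2 * u p.2) - p.2 * u p.2)
      = n * (n * u n) - u n - treePrim n := by
  have := congrArg (coeff n) treeT_mul_euler_euler_sub
  rw [coeff_mul, map_sub, coeff_treePrim] at this
  simpa only [map_sub, coeff_euler, coeff_treeU, coeff_treeT, coeff_treeU_sq] using this

lemma twelve_mul_sum_mul (n : ℕ) :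
    12 * ∑ p ∈ antidiagonal n, p.1 * u p.1 * (p.2 * u p.2) = n * treePrim n := by
  have := congrArg (coeff n) twelve_mul_euler_treeU_sq
  rw [← map_ofNat C 12, coeff_C_mul, coeff_mul, coeff_euler, coeff_treePrim] at this
  simpa only [map_sub, coeff_euler, coeff_treeU, coeff_treeT, coeff_treeU_sq] using this

/-- The kernel `∑_{i+j=n} l u_l u_i u_j / (i+l)`. -/
noncomputable def treeKernel (n l : ℕ) : ℚ :=
  ∑ p ∈ antidiagonal n, l * u l * u p.1 / (p.1 + l) * u p.2

/-- The exponential series in `l z` truncated from below at degree `l`, divided by `z^l`. -/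
noncomputable def expTail (l : ℕ) : ℚ⟦X⟧ :=
  PowerSeries.mk fun p => (l : ℚ) ^ (p + l) / (p + l).factorial

lemma euler_expTail (l : ℕ) (hl : l ≠ 0) :
    euler (expTail l) + C (l : ℚ) * (expTail l * (1 - X)) = C (l * u l) := by
  rw [show C (l : ℚ) * (expTail l * (1 - X))
    = C (l : ℚ) * expTail l - C (l : ℚ) * (X * expTail l) by ring]
  ext n
  rw [map_add, map_sub, coeff_euler, coeff_C_mul, coeff_C_mul, coeff_C]
  cases n with
  | zero => simp [expTail, treeCoeff_of_ne_zero hl]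
  | succ n =>
    rw [coeff_succ_X_mul, expTail, coeff_mk, coeff_mk, if_neg (by omega),
      show n + 1 + l = n + l + 1 by ring, Nat.factorial_succ]
    push_cast
    field_simp
    ring

lemma coeff_treeSubst_expTail (l : ℕ) (hl : l ≠ 0) (i : ℕ) :
    coeff i (treeSubst (expTail l)) = l * u l * coeff i (1 + treeU) / (i + l) := by
  obtain ⟨g, hg⟩ := exists_inv_one_sub_X
  have h1 : euler (expTail l) = (euler (expTail l) * g) * (1 - euler X) := by
    rw [euler_X, mul_assoc, hg, mul_one]
  have h2 := congrArg (coeff i) (euler_lagrange euler_exp (by simp) h1)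
  have h3 : euler (expTail l) * g = C (l * u l) * g - C (l : ℚ) * expTail l := by
    rw [← euler_expTail l hl]
    linear_combination (-C (l : ℚ) * expTail l) * hg
  rw [h3, lagrange_sub, lagrange_C_mul, lagrange_C_mul] at h2
  change _ = coeff i (_ * treeSubst g - _ * treeSubst (expTail l)) at h2
  rw [treeSubst_inv hg, coeff_euler, map_sub, coeff_C_mul, coeff_C_mul] at h2
  change i * coeff i (treeSubst (expTail l)) = _ at h2
  have hl' : (i : ℚ) + l ≠ 0 := by positivity
  field_simp
  linear_combination h2

lemma sum_expTail (n l : ℕ) (hl : l ≠ 0) :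
    ∑ p ∈ antidiagonal n, l * u l * coeff p.1 (1 + treeU) / (p.1 + l) * coeff p.2 (1 + treeU)
      = ∑ p ∈ antidiagonal n, (l : ℚ) ^ (p.1 + l) / (p.1 + l).factorial
          * ((n : ℚ) ^ p.2 / p.2.factorial) := by
  obtain ⟨g, hg⟩ := exists_inv_one_sub_X
  have h := treeSubst_of_mul_eq (g := expTail l * g) (h := expTail l)
    (by rw [mul_assoc, hg, mul_one]) n
  rw [treeSubst_mul, treeSubst_inv hg, coeff_mul, coeff_mul] at h
  simp only [coeff_treeSubst_expTail l hl, coeff_exp_pow] at h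
  simpa only [expTail, coeff_mk] using h

lemma sum_expTail_eq_sum (n l : ℕ) :
    ∑ p ∈ antidiagonal n, (l : ℚ) ^ (p.1 + l) / (p.1 + l).factorial
          * ((n : ℚ) ^ p.2 / p.2.factorial)
      = ∑ q ∈ (range (n + 1)), (l : ℚ) ^ (n + l - q) / (n + l - q).factorial
          * ((n : ℚ) ^ q / q.factorial) := by
  rw [← Nat.sum_antidiagonal_swap, Nat.sum_antidiagonal_eq_sum_range_succ_mk]
  refine sum_congr rfl fun q hq => ?_
  have : q ≤ n := by simpa [Nat.lt_succ_iff] using hq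
  simp only [Prod.fst_swap, Prod.snd_swap]
  rw [show n - q + l = n + l - q by omega]

lemma sum_expTail_add (n l : ℕ) :
    ∑ p ∈ antidiagonal n, (l : ℚ) ^ (p.1 + l) / (p.1 + l).factorial
          * ((n : ℚ) ^ p.2 / p.2.factorial)
      + ∑ p ∈ antidiagonal l, (n : ℚ) ^ (p.1 + n) / (p.1 + n).factorial
          * ((l : ℚ) ^ p.2 / p.2.factorial)
      = ((n + l : ℕ) : ℚ) ^ (n + l) / (n + l).factorial
        + (n : ℚ) ^ n / n.factorial * ((l : ℚ) ^ l / l.factorial) := by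
  have hN : ((n + l : ℕ) : ℚ) ^ (n + l) / (n + l).factorial
      = ∑ q ∈ range (n + l + 1), (l : ℚ) ^ (n + l - q) / (n + l - q).factorial
          * ((n : ℚ) ^ q / q.factorial) := by
    push_cast
    rw [add_pow, sum_div]
    refine sum_congr rfl fun q hq => ?_
    have hq' : q ≤ n + l := by simpa [Nat.lt_succ_iff] using hq
    rw [Nat.cast_choose ℚ hq']
    field_simp
  have h2 : ∑ p ∈ antidiagonal l, (n : ℚ) ^ (p.1 + n) / (p.1 + n).factorial
          * ((l : ℚ) ^ p.2 / p.2.factorial)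
      = ∑ j ∈ range (l + 1), (l : ℚ) ^ (n + l - (n + j)) / (n + l - (n + j)).factorial
          * ((n : ℚ) ^ (n + j) / (n + j).factorial) := by
    rw [Nat.sum_antidiagonal_eq_sum_range_succ_mk]
    refine sum_congr rfl fun q hq => ?_
    simp only
    rw [show n + l - (n + q) = l - q by omega, add_comm q n]
    ring
  rw [sum_expTail_eq_sum, h2, hN, sum_range_succ _ n, add_assoc n l 1, sum_range_add _ n (l + 1),
    Nat.add_sub_cancel_left]
  ring

lemma treeKernel_add_treeKernel {n l : ℕ} (hn : n ≠ 0) (hl : l ≠ 0) :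
    treeKernel n l + treeKernel l n = u (n + l) - 2 * u n * u l := by
  have key : ∀ n l : ℕ, n ≠ 0 → l ≠ 0 →
      ∑ p ∈ antidiagonal n, l * u l * coeff p.1 (1 + treeU) / (p.1 + l) * coeff p.2 (1 + treeU)
        = treeKernel n l + u l * u n + l * u l * u n / (n + l) := by
    intro n l hn hl
    obtain ⟨n, rfl⟩ := Nat.exists_eq_succ_of_ne_zero hn
    cases n with
    | zero =>
      have : antidiagonal (Nat.succ 0) = {(0, 1), (1, 0)} := rfl
      rw [treeKernel, this, sum_pair (by simp), sum_pair (by simp)]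
      simp [coeff_treeU, coeff_one]
      left
      field_simp
    | succ n =>
      rw [treeKernel, Nat.sum_antidiagonal_succ, Nat.sum_antidiagonal_succ',
        Nat.sum_antidiagonal_succ, Nat.sum_antidiagonal_succ']
      simp [coeff_treeU, coeff_one]
      field_simp
      ring
  have h := sum_expTail_add n l
  rw [← sum_expTail n l hl, ← sum_expTail l n hn, key n l hn hl, key l n hl hn,
    ← treeCoeff_of_ne_zero hn, ← treeCoeff_of_ne_zero hl, ← treeCoeff_of_ne_zero (by omega)] at h
  have h2 : (l : ℚ) * u l * u n / (n + l) + n * u n * u l / (l + n) = u n * u l := by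
    have : (n : ℚ) + l ≠ 0 := by positivity
    rw [add_comm (l : ℚ) n]
    field_simp
    ring
  linear_combination h - h2

/-- The kernel `∑_{i+j=n} l u_l u_i (j u_j) / (i+l)`. -/
noncomputable def treeKernelOne (n l : ℕ) : ℚ :=
  ∑ p ∈ antidiagonal n, l * u l * u p.1 / (p.1 + l) * (p.2 * u p.2)

/-- The kernel `∑_{i+j=n} l u_l u_i (j² u_j) / (i+l)`. -/
noncomputable def treeKernelTwo (n l : ℕ) : ℚ :=
  ∑ p ∈ antidiagonal n, l * u l * u p.1 / (p.1 + l) * (p.2 * (p.2 * u p.2))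

lemma treeKernelOne_eq {l : ℕ} (hl : l ≠ 0) (n : ℕ) :
    treeKernelOne n l = (n + l) * treeKernel n l - l * u l * r n := by
  rw [treeKernelOne, treeKernel, treeSq, mul_sum, mul_sum, ← sum_sub_distrib]
  refine sum_congr rfl fun p hp => ?_
  rw [HasAntidiagonal.mem_antidiagonal] at hp
  have h1 : (p.1 : ℚ) + l ≠ 0 := by positivity
  rw [← hp]
  push_cast
  field_simp
  ring

lemma sum_mul_id (n : ℕ) : ∑ p ∈ antidiagonal n, u p.1 * (p.2 * u p.2) = n / 2 * r n := by
  have h : ∑ p ∈ antidiagonal n, u p.1 * (p.2 * u p.2)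
      = ∑ p ∈ antidiagonal n, p.1 * (u p.1 * u p.2) := by
    rw [← Nat.sum_antidiagonal_swap]
    refine sum_congr rfl fun p _ => ?_
    simp only [Prod.fst_swap, Prod.snd_swap]
    ring
  have h2 : ∑ p ∈ antidiagonal n, u p.1 * (p.2 * u p.2)
      + ∑ p ∈ antidiagonal n, p.1 * (u p.1 * u p.2) = n * r n := by
    rw [← sum_add_distrib, treeSq, mul_sum]
    refine sum_congr rfl fun p hp => ?_
    rw [HasAntidiagonal.mem_antidiagonal] at hp
    rw [← hp]
    push_cast
    ring
  linear_combination (h2 + h) / 2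

lemma treeKernelTwo_eq {l : ℕ} (hl : l ≠ 0) (n : ℕ) :
    treeKernelTwo n l = (n + l) * treeKernelOne n l - l * u l * (n / 2 * r n) := by
  rw [treeKernelTwo, treeKernelOne, ← sum_mul_id, mul_sum, mul_sum, ← sum_sub_distrib]
  refine sum_congr rfl fun p hp => ?_
  rw [HasAntidiagonal.mem_antidiagonal] at hp
  have h1 : (p.1 : ℚ) + l ≠ 0 := by positivity
  rw [← hp]
  push_cast
  field_simp
  ring

lemma treeKernelOne_add {n l : ℕ} (hn : n ≠ 0) (hl : l ≠ 0) :
    treeKernelOne n l + treeKernelOne l n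
      = (n + l) * (u (n + l) - 2 * u n * u l) - l * u l * r n - n * u n * r l := by
  rw [← treeKernel_add_treeKernel hn hl, treeKernelOne_eq hl, treeKernelOne_eq hn]
  ring

lemma treeKernelTwo_add {n l : ℕ} (hn : n ≠ 0) (hl : l ≠ 0) :
    treeKernelTwo n l + treeKernelTwo l n
      = (n + l) * ((n + l) * (u (n + l) - 2 * u n * u l) - l * u l * r n - n * u n * r l)
        - l * u l * (n / 2 * r n) - n * u n * (l / 2 * r l) := by
  rw [← treeKernelOne_add hn hl, treeKernelTwo_eq hl, treeKernelTwo_eq hn]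
  ring

end TreeFunction

end HurwitzGenusOne

namespace HurwitzGenusOne

open PowerSeries Finset

section UniqueSolution

variable {R : Type*} [CommRing R]

lemma eq_zero_of_euler_eq_mul [IsDomain R] [CharZero R] {φ W : R⟦X⟧}
    (hφ : constantCoeff φ = 0) (h : euler W = φ * W) (h0 : constantCoeff W = 0) : W = 0 := by
  ext n
  rw [map_zero]
  induction n using Nat.strong_induction_on with
  | _ n ih =>
    rcases Nat.eq_zero_or_pos n with rfl | hn
    · simpa using h0
    · have h1 := congrArg (coeff n) h
      rw [coeff_euler, coeff_mul, sum_eq_zero] at h1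
      · exact (mul_eq_zero.1 h1).resolve_left (by exact_mod_cast hn.ne')
      · rintro ⟨i, j⟩ hij
        rw [HasAntidiagonal.mem_antidiagonal] at hij
        rcases Nat.eq_zero_or_pos i with rfl | hi
        · simp [hφ]
        · simp only at hij
          rw [ih j (by omega), mul_zero]

lemma exists_euler_eq_mul [Algebra ℚ R] {ψ : R⟦X⟧} (hψ : constantCoeff ψ = 0) :
    ∃ E : R⟦X⟧, euler E = euler ψ * E ∧ constantCoeff E = 1 := by
  have hs : HasSubst ψ := HasSubst.of_constantCoeff_zero hψ
  refine ⟨(exp R).subst ψ, ?_, ?_⟩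
  · have h := derivative_subst (f := exp R) hs
    have h' : PowerSeries.derivative R (exp R) = exp R := by
      ext n
      rw [coeff_derivative, coeff_exp, coeff_exp, ← map_natCast (algebraMap ℚ R) n,
        ← map_one (algebraMap ℚ R), ← map_add, ← map_mul, Nat.factorial_succ]
      congr 1
      push_cast
      field_simp
    rw [euler, Derivation.smul_apply, Derivation.smul_apply, h, h', smul_eq_mul, smul_eq_mul]
    ring
  · have h : constantCoeff (R := R) (subst ψ (exp R - 1 : R⟦X⟧)) = 0 :=
      constantCoeff_subst_eq_zero hψ (exp R - 1 : R⟦X⟧) (by simp)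
    rw [← coe_substAlgHom (R := R) hs, map_sub, map_one, coe_substAlgHom hs, map_sub, map_one] at h
    exact sub_eq_zero.1 h

end UniqueSolution

section Candidates

local notation "𝓡" => MvPolynomial ℕ ℚ
local notation "u" => treeCoeff

/-- The variable `x_n`, with the convention that `x_0 = 0`. -/
noncomputable def pvar (n : ℕ) : 𝓡 := if n = 0 then 0 else MvPolynomial.X n

@[simp] lemma pvar_zero : pvar 0 = 0 := by simp [pvar]

/-- Rational constants as power series. -/
noncomputable def ratC : ℚ →+* 𝓡⟦X⟧ := (PowerSeries.C (R := 𝓡)).comp MvPolynomial.C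

lemma ratC_apply (a : ℚ) : ratC a = PowerSeries.C (MvPolynomial.C a : 𝓡) := rfl

lemma coeff_ratC_mul (a : ℚ) (f : 𝓡⟦X⟧) (n : ℕ) :
    coeff n (ratC a * f) = MvPolynomial.C a * coeff n f := by
  rw [ratC_apply, coeff_C_mul]

/-- The series `∑ a_n x_n zⁿ`. -/
noncomputable def linSeries (a : ℕ → ℚ) : 𝓡⟦X⟧ :=
  PowerSeries.mk fun n => MvPolynomial.C (a n) * pvar n

/-- The series `∑ a_{n,l} x_n x_l z^{n+l}`. -/
noncomputable def quadSeries (a : ℕ → ℕ → ℚ) : 𝓡⟦X⟧ :=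
  PowerSeries.mk fun N =>
    ∑ p ∈ antidiagonal N, MvPolynomial.C (a p.1 p.2) * (pvar p.1 * pvar p.2)

lemma coeff_linSeries (a : ℕ → ℚ) (n : ℕ) :
    coeff n (linSeries a) = MvPolynomial.C (a n) * pvar n := coeff_mk _ _

lemma coeff_quadSeries (a : ℕ → ℕ → ℚ) (N : ℕ) :
    coeff N (quadSeries a)
      = ∑ p ∈ antidiagonal N, MvPolynomial.C (a p.1 p.2) * (pvar p.1 * pvar p.2) := coeff_mk _ _

@[simp] lemma constantCoeff_linSeries (a : ℕ → ℚ) : constantCoeff (linSeries a) = 0 := by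
  rw [← coeff_zero_eq_constantCoeff_apply, coeff_linSeries]; simp

lemma euler_linSeries (a : ℕ → ℚ) : euler (linSeries a) = linSeries fun n => n * a n := by
  ext1 n
  rw [coeff_euler, coeff_linSeries, coeff_linSeries, map_mul, map_natCast, mul_assoc]

lemma linSeries_add (a b : ℕ → ℚ) :
    linSeries a + linSeries b = linSeries fun n => a n + b n := by
  ext1 n
  rw [map_add, coeff_linSeries, coeff_linSeries, coeff_linSeries, map_add, add_mul]

lemma linSeries_sub (a b : ℕ → ℚ) :
    linSeries a - linSeries b = linSeries fun n => a n - b n := by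
  ext1 n
  rw [map_sub, coeff_linSeries, coeff_linSeries, coeff_linSeries, map_sub, sub_mul]

lemma ratC_mul_linSeries (c : ℚ) (a : ℕ → ℚ) :
    ratC c * linSeries a = linSeries fun n => c * a n := by
  ext1 n
  rw [coeff_ratC_mul, coeff_linSeries, coeff_linSeries, map_mul, mul_assoc]

lemma linSeries_congr {a b : ℕ → ℚ} (h : ∀ n ≠ 0, a n = b n) : linSeries a = linSeries b := by
  ext1 n
  rw [coeff_linSeries, coeff_linSeries]
  rcases eq_or_ne n 0 with rfl | hn
  · simp
  · rw [h n hn]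

lemma quadSeries_add (a b : ℕ → ℕ → ℚ) :
    quadSeries a + quadSeries b = quadSeries fun n l => a n l + b n l := by
  ext1 n
  rw [map_add, coeff_quadSeries, coeff_quadSeries, coeff_quadSeries, ← sum_add_distrib]
  simp only [map_add, add_mul]

lemma quadSeries_sub (a b : ℕ → ℕ → ℚ) :
    quadSeries a - quadSeries b = quadSeries fun n l => a n l - b n l := by
  ext1 n
  rw [map_sub, coeff_quadSeries, coeff_quadSeries, coeff_quadSeries, ← sum_sub_distrib]
  simp only [map_sub, sub_mul]

lemma ratC_mul_quadSeries (c : ℚ) (a : ℕ → ℕ → ℚ) :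
    ratC c * quadSeries a = quadSeries fun n l => c * a n l := by
  ext1 n
  rw [coeff_ratC_mul, coeff_quadSeries, coeff_quadSeries, mul_sum]
  simp only [map_mul, mul_assoc]

lemma quadSeries_swap (a : ℕ → ℕ → ℚ) :
    quadSeries (fun n l => a l n) = quadSeries a := by
  ext1 n
  rw [coeff_quadSeries, coeff_quadSeries, ← Nat.sum_antidiagonal_swap]
  refine sum_congr rfl fun p _ => ?_
  rw [Prod.fst_swap, Prod.snd_swap, mul_comm (pvar p.2)]

lemma quadSeries_congr {a b : ℕ → ℕ → ℚ} (h : ∀ n ≠ 0, ∀ l ≠ 0, a n l = b n l) :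
    quadSeries a = quadSeries b := by
  ext1 N
  rw [coeff_quadSeries, coeff_quadSeries]
  refine sum_congr rfl fun p _ => ?_
  rcases eq_or_ne p.1 0 with hn | hn
  · simp [hn]
  rcases eq_or_ne p.2 0 with hl | hl
  · simp [hl]
  rw [h _ hn _ hl]

lemma linSeries_mul_linSeries (a b : ℕ → ℚ) :
    linSeries a * linSeries b = quadSeries fun n l => a n * b l := by
  ext1 N
  rw [coeff_mul, coeff_quadSeries]
  refine sum_congr rfl fun p _ => ?_
  rw [coeff_linSeries, coeff_linSeries, map_mul]
  ring

/-- The coefficientwise partial derivative with respect to `x_j`. -/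
noncomputable def pd (j : ℕ) (f : 𝓡⟦X⟧) : 𝓡⟦X⟧ :=
  PowerSeries.mk fun n => MvPolynomial.pderiv j (coeff n f)

lemma coeff_pd (j : ℕ) (f : 𝓡⟦X⟧) (n : ℕ) :
    coeff n (pd j f) = MvPolynomial.pderiv j (coeff n f) := coeff_mk _ _

lemma pd_add (j : ℕ) (f g : 𝓡⟦X⟧) : pd j (f + g) = pd j f + pd j g := by
  ext1 n; simp only [coeff_pd, map_add]

lemma pd_sub (j : ℕ) (f g : 𝓡⟦X⟧) : pd j (f - g) = pd j f - pd j g := by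
  ext1 n; simp only [coeff_pd, map_sub]

lemma pd_mul (j : ℕ) (f g : 𝓡⟦X⟧) : pd j (f * g) = pd j f * g + f * pd j g := by
  ext1 n
  rw [map_add, coeff_pd, coeff_mul, coeff_mul, coeff_mul, map_sum, ← sum_add_distrib]
  refine sum_congr rfl fun p _ => ?_
  rw [Derivation.leibniz, coeff_pd, coeff_pd, smul_eq_mul, smul_eq_mul]
  ring

lemma pd_ratC (j : ℕ) (a : ℚ) : pd j (ratC a) = 0 := by
  ext1 n
  rw [coeff_pd, ratC_apply, coeff_C]
  split_ifs <;> simp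

lemma pd_one (j : ℕ) : pd j 1 = 0 := by rw [← map_one ratC, pd_ratC]

lemma pd_natCast (j n : ℕ) : pd j (n : 𝓡⟦X⟧) = 0 := by rw [← map_natCast ratC, pd_ratC]

lemma pd_X_pow (j n : ℕ) : pd j (X ^ n) = 0 := by
  ext1 m
  rw [coeff_pd, coeff_X_pow]
  split_ifs <;> simp

lemma pd_ratC_mul (j : ℕ) (a : ℚ) (f : 𝓡⟦X⟧) : pd j (ratC a * f) = ratC a * pd j f := by
  rw [pd_mul, pd_ratC, zero_mul, zero_add]

lemma pd_euler (j : ℕ) (f : 𝓡⟦X⟧) : pd j (euler f) = euler (pd j f) := by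
  ext1 n
  rw [coeff_pd, coeff_euler, coeff_euler, coeff_pd, Derivation.leibniz]
  simp

lemma pd_pow (j : ℕ) (f : 𝓡⟦X⟧) (n : ℕ) :
    f * pd j (f ^ n) = n * f ^ n * pd j f := by
  induction n with
  | zero => simp [pd_one]
  | succ n ih =>
    rw [pow_succ, pd_mul]
    push_cast
    linear_combination f * ih

lemma pderiv_pvar (j n : ℕ) (hj : j ≠ 0) :
    MvPolynomial.pderiv j (pvar n) = if n = j then 1 else 0 := by
  rw [pvar]
  split_ifs with h1 h2 h2
  · omega
  · simp
  · subst h2; simp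
  · rw [MvPolynomial.pderiv_X_of_ne h2]

lemma pderiv_zero_pvar (n : ℕ) : MvPolynomial.pderiv 0 (pvar n) = 0 := by
  rw [pvar]
  split_ifs with h1
  · simp
  · rw [MvPolynomial.pderiv_X_of_ne h1]

lemma pd_linSeries (j : ℕ) (a : ℕ → ℚ) (ha : a 0 = 0) :
    pd j (linSeries a) = ratC (a j) * X ^ j := by
  ext1 n
  rw [coeff_pd, coeff_linSeries, coeff_ratC_mul, coeff_X_pow, Derivation.leibniz]
  rcases eq_or_ne j 0 with rfl | hj
  · simp [pderiv_zero_pvar, ha]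
  · rw [pderiv_pvar _ _ hj]
    split_ifs with h
    · simp [h]
    · simp

end Candidates

end HurwitzGenusOne

namespace HurwitzGenusOne

open PowerSeries Finset

section Functional

local notation "𝓡" => MvPolynomial ℕ ℚ
local notation "u" => treeCoeff

/-- The series `∑ n^a (n^n/n!) x_n zⁿ`. -/
noncomputable def psi (a : ℕ) : 𝓡⟦X⟧ := linSeries fun n => n ^ a * u n

lemma euler_psi (a : ℕ) : euler (psi a) = psi (a + 1) := by
  rw [psi, psi, euler_linSeries]
  congr 1
  ext n
  ring

lemma constantCoeff_psi (a : ℕ) : constantCoeff (psi a) = 0 := constantCoeff_linSeries _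

lemma pd_psi (j a : ℕ) : pd j (psi a) = ratC (j ^ a * u j) * X ^ j :=
  pd_linSeries _ _ (by simp)

/-- The exponential of `psi 0`. -/
noncomputable def expPsi : 𝓡⟦X⟧ :=
  Classical.choose (exists_euler_eq_mul (constantCoeff_psi 0))

lemma euler_expPsi : euler expPsi = euler (psi 0) * expPsi :=
  (Classical.choose_spec (exists_euler_eq_mul (constantCoeff_psi 0))).1

lemma constantCoeff_expPsi : constantCoeff expPsi = 1 :=
  (Classical.choose_spec (exists_euler_eq_mul (constantCoeff_psi 0))).2

lemma constantCoeff_pd (j : ℕ) (f : 𝓡⟦X⟧) :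
    constantCoeff (pd j f) = MvPolynomial.pderiv j (constantCoeff f) := by
  rw [← coeff_zero_eq_constantCoeff_apply, ← coeff_zero_eq_constantCoeff_apply, coeff_pd]

lemma expPsi_ne_zero : expPsi ≠ 0 := by
  intro h
  have := constantCoeff_expPsi
  rw [h, map_zero] at this
  exact zero_ne_one this

lemma pd_expPsi (j : ℕ) : pd j expPsi = ratC (u j) * X ^ j * expPsi := by
  have hpsi : pd j (psi 0) = ratC (u j) * X ^ j := by
    rw [pd_psi, pow_zero, one_mul]
  rw [← sub_eq_zero]
  refine eq_zero_of_euler_eq_mul (φ := euler (psi 0)) ?_ ?_ ?_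
  · rw [euler_psi, constantCoeff_psi]
  · rw [map_sub, ← pd_euler, euler_expPsi, pd_mul, pd_euler, euler_mul, hpsi, euler_expPsi]
    ring
  · rw [map_sub, constantCoeff_pd, constantCoeff_expPsi, Derivation.map_one_eq_zero, map_mul,
      ← hpsi, constantCoeff_pd, constantCoeff_psi, map_zero, zero_mul, sub_zero]

/-- The inverse of `1 - psi 1`. -/
noncomputable def invPsi : 𝓡⟦X⟧ := invOfUnit (1 - psi 1) 1

lemma invPsi_mul : invPsi * (1 - psi 1) = 1 := by
  rw [mul_comm]
  exact mul_invOfUnit _ _ (by simp [constantCoeff_psi])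

lemma euler_invPsi : euler invPsi = psi 2 * invPsi ^ 2 := by
  have h := congrArg euler invPsi_mul
  rw [euler_mul, map_sub, Derivation.map_one_eq_zero, euler_psi] at h
  linear_combination invPsi * h - euler invPsi * invPsi_mul

lemma pd_invPsi (j : ℕ) : pd j invPsi = ratC (j * u j) * X ^ j * invPsi ^ 2 := by
  have h := congrArg (pd j) invPsi_mul
  rw [pd_mul, pd_sub, pd_one, pd_psi, pow_one] at h
  linear_combination invPsi * h - pd j invPsi * invPsi_mul

/-- The coefficient of `z^k` in the composition of `g` with the solution of `s = z exp (ψ₀ s)`. -/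
noncomputable def subCoeff (k : ℕ) (g : 𝓡⟦X⟧) : 𝓡 := coeff k (lagrange (psi 0) expPsi g)

lemma subCoeff_add (k : ℕ) (g h : 𝓡⟦X⟧) : subCoeff k (g + h) = subCoeff k g + subCoeff k h := by
  rw [subCoeff, lagrange_add, map_add]; rfl

lemma subCoeff_sub (k : ℕ) (g h : 𝓡⟦X⟧) : subCoeff k (g - h) = subCoeff k g - subCoeff k h := by
  rw [subCoeff, lagrange_sub, map_sub]; rfl

lemma subCoeff_C_mul (k : ℕ) (a : 𝓡) (g : 𝓡⟦X⟧) :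
    subCoeff k (PowerSeries.C a * g) = a * subCoeff k g := by
  rw [subCoeff, lagrange_C_mul, coeff_C_mul]; rfl

lemma subCoeff_ratC_mul (k : ℕ) (a : ℚ) (g : 𝓡⟦X⟧) :
    subCoeff k (ratC a * g) = MvPolynomial.C a * subCoeff k g := subCoeff_C_mul _ _ _

lemma subCoeff_zero (k : ℕ) : subCoeff k 0 = 0 := by
  have := subCoeff_sub k 0 0
  rwa [sub_self, sub_self] at this

lemma subCoeff_sum {ι : Type*} (k : ℕ) (s : Finset ι) (g : ι → 𝓡⟦X⟧) :
    subCoeff k (∑ i ∈ s, g i) = ∑ i ∈ s, subCoeff k (g i) := by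
  classical
  induction s using Finset.induction_on with
  | empty => simp [subCoeff_zero]
  | insert i s hi ih => rw [sum_insert hi, sum_insert hi, subCoeff_add, ih]

lemma subCoeff_mul (k : ℕ) (g h : 𝓡⟦X⟧) :
    subCoeff k (g * h) = ∑ p ∈ antidiagonal k, subCoeff p.1 g * subCoeff p.2 h := by
  rw [subCoeff, lagrange_mul euler_expPsi constantCoeff_expPsi, coeff_mul]; rfl

lemma subCoeff_of_index_zero (g : 𝓡⟦X⟧) : subCoeff 0 g = constantCoeff g := by
  rw [subCoeff, coeff_lagrange, euler_psi]
  simp [constantCoeff_psi]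

lemma natCast_mul_subCoeff (k : ℕ) (g : 𝓡⟦X⟧) :
    (k : 𝓡) * subCoeff k g = subCoeff k (invPsi * euler g) := by
  have h : euler g = (invPsi * euler g) * (1 - euler (psi 0)) := by
    rw [euler_psi, mul_right_comm, invPsi_mul, one_mul]
  have := congrArg (coeff k) (euler_lagrange euler_expPsi constantCoeff_expPsi h)
  rwa [coeff_euler] at this

lemma natCast_mul_subCoeff_eq (k : ℕ) (g : 𝓡⟦X⟧) :
    (k : 𝓡) * subCoeff k g = coeff k (euler g * expPsi ^ k) :=
  (coeff_euler_mul_pow euler_expPsi constantCoeff_expPsi g k).symm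

lemma subCoeff_mk_mul (k : ℕ) (a : ℕ → 𝓡) (h : 𝓡⟦X⟧) :
    subCoeff k (PowerSeries.mk a * h) = ∑ n ∈ range (k + 1), a n * subCoeff k (X ^ n * h) := by
  rw [subCoeff, coeff_lagrange, mul_assoc, mul_assoc, coeff_mul,
    Nat.sum_antidiagonal_eq_sum_range_succ_mk]
  refine sum_congr rfl fun n hn => ?_
  rw [subCoeff, coeff_lagrange, mul_assoc, mul_assoc, coeff_X_pow_mul',
    if_pos (by simpa [Nat.lt_succ_iff] using hn), coeff_mk]

lemma subCoeff_linSeries_mul (k : ℕ) (a : ℕ → ℚ) (h : 𝓡⟦X⟧) :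
    subCoeff k (linSeries a * h)
      = ∑ n ∈ range (k + 1), pvar n * subCoeff k (ratC (a n) * X ^ n * h) := by
  rw [linSeries, subCoeff_mk_mul]
  refine sum_congr rfl fun n _ => ?_
  rw [mul_assoc (ratC _), subCoeff_ratC_mul]
  ring

lemma subCoeff_quadSeries_mul (k : ℕ) (a : ℕ → ℕ → ℚ) (h : 𝓡⟦X⟧) :
    subCoeff k (quadSeries a * h)
      = ∑ n ∈ range (k + 1), pvar n * subCoeff k (X ^ n * linSeries (a n) * h) := by
  have h1 : ∀ n, subCoeff k (X ^ n * linSeries (a n) * h)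
      = ∑ l ∈ range (k + 1), MvPolynomial.C (a n l) * pvar l * subCoeff k (X ^ (n + l) * h) := by
    intro n
    rw [mul_comm (X ^ n), mul_assoc, linSeries, subCoeff_mk_mul]
    refine sum_congr rfl fun l _ => ?_
    rw [← mul_assoc (X ^ l), ← pow_add, add_comm l]
  have h2 : ∀ N, k < N → subCoeff k (X ^ N * h) = 0 := fun N hN =>
    X_pow_dvd_iff.1 (lagrange_X_pow_dvd ⟨h, rfl⟩) k hN
  rw [quadSeries, subCoeff_mk_mul]
  simp only [h1, mul_sum, sum_mul]
  rw [← sum_product', ← sum_fiberwise_of_maps_to (s := range (k + 1) ×ˢ range (k + 1))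
    (t := range (2 * k + 1)) (g := fun p => p.1 + p.2)]
  · symm
    rw [← sum_subset (s₁ := range (k + 1))]
    · refine sum_congr rfl fun N hN => ?_
      have : (range (k + 1) ×ˢ range (k + 1)).filter (fun p => p.1 + p.2 = N)
          = antidiagonal N := by
        ext p
        simp only [mem_filter, mem_product, mem_range, HasAntidiagonal.mem_antidiagonal] at hN ⊢
        omega
      rw [this]
      refine sum_congr rfl fun p hp => ?_
      rw [HasAntidiagonal.mem_antidiagonal] at hp
      rw [hp]
      ring
    · intro x hx; simp only [mem_range] at hx ⊢; omega
    · intro N _ hN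
      refine sum_eq_zero fun p hp => ?_
      rw [mem_filter] at hp
      rw [hp.2, h2 N (by simpa [Nat.lt_succ_iff] using hN)]
      ring
  · intro p hp
    simp only [mem_product, mem_range] at hp ⊢
    omega

lemma pderiv_subCoeff (j k : ℕ) (g : 𝓡⟦X⟧) :
    MvPolynomial.pderiv j (subCoeff k g)
      = subCoeff k (pd j g + ratC (u j) * X ^ j * (invPsi * euler g)) := by
  have h1 : pd j (expPsi ^ k) = (k : 𝓡⟦X⟧) * (ratC (u j) * X ^ j) * expPsi ^ k := by
    apply mul_left_cancel₀ expPsi_ne_zero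
    rw [pd_pow, pd_expPsi]; ring
  have h2 : euler (expPsi ^ k) = (k : 𝓡⟦X⟧) * euler (psi 0) * expPsi ^ k := by
    apply mul_left_cancel₀ expPsi_ne_zero
    rw [euler_pow, euler_expPsi]; ring
  have hpsi : pd j (psi 0) = ratC (u j) * X ^ j := by
    rw [pd_psi, pow_zero, one_mul]
  set w := ratC (u j) * X ^ j with hw
  have h3 := coeff_euler (w * g * expPsi ^ k) k
  rw [subCoeff, coeff_lagrange, ← coeff_pd, pd_mul, h1, pd_mul, pd_sub, pd_one, pd_euler, hpsi,
    subCoeff, coeff_lagrange]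
  rw [euler_mul, euler_mul, h2] at h3
  have h4 : (k : 𝓡) * coeff k (w * g * expPsi ^ k) = coeff k ((k : 𝓡⟦X⟧) * (w * g * expPsi ^ k)) := by
    rw [← map_natCast (PowerSeries.C (R := 𝓡)), coeff_C_mul]
  rw [h4, ← sub_eq_zero, ← map_sub] at h3
  rw [← sub_eq_zero, ← map_sub, ← neg_eq_zero, ← map_neg, ← h3]
  congr 1
  have h5 := invPsi_mul
  rw [← euler_psi] at h5
  linear_combination (w * euler g * expPsi ^ k) * h5

end Functional

end HurwitzGenusOne

namespace HurwitzGenusOne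

open PowerSeries Finset

section CutJoin

local notation "𝓡" => MvPolynomial ℕ ℚ
local notation "u" => treeCoeff

/-- The operator `n ∂/∂x_n`. -/
noncomputable def wd (n : ℕ) : Derivation ℚ 𝓡 𝓡 := n • MvPolynomial.pderiv n

lemma wd_apply (n : ℕ) (f : 𝓡) : wd n f = n * MvPolynomial.pderiv n f := by
  rw [wd, Derivation.smul_apply, nsmul_eq_mul]

@[simp] lemma wd_zero_apply (f : 𝓡) : wd 0 f = 0 := by simp [wd_apply]

/-- The cut operator, truncated at index `N`. -/
noncomputable def cutOp (N : ℕ) (f : 𝓡) : 𝓡 :=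
  ∑ n ∈ range (N + 1), (∑ p ∈ antidiagonal n, pvar p.1 * pvar p.2) * wd n f

/-- The join operator, truncated at index `N`. -/
noncomputable def joinOp (N : ℕ) (f : 𝓡) : 𝓡 :=
  ∑ n ∈ range (N + 1), pvar n * ∑ p ∈ antidiagonal n, wd p.1 (wd p.2 f)

/-- The bilinear operator joining two components, truncated at index `N`. -/
noncomputable def bilOp (N : ℕ) (f g : 𝓡) : 𝓡 :=
  ∑ n ∈ range (N + 1), pvar n * ∑ p ∈ antidiagonal n, wd p.1 f * wd p.2 g

/-- The degree operator `∑ x_n ∂/∂x_n`, truncated at index `N`. -/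
noncomputable def degOp (N : ℕ) (f : 𝓡) : 𝓡 :=
  ∑ n ∈ range (N + 1), pvar n * MvPolynomial.pderiv n f

/-- The series whose composition encodes the genus-zero numbers. -/
noncomputable def genZero : 𝓡⟦X⟧ := linSeries (fun n => u n / n) - ratC (1 / 2) * psi 0 ^ 2

/-- The genus-zero candidate. -/
noncomputable def candZero (k : ℕ) : 𝓡 := MvPolynomial.C (1 / (k : ℚ)) * subCoeff k genZero

/-- The logarithm of `invPsi`. -/
noncomputable def logPsi : 𝓡⟦X⟧ :=
  PowerSeries.mk fun n => MvPolynomial.C (1 / (n : ℚ)) * coeff n (psi 2 * invPsi)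

/-- The genus-one candidate. -/
noncomputable def candOne (k : ℕ) : 𝓡 :=
  MvPolynomial.C (1 / 24) * subCoeff k (logPsi - psi 0)

lemma euler_genZero : euler genZero = psi 0 * (1 - psi 1) := by
  have h : ratC (1 / 2) * 2 = 1 := by
    rw [← map_ofNat ratC 2, ← map_mul]; norm_num
  have h2 : euler (ratC (1 / 2)) = 0 := by
    ext1 n; rw [coeff_euler, ratC_apply, coeff_C]; split_ifs with h <;> simp [h]
  rw [genZero, map_sub, euler_linSeries, euler_mul, sq, euler_mul, euler_psi, h2]
  have h1 : (linSeries fun n => (n : ℚ) * (u n / n)) = psi 0 :=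
    linSeries_congr fun n hn => by field_simp
  rw [h1]
  linear_combination (-(psi 0 * psi 1)) * h

lemma natCast_mul_C_one_div {k : ℕ} (hk : k ≠ 0) :
    (k : 𝓡) * MvPolynomial.C (1 / (k : ℚ)) = 1 := by
  rw [← map_natCast (MvPolynomial.C (σ := ℕ) (R := ℚ)), ← map_mul, mul_one_div_cancel, map_one]
  exact_mod_cast hk

lemma natCast_mul_candZero {k : ℕ} (hk : k ≠ 0) :
    (k : 𝓡) * candZero k = subCoeff k genZero := by
  rw [candZero, ← mul_assoc, natCast_mul_C_one_div hk, one_mul]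

@[simp] lemma candZero_zero : candZero 0 = 0 := by simp [candZero]

lemma natCast_sq_mul_candZero {k : ℕ} (hk : k ≠ 0) :
    (k : 𝓡) * (k * candZero k) = subCoeff k (psi 0) := by
  rw [natCast_mul_candZero hk, natCast_mul_subCoeff, euler_genZero]
  congr 1
  linear_combination psi 0 * invPsi_mul

lemma ratC_half : ratC (1 / 2) * 2 = 1 := by
  rw [← map_ofNat ratC 2, ← map_mul]; norm_num

lemma pd_genZero (j : ℕ) :
    pd j genZero = ratC (u j / j) * X ^ j - psi 0 * (ratC (u j) * X ^ j) := by
  rw [genZero, pd_sub, pd_linSeries _ _ (by simp), pd_ratC_mul, sq, pd_mul, pd_psi, pow_zero,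
    one_mul]
  linear_combination (-(psi 0 * (ratC (u j) * X ^ j))) * ratC_half

lemma natCast_mul_pderiv_candZero {k : ℕ} (hk : k ≠ 0) (j : ℕ) :
    (k : 𝓡) * MvPolynomial.pderiv j (candZero k) = subCoeff k (ratC (u j / j) * X ^ j) := by
  have h : (k : 𝓡) * MvPolynomial.pderiv j (candZero k)
      = MvPolynomial.pderiv j ((k : 𝓡) * candZero k) := by
    rw [Derivation.leibniz]; simp
  rw [h, natCast_mul_candZero hk, pderiv_subCoeff, pd_genZero, euler_genZero]
  congr 1
  linear_combination (ratC (u j) * X ^ j * psi 0) * invPsi_mul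

lemma natCast_mul_wd_candZero {k : ℕ} (hk : k ≠ 0) (j : ℕ) :
    (k : 𝓡) * wd j (candZero k) = subCoeff k (ratC (u j) * X ^ j) := by
  rw [wd_apply, mul_left_comm, natCast_mul_pderiv_candZero hk,
    ← map_natCast (MvPolynomial.C (σ := ℕ) (R := ℚ)), ← subCoeff_ratC_mul, ← mul_assoc, ← map_mul]
  rcases eq_or_ne j 0 with rfl | hj
  · simp
  · rw [mul_div_cancel₀]; exact_mod_cast hj

/-- The series whose composition gives `wd i` of the genus-zero candidates. -/
noncomputable def wdSeries (i : ℕ) : 𝓡⟦X⟧ :=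
  ratC (u i / i) - ratC (u i) * linSeries fun l => l * u l / (i + l)

lemma ratC_natCast (n : ℕ) : ratC n = (n : 𝓡⟦X⟧) := map_natCast ratC n

lemma euler_ratC (a : ℚ) : euler (ratC a) = 0 := by
  ext1 n; rw [coeff_euler, ratC_apply, coeff_C]; split_ifs with h <;> simp [h]

lemma euler_X_pow_mul_wdSeries (i : ℕ) :
    euler (X ^ i * wdSeries i) = ratC (u i) * X ^ i * (1 - psi 1) := by
  rcases eq_or_ne i 0 with rfl | hi
  · simp [wdSeries]
  rw [euler_mul, euler_X_pow, wdSeries, map_sub, euler_mul, euler_ratC, euler_ratC,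
    euler_linSeries, ← ratC_natCast]
  have h1 : ratC i * ratC (u i / i) = ratC (u i) := by
    rw [← map_mul]; congr 1; field_simp
  have h2 : ratC i * (linSeries fun l => l * u l / (i + l))
      + (linSeries fun n => n * (n * u n / (i + n))) = psi 1 := by
    rw [ratC_mul_linSeries, linSeries_add, psi]
    refine linSeries_congr fun n hn => ?_
    have : (i : ℚ) + n ≠ 0 := by positivity
    field_simp
  linear_combination X ^ i * h1 - (X ^ i * ratC (u i)) * h2

lemma natCast_mul_subCoeff_X_pow_mul_wdSeries (k i : ℕ) :
    (k : 𝓡) * subCoeff k (X ^ i * wdSeries i) = subCoeff k (ratC (u i) * X ^ i) := by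
  rw [natCast_mul_subCoeff, euler_X_pow_mul_wdSeries]
  congr 1
  linear_combination (ratC (u i) * X ^ i) * invPsi_mul

lemma wd_candZero (k j : ℕ) : wd j (candZero k) = subCoeff k (X ^ j * wdSeries j) := by
  rcases eq_or_ne k 0 with rfl | hk
  · rw [candZero_zero, map_zero, subCoeff_of_index_zero]
    rcases eq_or_ne j 0 with rfl | hj
    · simp [wdSeries]
    · simp [hj]
  · apply mul_left_cancel₀ (show (k : 𝓡) ≠ 0 by exact_mod_cast hk)
    rw [natCast_mul_wd_candZero hk, natCast_mul_subCoeff_X_pow_mul_wdSeries]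

lemma wd_wd_candZero {k : ℕ} (hk : k ≠ 0) (i j : ℕ) :
    wd i (wd j (candZero k))
      = subCoeff k (ratC (i * u i * (j * u j) / ((i + j : ℕ) : ℚ)) * X ^ (i + j)) := by
  apply mul_left_cancel₀ (show (k : 𝓡) ≠ 0 by exact_mod_cast hk)
  have h : (k : 𝓡) * wd i (wd j (candZero k)) = wd i ((k : 𝓡) * wd j (candZero k)) := by
    rw [Derivation.leibniz]; simp
  rw [h, natCast_mul_wd_candZero hk, wd_apply, pderiv_subCoeff, natCast_mul_subCoeff,
    ← map_natCast (MvPolynomial.C (σ := ℕ) (R := ℚ)), ← subCoeff_ratC_mul]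
  congr 1
  rw [pd_ratC_mul, pd_X_pow, euler_mul, euler_mul, euler_ratC, euler_ratC, euler_X_pow, euler_X_pow,
    ← ratC_natCast, ← ratC_natCast]
  have h1 : ratC (i * u i * (j * u j) / ((i + j : ℕ) : ℚ)) * ratC ((i + j : ℕ) : ℚ)
      = ratC i * ratC (u i) * (ratC j * ratC (u j)) := by
    simp only [← map_mul]
    congr 1
    rcases eq_or_ne (i + j) 0 with h0 | h0
    · have : i = 0 := by omega
      simp [this]
    · field_simp
  rw [pow_add]
  linear_combination (-(X ^ i * X ^ j * invPsi)) * h1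

lemma degOp_candZero {k : ℕ} (hk : k ≠ 0) :
    (k : 𝓡) * degOp k (candZero k) = subCoeff k (linSeries fun n => u n / n) := by
  rw [← mul_one (linSeries _), subCoeff_linSeries_mul, degOp, mul_sum]
  refine sum_congr rfl fun n _ => ?_
  rw [mul_left_comm, natCast_mul_pderiv_candZero hk, mul_one]

lemma euler_logPsi : euler logPsi = psi 2 * invPsi := by
  ext1 n
  rw [coeff_euler, logPsi, coeff_mk, ← mul_assoc]
  rcases eq_or_ne n 0 with rfl | hn
  · simp [constantCoeff_psi]
  · rw [natCast_mul_C_one_div hn, one_mul]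

lemma constantCoeff_logPsi : constantCoeff logPsi = 0 := by
  rw [← coeff_zero_eq_constantCoeff_apply, logPsi, coeff_mk]; simp

lemma pd_logPsi (j : ℕ) : pd j logPsi = ratC (j * u j) * X ^ j * invPsi := by
  rw [← sub_eq_zero]
  refine eq_zero_of_euler_eq_mul (φ := 0) (map_zero _) ?_ ?_
  · rw [map_sub, ← pd_euler, euler_logPsi, pd_mul, pd_psi, pd_invPsi, euler_mul, euler_mul,
      euler_ratC, euler_X_pow, euler_invPsi, ← ratC_natCast, show ((j : ℚ) ^ 2 * u j) =
      j * (j * u j) by ring, map_mul]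
    ring
  · rw [map_sub, constantCoeff_pd, constantCoeff_logPsi]
    rcases eq_or_ne j 0 with rfl | hj
    · simp
    · simp [hj]

lemma pderiv_candOne (j k : ℕ) :
    MvPolynomial.pderiv j (candOne k) = MvPolynomial.C (1 / 24) *
      subCoeff k (ratC (u j) * X ^ j * invPsi * (ratC j - 1 + psi 2 * invPsi)) := by
  rw [candOne, MvPolynomial.pderiv_C_mul, pderiv_subCoeff, pd_sub, pd_logPsi, pd_psi, map_sub,
    euler_logPsi, euler_psi, pow_zero, one_mul, map_mul]
  congr 2
  linear_combination (ratC (u j) * X ^ j) * invPsi_mul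

lemma natCast_mul_candOne (k : ℕ) :
    (k : 𝓡) * candOne k = MvPolynomial.C (1 / 24) *
      subCoeff k (invPsi * (psi 2 * invPsi - psi 1)) := by
  rw [candOne, mul_left_comm, natCast_mul_subCoeff, map_sub, euler_logPsi, euler_psi]

lemma degOp_candOne (k : ℕ) :
    degOp k (candOne k) = MvPolynomial.C (1 / 24) *
      subCoeff k (invPsi * (psi 1 - psi 0 + psi 0 * psi 2 * invPsi)) := by
  have h : invPsi * (psi 1 - psi 0 + psi 0 * psi 2 * invPsi)
      = psi 1 * invPsi + psi 0 * (invPsi * (psi 2 * invPsi - 1)) := by ring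
  rw [h, subCoeff_add, psi, psi, subCoeff_linSeries_mul, subCoeff_linSeries_mul, degOp, mul_add,
    mul_sum, mul_sum, ← sum_add_distrib]
  refine sum_congr rfl fun n _ => ?_
  rw [pderiv_candOne, mul_left_comm, ← mul_add, ← mul_add, ← subCoeff_add, pow_one, pow_zero,
    one_mul, map_mul]
  congr 3
  ring

end CutJoin

end HurwitzGenusOne

namespace HurwitzGenusOne

open PowerSeries Finset

section CutJoinEquations

local notation "𝓡" => MvPolynomial ℕ ℚ
local notation "u" => treeCoeff
local notation "r" => treeSq

lemma sum_cut_subCoeff (k : ℕ) (a : ℕ → ℚ) (h : 𝓡⟦X⟧) :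
    ∑ n ∈ range (k + 1), (∑ p ∈ antidiagonal n, pvar p.1 * pvar p.2)
        * subCoeff k (ratC (a n) * X ^ n * h)
      = subCoeff k (quadSeries (fun n l => a (n + l)) * h) := by
  rw [quadSeries, subCoeff_mk_mul]
  refine sum_congr rfl fun n _ => ?_
  rw [mul_assoc (ratC _), subCoeff_ratC_mul, ← mul_assoc, sum_mul]
  congr 1
  refine sum_congr rfl fun p hp => ?_
  rw [HasAntidiagonal.mem_antidiagonal] at hp
  rw [hp]
  ring

lemma sum_bilOp (k : ℕ) (f g : ℕ → 𝓡) (F G : ℕ → 𝓡⟦X⟧)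
    (hf : ∀ k i, wd i (f k) = subCoeff k (F i)) (hg : ∀ k i, wd i (g k) = subCoeff k (G i)) :
    ∑ q ∈ antidiagonal k, bilOp k (f q.1) (g q.2)
      = ∑ n ∈ range (k + 1), pvar n * subCoeff k (∑ p ∈ antidiagonal n, F p.1 * G p.2) := by
  simp only [bilOp]
  rw [sum_comm]
  refine sum_congr rfl fun n _ => ?_
  rw [← mul_sum, sum_comm, subCoeff_sum]
  congr 1
  refine sum_congr rfl fun p _ => ?_
  rw [subCoeff_mul]
  refine sum_congr rfl fun q _ => ?_
  rw [hf, hg]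

lemma ratC_mul_linSeries_sum {ι : Type*} (s : Finset ι) (c : ι → ℚ) (a : ι → ℕ → ℚ) :
    ∑ i ∈ s, ratC (c i) * linSeries (a i) = linSeries fun l => ∑ i ∈ s, c i * a i l := by
  ext1 n
  simp only [map_sum, coeff_ratC_mul, coeff_linSeries, map_mul, sum_mul, mul_assoc]

lemma sum_wdSeries_subCoeff (k : ℕ) (b : ℕ → ℚ) (h : 𝓡⟦X⟧) :
    ∑ n ∈ range (k + 1), pvar n * subCoeff k
        ((∑ p ∈ antidiagonal n, X ^ p.1 * wdSeries p.1 * (ratC (b p.2) * X ^ p.2)) * h)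
      = subCoeff k ((linSeries (fun n => ∑ p ∈ antidiagonal n, u p.1 / p.1 * b p.2)
        - quadSeries (fun n l => ∑ p ∈ antidiagonal n, l * u l * u p.1 / (p.1 + l) * b p.2))
          * h) := by
  rw [sub_mul, subCoeff_sub, subCoeff_linSeries_mul, subCoeff_quadSeries_mul,
    ← sum_sub_distrib]
  refine sum_congr rfl fun n _ => ?_
  rw [← mul_sub, ← subCoeff_sub, ← sub_mul]
  congr 3
  have h1 : (linSeries fun l => ∑ p ∈ antidiagonal n, l * u l * u p.1 / (p.1 + l) * b p.2)
      = ∑ p ∈ antidiagonal n, ratC (u p.1 * b p.2) * linSeries fun l => l * u l / (p.1 + l) := by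
    rw [ratC_mul_linSeries_sum]
    congr 1
    ext l
    refine sum_congr rfl fun p _ => by ring
  rw [h1, map_sum, sum_mul, mul_sum, ← sum_sub_distrib]
  refine sum_congr rfl fun p hp => ?_
  rw [HasAntidiagonal.mem_antidiagonal] at hp
  rw [wdSeries, ← hp, pow_add, map_mul, map_mul]
  ring

lemma ratC_ofNat_two : ratC 2 = 2 := map_ofNat ratC 2

lemma subCoeff_two_mul (k : ℕ) (g : 𝓡⟦X⟧) : subCoeff k (2 * g) = 2 * subCoeff k g := by
  rw [← ratC_ofNat_two, subCoeff_ratC_mul, map_ofNat]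

lemma natCast_mul_cutOp_candZero {k : ℕ} (hk : k ≠ 0) :
    (k : 𝓡) * cutOp k (candZero k) = subCoeff k (quadSeries fun n l => u (n + l)) := by
  rw [← mul_one (quadSeries _), ← sum_cut_subCoeff, cutOp, mul_sum]
  refine sum_congr rfl fun n _ => ?_
  rw [mul_left_comm, natCast_mul_wd_candZero hk, mul_one]

lemma invPsi_mul_euler_sum (n : ℕ) :
    invPsi * euler (∑ p ∈ antidiagonal n, X ^ p.1 * wdSeries p.1 * (X ^ p.2 * wdSeries p.2))
      = (∑ p ∈ antidiagonal n, X ^ p.1 * wdSeries p.1 * (ratC (u p.2) * X ^ p.2)) * 2 := by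
  have h2 : ∀ p : ℕ × ℕ, invPsi * euler (X ^ p.1 * wdSeries p.1 * (X ^ p.2 * wdSeries p.2))
      = X ^ p.1 * wdSeries p.1 * (ratC (u p.2) * X ^ p.2)
        + X ^ p.2 * wdSeries p.2 * (ratC (u p.1) * X ^ p.1) := by
    intro p
    rw [euler_mul, euler_X_pow_mul_wdSeries, euler_X_pow_mul_wdSeries]
    linear_combination (X ^ p.1 * wdSeries p.1 * (ratC (u p.2) * X ^ p.2)
        + X ^ p.2 * wdSeries p.2 * (ratC (u p.1) * X ^ p.1)) * invPsi_mul
  have h3 := Nat.sum_antidiagonal_swap (n := n)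
    (f := fun p => (X ^ p.1 * wdSeries p.1 * (ratC (u p.2) * X ^ p.2) : 𝓡⟦X⟧))
  simp only [Prod.fst_swap, Prod.snd_swap] at h3
  rw [map_sum, mul_sum, sum_congr rfl fun p _ => h2 p, sum_add_distrib, h3, mul_two]

lemma natCast_mul_sum_bilOp_candZero (k : ℕ) :
    (k : 𝓡) * ∑ q ∈ antidiagonal k, bilOp k (candZero q.1) (candZero q.2)
      = subCoeff k (2 * (linSeries (fun n => u n - u n / n) - quadSeries treeKernel)) := by
  have h1 := sum_wdSeries_subCoeff k u 2
  simp only [sum_div_mul] at h1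
  rw [mul_comm 2, show treeKernel = fun n l => treeKernel n l from rfl]
  simp only [treeKernel]
  rw [← h1, sum_bilOp k candZero candZero _ _ wd_candZero wd_candZero, mul_sum]
  refine sum_congr rfl fun n _ => ?_
  rw [mul_left_comm, natCast_mul_subCoeff, invPsi_mul_euler_sum]

lemma quadSeries_treeKernel :
    quadSeries (fun n l => u (n + l)) - 2 * quadSeries treeKernel = 2 * psi 0 ^ 2 := by
  rw [two_mul (quadSeries _)]
  nth_rw 1 [← quadSeries_swap treeKernel]
  rw [quadSeries_add, quadSeries_sub, sq, psi, linSeries_mul_linSeries, ← ratC_ofNat_two,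
    ratC_mul_quadSeries]
  refine quadSeries_congr fun n hn l hl => ?_
  have := treeKernel_add_treeKernel hn hl
  simp only [pow_zero, one_mul]
  linear_combination -this

lemma quadSeries_treeKernelOne :
    quadSeries (fun n l => (n + l) * u (n + l)) - 2 * quadSeries treeKernelOne
      = 2 * (psi 1 * (2 * psi 0 + linSeries r)) := by
  rw [two_mul (quadSeries _)]
  nth_rw 1 [← quadSeries_swap treeKernelOne]
  have h : 2 * (psi 1 * (2 * psi 0 + linSeries r)) = ratC 2 * (psi 1 * psi 0) +
      ratC 2 * (psi 0 * psi 1) + psi 1 * linSeries r + linSeries r * psi 1 := by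
    rw [ratC_ofNat_two]; ring
  rw [h, psi, psi]
  simp only [quadSeries_add, quadSeries_sub, linSeries_mul_linSeries, ratC_mul_quadSeries]
  refine quadSeries_congr fun n hn l hl => ?_
  have := treeKernelOne_add hn hl
  simp only [pow_zero, one_mul, pow_one]
  linear_combination -this

lemma quadSeries_treeKernelTwo :
    quadSeries (fun n l => (n + l) * ((n + l) * u (n + l))) - 2 * quadSeries treeKernelTwo
      = 2 * (2 * psi 2 * psi 0 + 2 * psi 1 ^ 2 + psi 1 * linSeries (fun n => n * r n)
        + psi 2 * linSeries r) + psi 1 * linSeries (fun n => n * r n) := by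
  rw [two_mul (quadSeries _)]
  nth_rw 1 [← quadSeries_swap treeKernelTwo]
  have h : 2 * (2 * psi 2 * psi 0 + 2 * psi 1 ^ 2 + psi 1 * linSeries (fun n => n * r n)
        + psi 2 * linSeries r) + psi 1 * linSeries (fun n => n * r n)
      = ratC 2 * (psi 2 * psi 0) + ratC 2 * (psi 0 * psi 2) + ratC 4 * (psi 1 * psi 1)
        + ratC (3 / 2) * (psi 1 * linSeries (fun n => n * r n))
        + ratC (3 / 2) * (linSeries (fun n => n * r n) * psi 1)
        + psi 2 * linSeries r + linSeries r * psi 2 := by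
    have h4 : ratC 4 = 4 := map_ofNat ratC 4
    have h3 : ratC (3 / 2) * 2 = 3 := by
      rw [← ratC_ofNat_two, ← map_mul, ← map_ofNat ratC 3]; norm_num
    rw [ratC_ofNat_two, h4]
    linear_combination (-(psi 1 * linSeries (fun n => n * r n))) * h3
  rw [h, psi, psi, psi]
  simp only [quadSeries_add, quadSeries_sub, linSeries_mul_linSeries, ratC_mul_quadSeries]
  refine quadSeries_congr fun n hn l hl => ?_
  have := treeKernelTwo_add hn hl
  simp only [pow_zero, one_mul, pow_one]
  linear_combination -this

lemma candZero_cutJoin {k : ℕ} (hk : k ≠ 0) :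
    2 * (k * candZero k + degOp k (candZero k) - 2 * candZero k)
      = cutOp k (candZero k)
        + ∑ q ∈ antidiagonal k, bilOp k (candZero q.1) (candZero q.2) := by
  apply mul_left_cancel₀ (show (k : 𝓡) ≠ 0 by exact_mod_cast hk)
  have h4 : linSeries (fun n => u n - u n / n) = psi 0 - linSeries fun n => u n / n := by
    rw [psi, linSeries_sub]; simp only [pow_zero, one_mul]
  have e1 := natCast_sq_mul_candZero hk
  have e2 := degOp_candZero hk
  have e3 := natCast_mul_candZero hk
  rw [mul_add, natCast_mul_cutOp_candZero hk, natCast_mul_sum_bilOp_candZero, ← subCoeff_add]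
  have h5 : (quadSeries fun n l => u (n + l))
        + 2 * (linSeries (fun n => u n - u n / n) - quadSeries treeKernel)
      = 2 * (psi 0 + (linSeries fun n => u n / n) - 2 * genZero) := by
    rw [h4, genZero]
    linear_combination quadSeries_treeKernel - 2 * psi 0 ^ 2 * ratC_half
  rw [h5, subCoeff_two_mul, subCoeff_sub, subCoeff_add, subCoeff_two_mul, ← e1, ← e2, ← e3]
  ring

lemma candOne_series_identity {K : Type*} [CommRing K] (y p0 p1 p2 r0 r1 A J1 J2 E1 E2 : K)
    (hy : y * (1 - p1) = 1)
    (hA : 2 * A = 3 * r1 + 4 * p1 - 2 * r0 - 4 * p0)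
    (h1 : J1 - 2 * E1 = 2 * (p1 * (2 * p0 + r0)))
    (h2 : J2 - 2 * E2 = 2 * (2 * p2 * p0 + 2 * p1 ^ 2 + p1 * r1 + p2 * r0) + p1 * r1) :
    2 * (y * (p2 * y - p1) + y * (p1 - p0 + p0 * p2 * y))
      = ((J2 - J1) * y + J1 * (p2 * y ^ 2)) + 2 * A
        + 2 * ((p2 - p0 - A - (E2 - E1)) * y + (p1 - r0 - p0 - E1) * (p2 * y ^ 2)) := by
  grind

/-- The series whose composition gives `24 * wd j` of the genus-one candidates. -/
noncomputable def wdSeriesOne (j : ℕ) : 𝓡⟦X⟧ :=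
  ratC (j * (j * u j) - j * u j) * X ^ j * invPsi
    + ratC (j * u j) * X ^ j * (psi 2 * invPsi ^ 2)

lemma wd_candOne (k j : ℕ) :
    wd j (candOne k) = MvPolynomial.C (1 / 24) * subCoeff k (wdSeriesOne j) := by
  rw [wd_apply, pderiv_candOne, mul_left_comm, ← map_natCast (MvPolynomial.C (σ := ℕ) (R := ℚ)) j,
    ← subCoeff_ratC_mul]
  congr 2
  rw [wdSeriesOne]
  simp only [map_sub, map_mul]
  ring

lemma joinOp_candZero {k : ℕ} (hk : k ≠ 0) :
    joinOp k (candZero k) = MvPolynomial.C (1 / 24) * subCoeff k (2 * linSeries treePrim) := by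
  have h : joinOp k (candZero k) = subCoeff k (ratC (1 / 12) * linSeries treePrim) := by
    rw [ratC_mul_linSeries, ← mul_one (linSeries _), subCoeff_linSeries_mul, joinOp]
    refine sum_congr rfl fun n _ => ?_
    congr 1
    rw [sum_congr rfl fun p _ => wd_wd_candZero hk p.1 p.2, ← subCoeff_sum, mul_one]
    congr 1
    have h2 : ∀ p ∈ antidiagonal n, ratC (p.1 * u p.1 * (p.2 * u p.2) / ((p.1 + p.2 : ℕ) : ℚ))
        * (X ^ (p.1 + p.2) : 𝓡⟦X⟧) = ratC (p.1 * u p.1 * (p.2 * u p.2) / n) * X ^ n := by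
      intro p hp
      rw [HasAntidiagonal.mem_antidiagonal] at hp
      rw [hp]
    rw [sum_congr rfl h2, ← sum_mul, ← map_sum, ← sum_div]
    congr 2
    have := twelve_mul_sum_mul n
    rcases eq_or_ne n 0 with rfl | hn
    · simp [treePrim, treeSq]
    · have hn' : (n : ℚ) ≠ 0 := by exact_mod_cast hn
      rw [div_eq_iff hn']
      linear_combination this / 12
  rw [h, ← ratC_ofNat_two, subCoeff_ratC_mul, subCoeff_ratC_mul, ← mul_assoc, ← map_mul]
  norm_num

lemma cutOp_candOne (k : ℕ) :
    cutOp k (candOne k) = MvPolynomial.C (1 / 24) * subCoeff k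
      ((quadSeries (fun n l => (n + l) * ((n + l) * u (n + l)))
        - quadSeries fun n l => (n + l) * u (n + l)) * invPsi
        + quadSeries (fun n l => (n + l) * u (n + l)) * (psi 2 * invPsi ^ 2)) := by
  have h1 := sum_cut_subCoeff k (fun n => n * (n * u n) - n * u n) invPsi
  have h2 := sum_cut_subCoeff k (fun n => n * u n) (psi 2 * invPsi ^ 2)
  simp only [Nat.cast_add] at h1 h2
  rw [quadSeries_sub, subCoeff_add, ← h1, ← h2, cutOp, ← sum_add_distrib, mul_sum]
  refine sum_congr rfl fun n _ => ?_
  rw [wd_candOne, wdSeriesOne, subCoeff_add]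
  ring

lemma sum_bilOp_candZero_candOne (k : ℕ) :
    ∑ q ∈ antidiagonal k, bilOp k (candZero q.1) (candOne q.2)
      = MvPolynomial.C (1 / 24) * subCoeff k
        ((psi 2 - psi 0 - linSeries treePrim
          - (quadSeries treeKernelTwo - quadSeries treeKernelOne)) * invPsi
        + (psi 1 - linSeries r - psi 0 - quadSeries treeKernelOne) * (psi 2 * invPsi ^ 2)) := by
  have h1 := sum_wdSeries_subCoeff k (fun n => n * (n * u n) - n * u n) invPsi
  have h2 := sum_wdSeries_subCoeff k (fun n => n * u n) (psi 2 * invPsi ^ 2)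
  have h3 : linSeries (fun n => n * (n * u n) - u n - treePrim n)
      = psi 2 - psi 0 - linSeries treePrim := by
    rw [psi, psi]
    simp only [linSeries_sub, pow_zero, one_mul, sq, mul_assoc]
  have h4 : linSeries (fun n => n * u n - r n - u n) = psi 1 - linSeries r - psi 0 := by
    rw [psi, psi]
    simp only [linSeries_sub, pow_zero, one_mul, pow_one]
  have h5 : quadSeries treeKernelTwo - quadSeries treeKernelOne
      = quadSeries fun n l => ∑ p ∈ antidiagonal n,
        l * u l * u p.1 / (p.1 + l) * (p.2 * (p.2 * u p.2) - p.2 * u p.2) := by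
    rw [quadSeries_sub]
    simp only [treeKernelTwo, treeKernelOne, mul_sub, sum_sub_distrib]
  simp only [sum_div_mul_sq] at h1
  simp only [sum_div_mul_id] at h2
  rw [h3, ← h5] at h1
  rw [h4] at h2
  change _ = subCoeff k ((_ - quadSeries treeKernelOne) * _) at h2
  rw [subCoeff_add, ← h1, ← h2, sum_bilOp k candZero candOne _
    (fun j => ratC (1 / 24) * wdSeriesOne j) wd_candZero (fun k i => by
      rw [wd_candOne, subCoeff_ratC_mul]), ← sum_add_distrib, mul_sum]
  refine sum_congr rfl fun n _ => ?_
  rw [← mul_add, ← subCoeff_add, mul_left_comm, ← subCoeff_ratC_mul]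
  congr 2
  rw [sum_mul, sum_mul, ← sum_add_distrib, mul_sum]
  refine sum_congr rfl fun p _ => ?_
  rw [wdSeriesOne]
  ring

lemma candOne_cutJoin {k : ℕ} (hk : k ≠ 0) :
    2 * (k * candOne k + degOp k (candOne k))
      = cutOp k (candOne k) + joinOp k (candZero k)
        + 2 * ∑ q ∈ antidiagonal k, bilOp k (candZero q.1) (candOne q.2) := by
  have hA : 2 * linSeries treePrim = 3 * linSeries (fun n => n * r n) + 4 * psi 1
      - 2 * linSeries r - 4 * psi 0 := by
    have h4 : ratC 4 = 4 := map_ofNat ratC 4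
    have h3 : ratC 3 = 3 := map_ofNat ratC 3
    rw [← ratC_ofNat_two, ← h4, ← h3, psi, psi]
    simp only [ratC_mul_linSeries, linSeries_add, linSeries_sub]
    refine linSeries_congr fun n _ => ?_
    rw [treePrim]
    ring
  rw [natCast_mul_candOne, degOp_candOne, joinOp_candZero hk, cutOp_candOne,
    sum_bilOp_candZero_candOne]
  have key := congrArg (subCoeff k) (candOne_series_identity _ _ _ _ _ _ _ _ _ _ _ invPsi_mul hA
    quadSeries_treeKernelOne quadSeries_treeKernelTwo)
  rw [subCoeff_two_mul, subCoeff_add _ _ (2 * (_ + _)), subCoeff_two_mul _ (_ + _),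
    subCoeff_add _ _ (2 * linSeries _), subCoeff_add _ (invPsi * _)] at key
  linear_combination MvPolynomial.C (1 / 24) * key

end CutJoinEquations

end HurwitzGenusOne

namespace HurwitzGenusOne

open PowerSeries Finset

section FinalCoefficient

local notation "𝓡" => MvPolynomial ℕ ℚ
local notation "u" => treeCoeff

/-- Iterated partial derivatives. -/
noncomputable def iterPderiv (l : List ℕ) (p : 𝓡) : 𝓡 :=
  l.foldr (fun j q => MvPolynomial.pderiv j q) p

lemma factorial_prod_add_single (t : ℕ →₀ ℕ) (j : ℕ) :
    ((t + Finsupp.single j 1).prod fun _ n => (n.factorial : ℚ))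
      = (t.prod fun _ n => (n.factorial : ℚ)) * (t j + 1) := by
  classical
  have h0 : ∀ s : ℕ →₀ ℕ, s.support ⊆ insert j t.support →
      (s.prod fun _ n => (n.factorial : ℚ)) = ∏ i ∈ insert j t.support, ((s i).factorial : ℚ) :=
    fun s hs => Finsupp.prod_of_support_subset _ hs _ fun _ _ => by simp
  rw [h0 t (subset_insert _ _), h0]
  · rw [← mul_prod_erase _ _ (mem_insert_self j _), ← mul_prod_erase _ _ (mem_insert_self j _),
      mul_right_comm]
    congr 1
    · simp [Nat.factorial_succ]; ring
    · refine prod_congr rfl fun i hi => ?_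
      rw [Finsupp.add_apply, Finsupp.single_eq_of_ne (ne_of_mem_erase hi), add_zero]
  · refine Finsupp.support_add.trans (union_subset (subset_insert _ _) ?_)
    exact Finsupp.support_single_subset.trans (by simp)

lemma coeff_iterPderiv (l : List ℕ) (p : 𝓡) (t : ℕ →₀ ℕ) :
    (t.prod fun _ n => (n.factorial : ℚ)) * MvPolynomial.coeff t (iterPderiv l p)
      = MvPolynomial.coeff (t + Multiset.toFinsupp (l : Multiset ℕ)) p
        * ((t + Multiset.toFinsupp (l : Multiset ℕ)).prod fun _ n => (n.factorial : ℚ)) := by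
  induction l generalizing t with
  | nil => simp [iterPderiv, mul_comm]
  | cons j l ih =>
    have h := ih (t + Finsupp.single j 1)
    have h1 : iterPderiv (j :: l) p = MvPolynomial.pderiv j (iterPderiv l p) := rfl
    have h2 : t + Multiset.toFinsupp ((j :: l : List ℕ) : Multiset ℕ)
        = t + Finsupp.single j 1 + Multiset.toFinsupp (l : Multiset ℕ) := by
      rw [← Multiset.cons_coe, ← Multiset.singleton_add, map_add, Multiset.toFinsupp_singleton,
        add_assoc]
    rw [h1, h2, ← h, MvPolynomial.coeff_pderiv, factorial_prod_add_single]
    ring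

/-- The value at `g` of the functional `∏ (κ + j S)`, where `S` is the shift of sequences. -/
def shiftProd {A : Type*} [CommRing A] (κ : A) : List ℕ → (ℕ → A) → A
  | [], g => g 0
  | j :: l, g => κ * shiftProd κ l g + j * shiftProd κ l fun n => g (n + 1)

lemma map_shiftProd {A B : Type*} [CommRing A] [CommRing B] (f : A →+* B) (κ : A) (l : List ℕ)
    (g : ℕ → A) : f (shiftProd κ l g) = shiftProd (f κ) l fun n => f (g n) := by
  induction l generalizing g with
  | nil => rfl
  | cons j l ih => simp [shiftProd, ih]

lemma esymm_cons {A : Type*} [CommRing A] (a : A) (s : Multiset A) (n : ℕ) :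
    (a ::ₘ s).esymm (n + 1) = s.esymm (n + 1) + a * s.esymm n := by
  simp [Multiset.esymm, Multiset.powersetCard_cons, Multiset.sum_map_mul_left]

lemma esymm_zero {A : Type*} [CommRing A] (s : Multiset A) : s.esymm 0 = 1 := by
  simp [Multiset.esymm]

lemma esymm_one {A : Type*} [CommRing A] (s : Multiset A) : s.esymm 1 = s.sum := by
  simp [Multiset.esymm, Multiset.powersetCard_one]

lemma esymm_of_card_lt {A : Type*} [CommRing A] (s : Multiset A) (n : ℕ) (h : s.card < n) :
    s.esymm n = 0 := by
  simp [Multiset.esymm, Multiset.powersetCard_eq_empty n h]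

lemma shiftProd_eq {A : Type*} [CommRing A] (κ : A) (l : List ℕ) (g : ℕ → A) :
    shiftProd κ l g = ∑ n ∈ range (l.length + 1),
      (Multiset.map (fun j : ℕ => (j : A)) l).esymm n * κ ^ (l.length - n) * g n := by
  induction l generalizing g with
  | nil => simp [shiftProd, esymm_zero]
  | cons j l ih =>
    rw [shiftProd, ih, ih, sum_range_succ', List.length_cons]
    have h : ∀ n ∈ range (l.length + 1),
        (Multiset.map (fun j : ℕ => (j : A)) (j :: l : List ℕ)).esymm (n + 1)
          * κ ^ (l.length + 1 - (n + 1)) * g (n + 1)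
        = (Multiset.map (fun j : ℕ => (j : A)) l).esymm (n + 1) * κ ^ (l.length - n) * g (n + 1)
          + j * ((Multiset.map (fun j : ℕ => (j : A)) l).esymm n
            * κ ^ (l.length - n) * g (n + 1)) := by
      intro n _
      rw [← Multiset.cons_coe, Multiset.map_cons, esymm_cons, Nat.add_sub_add_right]
      ring
    have h3 : ∑ n ∈ range (l.length + 1),
        (Multiset.map (fun j : ℕ => (j : A)) l).esymm (n + 1) * κ ^ (l.length - n) * g (n + 1)
        = ∑ n ∈ range l.length,
          (Multiset.map (fun j : ℕ => (j : A)) l).esymm (n + 1) * κ ^ (l.length - n)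
            * g (n + 1) := by
      rw [sum_range_succ, esymm_of_card_lt _ (l.length + 1) (by simp), zero_mul, zero_mul,
        add_zero]
    rw [sum_range_succ' _ (l.length + 1), sum_congr rfl h, sum_add_distrib, ← mul_sum, mul_add,
      mul_sum, h3]
    have h2 : ∀ n ∈ range l.length,
        κ * ((Multiset.map (fun j : ℕ => (j : A)) l).esymm (n + 1)
          * κ ^ (l.length - (n + 1)) * g (n + 1))
        = (Multiset.map (fun j : ℕ => (j : A)) l).esymm (n + 1) * κ ^ (l.length - n)
          * g (n + 1) := by
      intro n hn
      rw [mem_range] at hn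
      rw [show l.length - n = l.length - (n + 1) + 1 by omega, pow_succ]
      ring
    rw [sum_congr rfl h2]
    simp only [esymm_zero, Nat.sub_zero]
    ring

lemma pd_expPsi_pow (j k : ℕ) :
    pd j (expPsi ^ k) = (k : 𝓡⟦X⟧) * (ratC (u j) * X ^ j) * expPsi ^ k := by
  apply mul_left_cancel₀ expPsi_ne_zero
  rw [pd_pow, pd_expPsi]; ring

lemma pd_add_mul_expPsi_pow (j k : ℕ) (f f' : 𝓡⟦X⟧)
    (hf : pd j f = ratC (j * u j) * X ^ j * f') :
    pd j (f * expPsi ^ k) = ratC (u j) * X ^ j * (((k : 𝓡⟦X⟧) * f + (j : 𝓡⟦X⟧) * f') * expPsi ^ k) := by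
  rw [pd_mul, hf, pd_expPsi_pow, map_mul, ratC_natCast]; ring

lemma pd_shiftProd (j k : ℕ) (l : List ℕ) (g : ℕ → 𝓡⟦X⟧)
    (hg : ∀ i, pd j (g i) = ratC (j * u j) * X ^ j * g (i + 1)) :
    pd j (shiftProd (k : 𝓡⟦X⟧) l g)
      = ratC (j * u j) * X ^ j * shiftProd (k : 𝓡⟦X⟧) l fun n => g (n + 1) := by
  induction l generalizing g with
  | nil => exact hg 0
  | cons i l ih =>
    rw [shiftProd, shiftProd, pd_add, pd_mul, pd_mul, pd_natCast, pd_natCast, ih _ hg,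
      ih _ fun i => hg (i + 1)]
    ring

lemma iterPderiv_coeff (k : ℕ) (l : List ℕ) (g : ℕ → 𝓡⟦X⟧)
    (hg : ∀ j i, pd j (g i) = ratC (j * u j) * X ^ j * g (i + 1)) (n : ℕ) :
    iterPderiv l (coeff n (g 0 * expPsi ^ k))
      = coeff n (ratC (l.map u).prod * X ^ l.sum * (shiftProd (k : 𝓡⟦X⟧) l g * expPsi ^ k)) := by
  induction l with
  | nil => simp [iterPderiv, shiftProd]
  | cons j l ih =>
    have h1 : iterPderiv (j :: l) (coeff n (g 0 * expPsi ^ k))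
        = MvPolynomial.pderiv j (iterPderiv l (coeff n (g 0 * expPsi ^ k))) := rfl
    rw [h1, ih, ← coeff_pd, mul_assoc, pd_ratC_mul, pd_mul, pd_X_pow, zero_mul, zero_add,
      pd_add_mul_expPsi_pow _ _ _ _ (pd_shiftProd j k l g (hg j)), shiftProd, List.map_cons,
      List.prod_cons, List.sum_cons, map_mul ratC, pow_add]
    congr 1
    ring

lemma constantCoeff_iterPderiv_coeff (l : List ℕ) (g : ℕ → 𝓡⟦X⟧)
    (hg : ∀ j i, pd j (g i) = ratC (j * u j) * X ^ j * g (i + 1)) :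
    MvPolynomial.constantCoeff (iterPderiv l (coeff l.sum (g 0 * expPsi ^ l.sum)))
      = (l.map u).prod * shiftProd (l.sum : ℚ) l fun n =>
        MvPolynomial.constantCoeff (constantCoeff (g n)) := by
  have h := map_shiftProd ((MvPolynomial.constantCoeff (R := ℚ) (σ := ℕ)).comp
    (constantCoeff (R := 𝓡))) (l.sum : 𝓡⟦X⟧) l g
  simp only [map_natCast, RingHom.comp_apply] at h
  rw [iterPderiv_coeff _ _ _ hg, ← h, mul_assoc, coeff_ratC_mul]
  have h2 := coeff_X_pow_mul (shiftProd (l.sum : 𝓡⟦X⟧) l g * expPsi ^ l.sum) l.sum 0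
  rw [zero_add] at h2
  rw [h2, coeff_zero_eq_constantCoeff_apply, map_mul, map_mul, map_mul, map_pow,
    constantCoeff_expPsi, one_pow, map_one, mul_one, MvPolynomial.constantCoeff_C]

/-- The successive derivatives of `(1 - psi 1) * logPsi`. -/
noncomputable def logSeq : ℕ → 𝓡⟦X⟧
  | 0 => logPsi * (1 - psi 1)
  | 1 => 1 - logPsi
  | n + 2 => -(ratC (n.factorial : ℚ) * invPsi ^ (n + 1))

lemma pd_logSeq (j i : ℕ) :
    pd j (logSeq i) = ratC (j * u j) * X ^ j * logSeq (i + 1) := by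
  match i with
  | 0 =>
    rw [logSeq, logSeq, pd_mul, pd_sub, pd_one, pd_psi, pd_logPsi, pow_one]
    linear_combination (ratC (j * u j) * X ^ j) * invPsi_mul
  | 1 =>
    rw [logSeq, logSeq, pd_sub, pd_one, pd_logPsi]
    simp
  | n + 2 =>
    have h : pd j (invPsi ^ (n + 1))
        = ((n + 1 : ℕ) : 𝓡⟦X⟧) * invPsi ^ n * (ratC (j * u j) * X ^ j * invPsi ^ 2) := by
      have h0 : invPsi ≠ 0 := left_ne_zero_of_mul_eq_one invPsi_mul
      apply mul_left_cancel₀ h0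
      rw [pd_pow, pd_invPsi]; ring
    rw [logSeq, logSeq, ← neg_one_mul, ← map_one ratC, ← map_neg, pd_ratC_mul, pd_ratC_mul, h,
      Nat.factorial_succ, Nat.cast_mul, map_mul ratC ((n + 1 : ℕ) : ℚ), ratC_natCast, ratC_natCast, map_neg,
      map_one]
    ring

/-- The successive derivatives of `psi 1`. -/
noncomputable def psiSeq : ℕ → 𝓡⟦X⟧
  | 0 => psi 1
  | 1 => 1
  | _ + 2 => 0

lemma pd_psiSeq (j i : ℕ) :
    pd j (psiSeq i) = ratC (j * u j) * X ^ j * psiSeq (i + 1) := by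
  match i with
  | 0 => rw [psiSeq, psiSeq, pd_psi, pow_one, mul_one]
  | 1 => rw [psiSeq, psiSeq, pd_one, mul_zero]
  | n + 2 => rw [psiSeq, psiSeq, ← map_zero ratC, pd_ratC, map_zero, mul_zero]

lemma constantCoeff_invPsi : constantCoeff invPsi = 1 := by
  have := congrArg constantCoeff invPsi_mul
  simpa [constantCoeff_psi] using this

lemma constantCoeff_iterPderiv_logPsi (l : List ℕ) (hl : l ≠ []) :
    MvPolynomial.constantCoeff (iterPderiv l (subCoeff l.sum logPsi))
      = (l.map u).prod * ((l.sum : ℚ) ^ l.length - ∑ i ∈ Icc 2 l.length,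
        ((i - 2).factorial : ℚ) * (Multiset.map (fun j : ℕ => (j : ℚ)) l).esymm i
          * (l.sum : ℚ) ^ (l.length - i)) := by
  have h := constantCoeff_iterPderiv_coeff l logSeq pd_logSeq
  rw [subCoeff, coeff_lagrange, euler_psi]
  refine h.trans ?_
  congr 1
  obtain ⟨m, hm⟩ : ∃ m, l.length = m + 1 :=
    Nat.exists_eq_succ_of_ne_zero (by simpa using hl)
  rw [shiftProd_eq, hm, sum_range_succ', sum_range_succ']
  simp only [logSeq, map_mul, map_sub, map_neg, map_one, map_pow, constantCoeff_logPsi,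
    constantCoeff_invPsi, zero_mul, map_zero, mul_zero, add_zero, sub_zero, mul_one, one_pow]
  rw [zero_add, esymm_one, sub_eq_neg_add]
  congr 1
  · rw [← sum_neg_distrib]
    refine sum_nbij' (fun n => n + 1 + 1) (fun n => n - 2) ?_ ?_ ?_ ?_ ?_
    · intro n hn; simp at hn ⊢; omega
    · intro n hn; simp at hn ⊢; omega
    · intro n hn; simp
    · intro n hn; simp at hn ⊢; omega
    · intro n hn
      simp
      ring
  · have : (Multiset.map (fun j : ℕ => (j : ℚ)) l).sum = (l.sum : ℚ) := by
      simp
    rw [this, Nat.add_sub_cancel, pow_succ']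

lemma constantCoeff_iterPderiv_psi (l : List ℕ) (hl : l ≠ []) (h0 : l.sum ≠ 0) :
    MvPolynomial.constantCoeff (iterPderiv l (subCoeff l.sum (psi 0)))
      = (l.map u).prod * (l.sum : ℚ) ^ (l.length - 1) := by
  have h := constantCoeff_iterPderiv_coeff l psiSeq pd_psiSeq
  have hk : (l.sum : ℚ) ≠ 0 := by exact_mod_cast h0
  have h1 : subCoeff l.sum (psi 0)
      = MvPolynomial.C (1 / (l.sum : ℚ)) * coeff l.sum (psi 1 * expPsi ^ l.sum) := by
    have := natCast_mul_subCoeff_eq l.sum (psi 0)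
    rw [euler_psi] at this
    rw [← this, ← mul_assoc, mul_comm _ (l.sum : 𝓡), natCast_mul_C_one_div h0, one_mul]
  have h2 : ∀ (a : ℚ) (l : List ℕ) (p : 𝓡),
      iterPderiv l (MvPolynomial.C a * p) = MvPolynomial.C a * iterPderiv l p := by
    intro a l p
    induction l with
    | nil => rfl
    | cons j l ih =>
      change MvPolynomial.pderiv j (iterPderiv l _) = _ * MvPolynomial.pderiv j (iterPderiv l _)
      rw [ih, MvPolynomial.pderiv_C_mul]
  rw [h1, h2, map_mul, MvPolynomial.constantCoeff_C, show psi 1 = psiSeq 0 from rfl, h]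
  obtain ⟨m, hm⟩ : ∃ m, l.length = m + 1 :=
    Nat.exists_eq_succ_of_ne_zero (by simpa using hl)
  rw [shiftProd_eq, hm, sum_range_succ', sum_range_succ']
  simp only [psiSeq, map_one, constantCoeff_psi, map_zero, mul_zero, add_zero, mul_one,
    sum_const_zero, zero_add, esymm_one]
  have : (Multiset.map (fun j : ℕ => (j : ℚ)) l).sum = (l.sum : ℚ) := by
    simp
  rw [this, Nat.add_sub_cancel]
  field_simp

lemma coeff_candOne (α : Multiset ℕ) (h0 : α.sum ≠ 0) :
    MvPolynomial.coeff (Multiset.toFinsupp α) (candOne α.sum)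
        * (∏ j ∈ α.toFinset, ((α.count j).factorial : ℚ))
      = 1 / 24 * (α.map u).prod * ((α.sum : ℚ) ^ α.card - (α.sum : ℚ) ^ (α.card - 1)
        - ∑ i ∈ Icc 2 α.card, ((i - 2).factorial : ℚ)
          * (α.map (fun j : ℕ => (j : ℚ))).esymm i * (α.sum : ℚ) ^ (α.card - i)) := by
  induction α using Quotient.inductionOn with
  | h l =>
  simp only [Multiset.quot_mk_to_coe, Multiset.sum_coe, Multiset.coe_card, Multiset.map_coe,
    Multiset.prod_coe] at h0 ⊢
  have hl : l ≠ [] := by rintro rfl; simp at h0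
  have h := fun p => coeff_iterPderiv l p 0
  have h1 := h (subCoeff l.sum logPsi)
  have h2 := h (subCoeff l.sum (psi 0))
  simp only [Finsupp.prod_zero_index, one_mul, zero_add, ← MvPolynomial.constantCoeff_eq] at h1 h2
  rw [constantCoeff_iterPderiv_logPsi l hl] at h1
  rw [constantCoeff_iterPderiv_psi l hl h0] at h2
  have h3 : ((Multiset.toFinsupp (l : Multiset ℕ)).prod fun _ n => (n.factorial : ℚ))
      = ∏ j ∈ (l : Multiset ℕ).toFinset, (((l : Multiset ℕ).count j).factorial : ℚ) := by
    rw [Finsupp.prod, Multiset.toFinsupp_support]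
    rfl
  rw [h3] at h1 h2
  rw [candOne, subCoeff_sub, MvPolynomial.coeff_C_mul, MvPolynomial.coeff_sub]
  simp only [Multiset.map_coe] at h1
  linear_combination (-1 / 24 : ℚ) * h1 + (1 / 24 : ℚ) * h2

end FinalCoefficient

end HurwitzGenusOne

namespace HurwitzGenusOne

open Finset Equiv Equiv.Perm

section CycleType

variable {V : Type*} [Fintype V] [DecidableEq V]

/-- The cycle of `v` under `σ`. -/
def orb (σ : Perm V) (v : V) : Finset V := univ.filter (SameCycle σ v)

lemma mem_orb {σ : Perm V} {v w : V} : w ∈ orb σ v ↔ SameCycle σ v w := by simp [orb]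

/-- The length of the cycle of `v` under `σ`. -/
def cycLen (σ : Perm V) (v : V) : ℕ := (orb σ v).card

lemma cycLen_pos (σ : Perm V) (v : V) : 0 < cycLen σ v :=
  card_pos.2 ⟨v, mem_orb.2 (SameCycle.refl _ _)⟩

lemma cycLen_le (σ : Perm V) (v : V) : cycLen σ v ≤ Fintype.card V := card_le_univ _

lemma orb_eq_of_sameCycle {σ : Perm V} {v w : V} (h : SameCycle σ v w) : orb σ v = orb σ w := by
  ext x
  rw [mem_orb, mem_orb]
  exact ⟨fun hx => h.symm.trans hx, fun hx => h.trans hx⟩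

lemma cycLen_eq_of_sameCycle {σ : Perm V} {v w : V} (h : SameCycle σ v w) :
    cycLen σ v = cycLen σ w := by rw [cycLen, cycLen, orb_eq_of_sameCycle h]

lemma disjoint_orb {σ : Perm V} {v w : V} (h : ¬ SameCycle σ v w) :
    _root_.Disjoint (orb σ v) (orb σ w) := by
  rw [Finset.disjoint_left]
  intro x hx hx'
  exact h ((mem_orb.1 hx).trans (mem_orb.1 hx').symm)

lemma cycLen_eq_minimalPeriod (σ : Perm V) (v : V) :
    cycLen σ v = Function.minimalPeriod σ v ∧
      orb σ v = (range (cycLen σ v)).image fun i => (σ ^ i) v := by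
  have hp : 0 < Function.minimalPeriod σ v :=
    Function.minimalPeriod_pos_of_mem_periodicPts (σ.injective.mem_periodicPts v)
  have h : orb σ v = (range (Function.minimalPeriod σ v)).image fun i => (σ ^ i) v := by
    ext w
    rw [mem_orb, mem_image]
    constructor
    · intro hw
      obtain ⟨i, -, hi⟩ := hw.exists_pow_eq'
      refine ⟨i % Function.minimalPeriod σ v, mem_range.2 (Nat.mod_lt _ hp), ?_⟩
      rw [← hi, Perm.coe_pow, Perm.coe_pow, Function.iterate_mod_minimalPeriod_eq]
    · rintro ⟨i, -, rfl⟩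
      exact sameCycle_pow_right.2 (SameCycle.refl _ _)
  have h2 : cycLen σ v = Function.minimalPeriod σ v := by
    rw [cycLen, h, card_image_of_injOn, card_range]
    intro i hi j hj hij
    rw [coe_range, Set.mem_Iio] at hi hj
    simp only [Perm.coe_pow] at hij
    exact (Function.iterate_eq_iterate_iff_of_lt_minimalPeriod hi hj).1 hij
  exact ⟨h2, h2 ▸ h⟩

lemma pow_injOn_cycLen (σ : Perm V) (v : V) {i j : ℕ} (hi : i < cycLen σ v)
    (hj : j < cycLen σ v) (h : (σ ^ i) v = (σ ^ j) v) : i = j := by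
  rw [(cycLen_eq_minimalPeriod σ v).1] at hi hj
  simp only [Perm.coe_pow] at h
  exact (Function.iterate_eq_iterate_iff_of_lt_minimalPeriod hi hj).1 h

lemma exists_pow_of_sameCycle {σ : Perm V} {v w : V} (h : SameCycle σ v w) :
    ∃ i < cycLen σ v, (σ ^ i) v = w := by
  have := mem_orb.2 h
  rw [(cycLen_eq_minimalPeriod σ v).2, mem_image] at this
  obtain ⟨i, hi, h⟩ := this
  exact ⟨i, mem_range.1 hi, h⟩

/-- A property preserved by `σ` propagates along cycles. -/
lemma sameCycle_induction {σ : Perm V} {p : V → Prop} (hp : ∀ x, p x → p (σ x)) {v w : V}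
    (h : SameCycle σ v w) (hv : p v) : p w := by
  obtain ⟨i, -, rfl⟩ := exists_pow_of_sameCycle h
  induction i with
  | zero => simpa using hv
  | succ i ih =>
    rw [pow_succ', Perm.mul_apply]
    exact hp _ (ih (sameCycle_pow_right.2 (SameCycle.refl _ _)))

/-- The cycle type, counting fixed points as cycles of length one. -/
def cycParts (σ : Perm V) : Multiset ℕ :=
  σ.cycleType + Multiset.replicate (Fintype.card V - σ.support.card) 1

lemma zero_notMem_cycParts (σ : Perm V) : 0 ∉ cycParts σ := by
  intro h
  rw [cycParts, Multiset.mem_add] at h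
  rcases h with h | h
  · have := two_le_of_mem_cycleType h
    omega
  · have := Multiset.eq_of_mem_replicate h
    omega

lemma mul_count_cycParts (σ : Perm V) (i : ℕ) :
    i * (cycParts σ).count i = (univ.filter fun v => cycLen σ v = i).card := by
  have h1 : ∀ v, v ∉ σ.support → cycLen σ v = 1 := by
    intro v hv
    rw [cycLen, card_eq_one]
    refine ⟨v, ?_⟩
    ext w
    rw [mem_orb, mem_singleton]
    constructor
    · intro h
      exact sameCycle_induction (p := fun x => x = v)
        (fun x hx => by rw [hx]; exact notMem_support.1 hv) h rfl
    · rintro rfl; exact SameCycle.refl _ _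
  have h2 : ∀ v ∈ σ.support, cycLen σ v = (σ.cycleOf v).support.card := by
    intro v hv
    rw [cycLen]
    congr 1
    ext w
    rw [mem_orb, mem_support_cycleOf_iff]
    exact ⟨fun h => ⟨h, hv⟩, fun h => h.1⟩
  have hsplit : (univ.filter fun v => cycLen σ v = i).card
      = (σ.support.filter fun v => cycLen σ v = i).card
        + (σ.supportᶜ.filter fun v => cycLen σ v = i).card := by
    rw [← card_union_of_disjoint, ← filter_union, union_compl]
    exact disjoint_filter_filter disjoint_compl_right
  have hA : (σ.support.filter fun v => cycLen σ v = i).card = i * σ.cycleType.count i := by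
    rw [card_eq_sum_card_fiberwise (f := σ.cycleOf) (t := σ.cycleFactorsFinset)
      (fun v hv => by
        rw [coe_filter, Set.mem_ofPred_eq] at hv
        exact cycleOf_mem_cycleFactorsFinset_iff.2 hv.1)]
    have h3 : ∀ c ∈ σ.cycleFactorsFinset,
        ((σ.support.filter fun v => cycLen σ v = i).filter fun v => σ.cycleOf v = c).card
          = if c.support.card = i then i else 0 := by
      intro c hc
      have h4 : ((σ.support.filter fun v => cycLen σ v = i).filter fun v => σ.cycleOf v = c)
          = if c.support.card = i then c.support else ∅ := by
        ext v
        simp only [mem_filter]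
        constructor
        · rintro ⟨⟨hv, hi⟩, rfl⟩
          rw [if_pos ((h2 v hv).symm.trans hi)]
          exact mem_support_cycleOf_iff.2 ⟨SameCycle.refl _ _, hv⟩
        · intro hv
          split_ifs at hv with hi
          · have h5 := cycle_is_cycleOf hv hc
            have h6 := mem_cycleFactorsFinset_support_le hc hv
            exact ⟨⟨h6, by rw [h2 v h6, ← h5, hi]⟩, h5.symm⟩
          · simp at hv
      rw [h4]
      split_ifs with hi
      · exact hi
      · simp
    rw [sum_congr rfl h3, ← sum_filter, sum_const, smul_eq_mul, mul_comm, cycleType_def,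
      Multiset.count_map]
    congr 1
    rw [Finset.card_def, filter_val]
    simp only [Function.comp_apply, eq_comm]
  have hB : (σ.supportᶜ.filter fun v => cycLen σ v = i).card
      = i * (Multiset.replicate (Fintype.card V - σ.support.card) 1).count i := by
    rw [Multiset.count_replicate]
    by_cases hi : i = 1
    · subst hi
      rw [filter_true_of_mem (fun v hv => h1 v (mem_compl.1 hv)), card_compl]
      simp
    · rw [filter_false_of_mem (fun v hv => by rw [h1 v (mem_compl.1 hv)]; exact Ne.symm hi)]
      simp [Ne.symm hi]
  rw [hsplit, hA, hB, cycParts, Multiset.count_add, mul_add]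

/-- A multiset of cycle lengths is determined by the number of points on cycles of each length. -/
lemma eq_of_mul_count_eq {s t : Multiset ℕ} (hs : 0 ∉ s) (ht : 0 ∉ t)
    (h : ∀ i, i * s.count i = i * t.count i) : s = t := by
  ext i
  rcases Nat.eq_zero_or_pos i with rfl | hi
  · rw [Multiset.count_eq_zero_of_notMem hs, Multiset.count_eq_zero_of_notMem ht]
  · exact Nat.eq_of_mul_eq_mul_left hi (h i)

lemma cycLen_mem_cycParts (σ : Perm V) (v : V) : cycLen σ v ∈ cycParts σ := by
  rw [← Multiset.count_pos]
  have h := mul_count_cycParts σ (cycLen σ v)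
  have h2 : 0 < (univ.filter fun w => cycLen σ w = cycLen σ v).card :=
    card_pos.2 ⟨v, by simp⟩
  rw [← h] at h2
  exact Nat.pos_of_mul_pos_left h2

lemma sameCycle_mul_swap {σ : Perm V} {a b : V} (hab : ¬ SameCycle σ a b) {v w : V} :
    SameCycle (σ * swap a b) v w ↔ SameCycle σ v w ∨
      ((SameCycle σ a v ∨ SameCycle σ b v) ∧ (SameCycle σ a w ∨ SameCycle σ b w)) := by
  set τ := σ * swap a b with hτ
  have hne : a ≠ b := fun h => hab (h ▸ SameCycle.refl _ _)
  have τa : τ a = σ b := by simp [hτ]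
  have τb : τ b = σ a := by simp [hτ]
  have τo : ∀ x, x ≠ a → x ≠ b → τ x = σ x := fun x h1 h2 => by
    simp [hτ, swap_apply_of_ne_of_ne h1 h2]
  have step : ∀ {ρ : Perm V} {x y : V}, SameCycle ρ x y → SameCycle ρ x (ρ y) :=
    fun h => sameCycle_apply_right.2 h
  constructor
  · intro h
    refine sameCycle_induction (σ := τ) (p := fun x => SameCycle σ v x ∨
      ((SameCycle σ a v ∨ SameCycle σ b v) ∧ (SameCycle σ a x ∨ SameCycle σ b x))) ?_ h
      (Or.inl (SameCycle.refl _ _))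
    intro x hx
    by_cases hxa : x = a
    · subst hxa
      rw [τa]
      refine Or.inr ⟨?_, Or.inr (step (SameCycle.refl _ _))⟩
      rcases hx with hx | hx
      · exact Or.inl hx.symm
      · exact hx.1
    · by_cases hxb : x = b
      · subst hxb
        rw [τb]
        refine Or.inr ⟨?_, Or.inl (step (SameCycle.refl _ _))⟩
        rcases hx with hx | hx
        · exact Or.inr hx.symm
        · exact hx.1
      · rw [τo x hxa hxb]
        rcases hx with hx | ⟨h1, hx | hx⟩
        · exact Or.inl (step hx)
        · exact Or.inr ⟨h1, Or.inl (step hx)⟩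
        · exact Or.inr ⟨h1, Or.inr (step hx)⟩
  · have hB : ∀ x, SameCycle σ b x → SameCycle τ a x := by
      intro x hx
      have h1 : ∀ y, SameCycle σ (σ b) y → SameCycle σ (σ b) y ∧ SameCycle τ a y := by
        intro y hy
        refine sameCycle_induction (σ := σ)
          (p := fun y => SameCycle σ (σ b) y ∧ SameCycle τ a y) ?_ hy
          ⟨SameCycle.refl _ _, by rw [← τa]; exact step (SameCycle.refl _ _)⟩
        rintro z ⟨hz1, hz2⟩
        refine ⟨step hz1, ?_⟩
        by_cases hzb : z = b
        · rw [hzb, ← τa]; exact step (SameCycle.refl _ _)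
        · rw [← τo z ?_ hzb]
          · exact step hz2
          · rintro rfl
            exact hab (sameCycle_apply_left.1 hz1).symm
      exact (h1 x (sameCycle_apply_left.2 hx)).2
    have hA : ∀ x, SameCycle σ a x → SameCycle τ b x := by
      intro x hx
      have h1 : ∀ y, SameCycle σ (σ a) y → SameCycle σ (σ a) y ∧ SameCycle τ b y := by
        intro y hy
        refine sameCycle_induction (σ := σ)
          (p := fun y => SameCycle σ (σ a) y ∧ SameCycle τ b y) ?_ hy
          ⟨SameCycle.refl _ _, by rw [← τb]; exact step (SameCycle.refl _ _)⟩
        rintro z ⟨hz1, hz2⟩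
        refine ⟨step hz1, ?_⟩
        by_cases hza : z = a
        · rw [hza, ← τb]; exact step (SameCycle.refl _ _)
        · rw [← τo z hza ?_]
          · exact step hz2
          · rintro rfl
            exact hab (sameCycle_apply_left.1 hz1)
      exact (h1 x (sameCycle_apply_left.2 hx)).2
    have hAB : SameCycle τ a b := hB b (SameCycle.refl _ _)
    have hU : ∀ x, SameCycle σ a x ∨ SameCycle σ b x → SameCycle τ a x := by
      rintro x (hx | hx)
      · exact hAB.trans (hA x hx)
      · exact hB x hx
    rintro (h | ⟨h1, h2⟩)
    · by_cases hv : SameCycle σ a v ∨ SameCycle σ b v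
      · exact (hU v hv).symm.trans (hU w (hv.imp (fun h' => h'.trans h) fun h' => h'.trans h))
      · refine (sameCycle_induction (σ := σ) (p := fun y => SameCycle σ v y ∧ SameCycle τ v y) ?_ h
          ⟨SameCycle.refl _ _, SameCycle.refl _ _⟩).2
        rintro x ⟨hx1, hx2⟩
        refine ⟨step hx1, ?_⟩
        rw [← τo x]
        · exact step hx2
        · rintro rfl; exact hv (Or.inl hx1.symm)
        · rintro rfl; exact hv (Or.inr hx1.symm)
    · exact (hU v h1).symm.trans (hU w h2)

lemma cycLen_mul_swap_left {σ : Perm V} {a b : V} (hab : ¬ SameCycle σ a b) {v : V}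
    (hv : SameCycle σ a v ∨ SameCycle σ b v) :
    cycLen (σ * swap a b) v = cycLen σ a + cycLen σ b := by
  have h : orb (σ * swap a b) v = orb σ a ∪ orb σ b := by
    ext x
    rw [mem_orb, sameCycle_mul_swap hab, mem_union, mem_orb, mem_orb]
    constructor
    · rintro (h | h)
      · exact hv.imp (fun h' => h'.trans h) fun h' => h'.trans h
      · exact h.2
    · intro h
      exact Or.inr ⟨hv, h⟩
  rw [cycLen, h, card_union_of_disjoint (disjoint_orb hab)]
  rfl

lemma cycLen_mul_swap_of_not {σ : Perm V} {a b : V} (hab : ¬ SameCycle σ a b) {v : V}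
    (hv : ¬ (SameCycle σ a v ∨ SameCycle σ b v)) :
    cycLen (σ * swap a b) v = cycLen σ v := by
  have h : orb (σ * swap a b) v = orb σ v := by
    ext x
    rw [mem_orb, sameCycle_mul_swap hab, mem_orb]
    tauto
  rw [cycLen, h]
  rfl

/-- Multiplying by a transposition of points on different cycles joins these cycles. -/
lemma cycParts_mul_swap {σ : Perm V} {a b : V} (hab : ¬ SameCycle σ a b) :
    cycParts (σ * swap a b) + {cycLen σ a} + {cycLen σ b}
      = cycParts σ + {cycLen σ a + cycLen σ b} := by
  have hpa := cycLen_pos σ a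
  have hpb := cycLen_pos σ b
  apply eq_of_mul_count_eq
  · rw [Multiset.mem_add, Multiset.mem_add, Multiset.mem_singleton, Multiset.mem_singleton]
    rintro ((h | h) | h)
    exacts [zero_notMem_cycParts _ h, hpa.ne h, hpb.ne h]
  · rw [Multiset.mem_add, Multiset.mem_singleton]
    rintro (h | h)
    exacts [zero_notMem_cycParts _ h, by omega]
  intro i
  simp only [Multiset.count_add, mul_add, mul_count_cycParts, Multiset.count_singleton]
  have hsplit : ∀ ρ : Perm V, (univ.filter fun v => cycLen ρ v = i).card
      = ((orb σ a ∪ orb σ b).filter fun v => cycLen ρ v = i).card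
        + ((orb σ a ∪ orb σ b)ᶜ.filter fun v => cycLen ρ v = i).card := by
    intro ρ
    rw [← card_union_of_disjoint, ← filter_union, union_compl]
    exact disjoint_filter_filter disjoint_compl_right
  have hrest : ((orb σ a ∪ orb σ b)ᶜ.filter fun v => cycLen (σ * swap a b) v = i)
      = (orb σ a ∪ orb σ b)ᶜ.filter fun v => cycLen σ v = i := by
    refine filter_congr fun v hv => ?_
    rw [mem_compl, mem_union, mem_orb, mem_orb] at hv
    rw [cycLen_mul_swap_of_not hab hv]
  have hL : ((orb σ a ∪ orb σ b).filter fun v => cycLen (σ * swap a b) v = i).card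
      = i * if i = cycLen σ a + cycLen σ b then 1 else 0 := by
    have : ∀ v ∈ orb σ a ∪ orb σ b,
        (cycLen (σ * swap a b) v = i ↔ i = cycLen σ a + cycLen σ b) := by
      intro v hv
      rw [mem_union, mem_orb, mem_orb] at hv
      rw [cycLen_mul_swap_left hab hv, eq_comm]
    rw [filter_congr this]
    split_ifs with h
    · rw [filter_true_of_mem fun _ _ => h, card_union_of_disjoint (disjoint_orb hab), mul_one, h]
      rfl
    · rw [filter_false_of_mem fun _ _ => h]; simp
  have hR : ∀ c, ((orb σ c).filter fun v => cycLen σ v = i).card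
      = i * if i = cycLen σ c then 1 else 0 := by
    intro c
    have : ∀ v ∈ orb σ c, (cycLen σ v = i ↔ i = cycLen σ c) := by
      intro v hv
      rw [← cycLen_eq_of_sameCycle (mem_orb.1 hv), eq_comm]
    rw [filter_congr this]
    split_ifs with h
    · rw [filter_true_of_mem fun _ _ => h, mul_one, h]
      rfl
    · rw [filter_false_of_mem fun _ _ => h]; simp
  rw [hsplit, hsplit σ, hrest, hL, filter_union, card_union_of_disjoint
    (disjoint_filter_filter (disjoint_orb hab)), hR, hR]
  ring

lemma cycParts_mul_swap_eq {σ : Perm V} {a b : V} (hab : ¬ SameCycle σ a b) :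
    cycParts (σ * swap a b)
      = ((cycParts σ).erase (cycLen σ b)).erase (cycLen σ a) + {cycLen σ a + cycLen σ b} := by
  have h := cycParts_mul_swap hab
  have hb := Multiset.cons_erase (cycLen_mem_cycParts σ b)
  by_cases heq : cycLen σ a ∈ (cycParts σ).erase (cycLen σ b)
  · have ha := Multiset.cons_erase heq
    rw [← ha] at hb
    rw [← hb, ← Multiset.singleton_add, ← Multiset.singleton_add] at h
    apply add_right_cancel (b := ({cycLen σ a} + {cycLen σ b} : Multiset ℕ))
    rw [← add_assoc, h]
    abel
  · exfalso
    have hpa := cycLen_pos σ a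
    have hcount := congrArg (Multiset.count (cycLen σ a)) h
    have hb' := congrArg (Multiset.count (cycLen σ a)) hb
    rw [Multiset.count_cons, Multiset.count_eq_zero_of_notMem heq] at hb'
    simp only [Multiset.count_add, Multiset.count_singleton, if_true] at hcount
    have hpb := cycLen_pos σ b
    split_ifs at hcount hb' <;> omega

/-- Multiplying by a transposition of points on one cycle cuts this cycle. -/
lemma cycParts_mul_swap_pow {σ : Perm V} {a : V} {i : ℕ} (hi : 0 < i) (hin : i < cycLen σ a) :
    cycParts (σ * swap a ((σ ^ i) a))
      = (cycParts σ).erase (cycLen σ a) + {i} + {cycLen σ a - i} := by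
  set b := (σ ^ i) a with hb
  set τ := σ * swap a b with hτ
  have τb : τ b = σ a := by simp [hτ]
  have τo : ∀ x, x ≠ a → x ≠ b → τ x = σ x := fun x h1 h2 => by
    simp [hτ, swap_apply_of_ne_of_ne h1 h2]
  have hστ : τ * swap a b = σ := by rw [hτ, mul_assoc, swap_mul_self, mul_one]
  have hstep : ∀ j, 0 < j → j < i → τ ((σ ^ j) a) = (σ ^ (j + 1)) a := by
    intro j hj hji
    rw [τo, pow_succ', Perm.mul_apply]
    · intro h
      have := pow_injOn_cycLen σ a (i := j) (j := 0) (by omega) (by omega) (by simpa using h)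
      omega
    · intro h
      have := pow_injOn_cycLen σ a (i := j) (j := i) (by omega) (by omega) h
      omega
  have horb : orb τ b = (Ico 1 (i + 1)).image fun j => (σ ^ j) a := by
    ext x
    rw [mem_orb]
    constructor
    · intro h
      refine sameCycle_induction (σ := τ)
        (p := fun x => x ∈ (Ico 1 (i + 1)).image fun j => (σ ^ j) a) ?_ h ?_
      · intro y hy
        obtain ⟨j, hj, rfl⟩ := mem_image.1 hy
        rw [mem_Ico] at hj
        rcases Nat.lt_or_ge j i with hji | hji
        · rw [hstep j hj.1 hji]
          exact mem_image.2 ⟨j + 1, mem_Ico.2 ⟨by omega, by omega⟩, rfl⟩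
        · have : j = i := by omega
          subst this
          rw [← hb, τb]
          exact mem_image.2 ⟨1, mem_Ico.2 ⟨le_rfl, by omega⟩, by simp⟩
      · exact mem_image.2 ⟨i, mem_Ico.2 ⟨hi, by omega⟩, rfl⟩
    · intro h
      obtain ⟨j, hj, rfl⟩ := mem_image.1 h
      rw [mem_Ico] at hj
      obtain ⟨j, rfl⟩ : ∃ j', j = j' + 1 := ⟨j - 1, by omega⟩
      induction j with
      | zero =>
        rw [zero_add, pow_one, ← τb]
        exact sameCycle_apply_right.2 (SameCycle.refl _ _)
      | succ j ih =>
        rw [← hstep (j + 1) (by omega) (by omega)]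
        exact sameCycle_apply_right.2
          (ih ⟨by omega, by omega⟩ (mem_image.2 ⟨j + 1, mem_Ico.2 ⟨by omega, by omega⟩, rfl⟩))
  have hlb : cycLen τ b = i := by
    rw [cycLen, horb, card_image_of_injOn, Nat.card_Ico, Nat.add_sub_cancel]
    intro j hj l hl hjl
    rw [coe_Ico, Set.mem_Ico] at hj hl
    exact pow_injOn_cycLen σ a (by omega) (by omega) hjl
  have hab : ¬ SameCycle τ a b := by
    intro h
    have := mem_orb.2 h.symm
    rw [horb, mem_image] at this
    obtain ⟨j, hj, h'⟩ := this
    rw [mem_Ico] at hj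
    have := pow_injOn_cycLen σ a (i := j) (j := 0) (by omega) (by omega) (by simpa using h')
    omega
  have hla := cycLen_mul_swap_left hab (v := a) (Or.inl (SameCycle.refl _ _))
  rw [hστ, hlb] at hla
  have h := cycParts_mul_swap hab
  rw [hστ, hlb] at h
  have hla' : cycLen τ a = cycLen σ a - i := by omega
  rw [← hla, hla', ← Multiset.cons_erase (cycLen_mem_cycParts σ a), ← Multiset.singleton_add] at h
  apply add_right_cancel (b := ({cycLen σ a} : Multiset ℕ))
  rw [← h]
  abel

end CycleType

end HurwitzGenusOne

namespace HurwitzGenusOne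

open Finset Equiv Equiv.Perm

section Monomials

local notation "𝓡" => MvPolynomial ℕ ℚ

/-- The monomial `∏ x_a` over the parts `a` of a multiset. -/
noncomputable def mono (s : Multiset ℕ) : 𝓡 := (s.map pvar).prod

lemma mono_add (s t : Multiset ℕ) : mono (s + t) = mono s * mono t := by simp [mono]

@[simp] lemma mono_zero : mono 0 = 1 := by simp [mono]

@[simp] lemma mono_singleton (a : ℕ) : mono {a} = pvar a := by simp [mono]

lemma mono_cons (a : ℕ) (s : Multiset ℕ) : mono (a ::ₘ s) = pvar a * mono s := by simp [mono]

lemma wd_pvar (n m : ℕ) : wd n (pvar m) = if m = n then (n : 𝓡) else 0 := by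
  rcases eq_or_ne n 0 with rfl | hn
  · simp
  · rw [wd_apply, pderiv_pvar _ _ hn]
    split_ifs <;> simp

lemma wd_mono (n : ℕ) (s : Multiset ℕ) :
    wd n (mono s) = ((n * s.count n : ℕ) : 𝓡) * mono (s.erase n) := by
  induction s using Multiset.induction_on with
  | empty => simp
  | cons m s ih =>
    rw [mono_cons, Derivation.leibniz, ih, wd_pvar, smul_eq_mul, smul_eq_mul]
    rcases eq_or_ne m n with rfl | hmn
    · rw [if_pos rfl, Multiset.count_cons_self, Multiset.erase_cons_head]
      by_cases hm : m ∈ s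
      · have : mono s = pvar m * mono (s.erase m) := by
          rw [← mono_cons, Multiset.cons_erase hm]
        rw [this]
        push_cast
        ring
      · rw [Multiset.count_eq_zero_of_notMem hm]
        push_cast
        ring
    · rw [if_neg hmn, Multiset.count_cons_of_ne hmn.symm, Multiset.erase_cons_tail _ hmn,
        mono_cons]
      ring

lemma sum_square_eq_sum_antidiagonal {M : Type*} [AddCommMonoid M] (N : ℕ) (f : ℕ → ℕ → M)
    (hf : ∀ i j, N < i + j → f i j = 0) :
    ∑ i ∈ range (N + 1), ∑ j ∈ range (N + 1), f i j
      = ∑ n ∈ range (N + 1), ∑ p ∈ antidiagonal n, f p.1 p.2 := by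
  rw [← sum_product', sum_sigma']
  refine sum_bij_ne_zero (fun p _ _ => ⟨p.1 + p.2, p⟩) ?_ ?_ ?_ ?_
  · intro p _ h
    rw [mem_sigma, mem_range, HasAntidiagonal.mem_antidiagonal]
    have : ¬ N < p.1 + p.2 := fun h' => h (hf _ _ h')
    exact ⟨by simpa using this, rfl⟩
  · intro p _ _ q _ _ h
    simpa using (Sigma.mk.inj_iff.1 h).2
  · rintro ⟨n, p⟩ h h'
    rw [mem_sigma, mem_range, HasAntidiagonal.mem_antidiagonal] at h
    obtain ⟨h1, h2⟩ := h
    simp only at h1 h2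
    subst h2
    exact ⟨p, by simp only [mem_product, mem_range]; omega, h', rfl⟩
  · intro p _ _
    rfl

variable {V : Type*} [Fintype V] [DecidableEq V]

lemma sum_cycLen {M : Type*} [Semiring M] (σ : Perm V) {N : ℕ} (hN : Fintype.card V ≤ N)
    (F : ℕ → M) :
    ∑ a, F (cycLen σ a)
      = ∑ n ∈ range (N + 1), ((n * (cycParts σ).count n : ℕ) : M) * F n := by
  rw [← sum_fiberwise_of_maps_to (s := univ) (t := range (N + 1)) (g := cycLen σ)
    (fun a _ => mem_range.2 (by have := cycLen_le σ a; omega))]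
  refine sum_congr rfl fun n _ => ?_
  rw [mul_count_cycParts, sum_congr rfl (g := fun _ => F n)
    (fun a ha => by rw [(mem_filter.1 ha).2]), sum_const, nsmul_eq_mul]

lemma sum_cycParts (σ : Perm V) : (cycParts σ).sum = Fintype.card V := by
  rw [cycParts, Multiset.sum_add, sum_cycleType, Multiset.sum_replicate, smul_eq_mul, mul_one]
  have := card_le_univ σ.support
  omega

lemma sum_not_sameCycle {M : Type*} [Semiring M] (σ : Perm V) {N : ℕ}
    (hN : Fintype.card V ≤ N) (a : V) (F : ℕ → M) :
    ∑ b ∈ univ.filter (fun b => ¬ SameCycle σ a b), F (cycLen σ b)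
      = ∑ n ∈ range (N + 1),
          ((n * ((cycParts σ).erase (cycLen σ a)).count n : ℕ) : M) * F n := by
  rw [← sum_fiberwise_of_maps_to (t := range (N + 1)) (g := cycLen σ)
    (fun a _ => mem_range.2 (by have := cycLen_le σ a; omega))]
  refine sum_congr rfl fun n _ => ?_
  rw [sum_congr rfl (g := fun _ => F n)
    (fun a ha => by rw [(mem_filter.1 ha).2]), sum_const, nsmul_eq_mul]
  congr 2
  have h := mul_count_cycParts σ n
  have hs := card_filter_add_card_filter_not (s := univ.filter fun v => cycLen σ v = n)
    (fun b => SameCycle σ a b)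
  rw [filter_filter, filter_filter] at hs
  have e : (univ.filter fun b => cycLen σ b = n ∧ ¬ SameCycle σ a b)
      = (univ.filter fun b => ¬ SameCycle σ a b).filter (fun b => cycLen σ b = n) := by
    ext b; simp [and_comm]
  rw [e] at hs
  rcases eq_or_ne n (cycLen σ a) with rfl | hn
  · rw [Multiset.count_erase_self, Nat.mul_sub, h, mul_one]
    have e2 : (univ.filter fun b => cycLen σ b = cycLen σ a ∧ SameCycle σ a b) = orb σ a := by
      ext b
      rw [mem_filter, mem_orb]
      exact ⟨fun h => h.2.2, fun h => ⟨mem_univ _, (cycLen_eq_of_sameCycle h).symm, h⟩⟩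
    rw [e2] at hs
    have : cycLen σ a = (orb σ a).card := rfl
    omega
  · rw [Multiset.count_erase_of_ne hn, h]
    have e2 : (univ.filter fun b => cycLen σ b = n ∧ SameCycle σ a b) = ∅ := by
      refine filter_eq_empty_iff.2 fun b _ h => hn ?_
      rw [cycLen_eq_of_sameCycle h.2, h.1]
    rw [e2, card_empty] at hs
    omega

lemma sum_sameCycle_mono (σ : Perm V) :
    ∑ a, ∑ b ∈ univ.filter (fun b => SameCycle σ a b ∧ a ≠ b), mono (cycParts (σ * swap a b))
      = cutOp (Fintype.card V) (mono (cycParts σ)) := by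
  obtain ⟨F, hF⟩ : ∃ F : ℕ → 𝓡, F = fun n =>
      (∑ p ∈ antidiagonal n, pvar p.1 * pvar p.2) * mono ((cycParts σ).erase n) := ⟨_, rfl⟩
  have h : ∀ a, ∑ b ∈ univ.filter (fun b => SameCycle σ a b ∧ a ≠ b),
      mono (cycParts (σ * swap a b)) = F (cycLen σ a) := by
    intro a
    rw [hF]
    have e : (univ.filter fun b => SameCycle σ a b ∧ a ≠ b)
        = (Ioo 0 (cycLen σ a)).image fun i => (σ ^ i) a := by
      ext b
      rw [mem_filter, mem_image]
      constructor
      · rintro ⟨-, h, hne⟩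
        obtain ⟨i, hi, rfl⟩ := exists_pow_of_sameCycle h
        refine ⟨i, mem_Ioo.2 ⟨Nat.pos_of_ne_zero ?_, hi⟩, rfl⟩
        rintro rfl
        simp at hne
      · rintro ⟨i, hi, rfl⟩
        rw [mem_Ioo] at hi
        refine ⟨mem_univ _, ⟨i, by simp⟩, fun h => hi.1.ne ?_⟩
        exact pow_injOn_cycLen σ a (cycLen_pos σ a) hi.2 (by simpa using h)
    rw [e, sum_image (fun i hi j hj hij => pow_injOn_cycLen σ a
      (mem_Ioo.1 hi).2 (mem_Ioo.1 hj).2 hij)]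
    simp only
    rw [Nat.sum_antidiagonal_eq_sum_range_succ (fun i j => pvar i * pvar j), sum_mul]
    refine Eq.trans ?_ (sum_subset (s₁ := Ioo 0 (cycLen σ a)) (fun i hi => ?_)
      fun i hi hi' => ?_)
    rotate_left
    · exact mem_range.2 (by rw [mem_Ioo] at hi; omega)
    · rw [mem_range] at hi
      rw [mem_Ioo] at hi'
      have : i = 0 ∨ cycLen σ a - i = 0 := by omega
      rcases this with h | h <;> simp [h]
    · refine sum_congr rfl fun i hi => ?_
      rw [mem_Ioo] at hi
      rw [cycParts_mul_swap_pow hi.1 hi.2, mono_add, mono_add, mono_singleton, mono_singleton]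
      ring
  rw [sum_congr rfl fun a _ => h a, sum_cycLen σ le_rfl, cutOp]
  refine sum_congr rfl fun n _ => ?_
  rw [wd_mono, hF]
  ring

lemma sum_not_sameCycle_mono (σ : Perm V) :
    ∑ a, ∑ b ∈ univ.filter (fun b => ¬ SameCycle σ a b), mono (cycParts (σ * swap a b))
      = joinOp (Fintype.card V) (mono (cycParts σ)) := by
  obtain ⟨F, hF⟩ : ∃ F : ℕ → 𝓡, F = fun i => ∑ j ∈ range (Fintype.card V + 1),
      ((j * ((cycParts σ).erase i).count j : ℕ) : 𝓡)
        * (mono (((cycParts σ).erase i).erase j) * pvar (j + i)) := ⟨_, rfl⟩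
  have h : ∀ a, ∑ b ∈ univ.filter (fun b => ¬ SameCycle σ a b), mono (cycParts (σ * swap a b))
      = F (cycLen σ a) := by
    intro a
    rw [hF]
    refine Eq.trans ?_ (sum_not_sameCycle σ le_rfl a fun j =>
      mono (((cycParts σ).erase (cycLen σ a)).erase j) * pvar (j + cycLen σ a))
    refine sum_congr rfl fun b hb => ?_
    rw [cycParts_mul_swap_eq (mem_filter.1 hb).2, mono_add, mono_singleton,
      Multiset.erase_comm, add_comm (cycLen σ b)]
  rw [sum_congr rfl fun a _ => h a, sum_cycLen σ le_rfl, joinOp, hF]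
  simp_rw [mul_sum]
  rw [sum_comm, sum_square_eq_sum_antidiagonal]
  · refine sum_congr rfl fun n _ => sum_congr rfl fun p hp => ?_
    rw [HasAntidiagonal.mem_antidiagonal] at hp
    rw [wd_mono, hp, ← nsmul_eq_mul (p.2 * _) (mono _), map_nsmul, wd_mono, nsmul_eq_mul]
    ring
  · intro i j hij
    by_cases h1 : j ∈ cycParts σ
    · by_cases h2 : i ∈ (cycParts σ).erase j
      · exfalso
        have hs := sum_cycParts σ
        rw [← Multiset.cons_erase h1, ← Multiset.cons_erase h2, Multiset.sum_cons,
          Multiset.sum_cons] at hs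
        omega
      · rw [Multiset.count_eq_zero_of_notMem h2]
        simp
    · rw [Multiset.count_eq_zero_of_notMem h1]
      simp

/-- Multiplication by all transpositions acts by the cut and join operators. -/
lemma sum_offDiag_mono (σ : Perm V) :
    ∑ e ∈ univ.offDiag, mono (cycParts (σ * swap e.1 e.2))
      = cutOp (Fintype.card V) (mono (cycParts σ))
        + joinOp (Fintype.card V) (mono (cycParts σ)) := by
  rw [← sum_sameCycle_mono, ← sum_not_sameCycle_mono, ← sum_add_distrib]
  have h : (univ : Finset V).offDiag = (univ ×ˢ univ).filter fun e : V × V => e.1 ≠ e.2 := by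
    ext e; simp
  rw [h, sum_filter, sum_product]
  refine sum_congr rfl fun a _ => ?_
  rw [sum_filter, sum_filter, ← sum_add_distrib]
  refine sum_congr rfl fun b _ => ?_
  by_cases hab : SameCycle σ a b
  · by_cases hne : a = b
    · subst hne; simp [hab]
    · simp [hab, hne]
  · have : a ≠ b := fun h => hab (h ▸ SameCycle.refl _ _)
    simp [hab, this]

variable {W : Type*} [Fintype W] [DecidableEq W]

lemma sumCongr_zpow {V W : Type*} (σ : Perm V) (τ : Perm W) (n : ℤ) :
    (Perm.sumCongr σ τ) ^ n = Perm.sumCongr (σ ^ n) (τ ^ n) := by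
  have := map_zpow (sumCongrHom V W) (σ, τ) n
  simpa using this.symm

lemma orb_sumCongr (σ : Perm V) (τ : Perm W) :
    (∀ a, orb (Perm.sumCongr σ τ) (Sum.inl a) = (orb σ a).map Function.Embedding.inl) ∧
      ∀ b, orb (Perm.sumCongr σ τ) (Sum.inr b) = (orb τ b).map Function.Embedding.inr := by
  constructor <;> intro a <;> ext x <;> rw [mem_orb, mem_map] <;> simp only [mem_orb] <;>
    constructor
  · rintro ⟨n, rfl⟩
    exact ⟨(σ ^ n) a, ⟨n, rfl⟩, by simp [sumCongr_zpow]⟩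
  · rintro ⟨_, ⟨n, rfl⟩, rfl⟩
    exact ⟨n, by simp [sumCongr_zpow]⟩
  · rintro ⟨n, rfl⟩
    exact ⟨(τ ^ n) a, ⟨n, rfl⟩, by simp [sumCongr_zpow]⟩
  · rintro ⟨_, ⟨n, rfl⟩, rfl⟩
    exact ⟨n, by simp [sumCongr_zpow]⟩

lemma cycLen_sumCongr_inl (σ : Perm V) (τ : Perm W) (a : V) :
    cycLen (Perm.sumCongr σ τ) (Sum.inl a) = cycLen σ a := by
  rw [cycLen, (orb_sumCongr σ τ).1, card_map]; rfl

lemma cycLen_sumCongr_inr (σ : Perm V) (τ : Perm W) (b : W) :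
    cycLen (Perm.sumCongr σ τ) (Sum.inr b) = cycLen τ b := by
  rw [cycLen, (orb_sumCongr σ τ).2, card_map]; rfl

lemma cycParts_sumCongr (σ : Perm V) (τ : Perm W) :
    cycParts (Perm.sumCongr σ τ) = cycParts σ + cycParts τ := by
  apply eq_of_mul_count_eq (zero_notMem_cycParts _)
  · rw [Multiset.mem_add]
    rintro (h | h)
    exacts [zero_notMem_cycParts _ h, zero_notMem_cycParts _ h]
  intro i
  rw [Multiset.count_add, mul_add, mul_count_cycParts, mul_count_cycParts, mul_count_cycParts,
    card_filter, card_filter, card_filter, Fintype.sum_sum_type]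
  simp only [cycLen_sumCongr_inl, cycLen_sumCongr_inr]

/-- Multiplication by the transpositions joining two blocks acts by the bilinear operator. -/
lemma sum_swap_sumCongr_mono (σ : Perm V) (τ : Perm W) :
    ∑ a, ∑ b, mono (cycParts (Perm.sumCongr σ τ * swap (Sum.inl a) (Sum.inr b)))
      = bilOp (Fintype.card V + Fintype.card W) (mono (cycParts σ)) (mono (cycParts τ)) := by
  have h : ∀ a b, mono (cycParts (Perm.sumCongr σ τ * swap (Sum.inl a) (Sum.inr b)))
      = mono ((cycParts σ).erase (cycLen σ a)) * mono ((cycParts τ).erase (cycLen τ b))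
        * pvar (cycLen σ a + cycLen τ b) := by
    intro a b
    have hab : ¬ SameCycle (Perm.sumCongr σ τ) (Sum.inl a) (Sum.inr b) := by
      rw [← mem_orb, (orb_sumCongr σ τ).1]
      simp
    rw [cycParts_mul_swap_eq hab, cycLen_sumCongr_inl, cycLen_sumCongr_inr, mono_add,
      mono_singleton, cycParts_sumCongr, Multiset.erase_add_right_pos _ (cycLen_mem_cycParts τ b),
      Multiset.erase_add_left_pos _ (cycLen_mem_cycParts σ a), mono_add]
  simp_rw [h]
  simp_rw [fun a => sum_cycLen τ (Nat.le_add_left _ (Fintype.card V)) fun j =>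
    mono ((cycParts σ).erase (cycLen σ a)) * mono ((cycParts τ).erase j)
        * pvar (cycLen σ a + j)]
  rw [sum_cycLen σ (Nat.le_add_right _ (Fintype.card W)) fun i =>
    ∑ j ∈ range (Fintype.card V + Fintype.card W + 1), ((j * (cycParts τ).count j : ℕ) : 𝓡) *
      (mono ((cycParts σ).erase i) * mono ((cycParts τ).erase j) * pvar (i + j)), bilOp]
  simp_rw [mul_sum]
  rw [sum_square_eq_sum_antidiagonal]
  · refine sum_congr rfl fun n _ => sum_congr rfl fun p hp => ?_
    rw [HasAntidiagonal.mem_antidiagonal] at hp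
    rw [wd_mono, wd_mono, hp]
    ring
  · intro i j hij
    by_cases h1 : i ∈ cycParts σ
    · by_cases h2 : j ∈ cycParts τ
      · exfalso
        have hs := Multiset.le_sum_of_mem h1
        have ht := Multiset.le_sum_of_mem h2
        rw [sum_cycParts] at hs ht
        omega
      · rw [Multiset.count_eq_zero_of_notMem h2]
        simp
    · rw [Multiset.count_eq_zero_of_notMem h1]
      simp

lemma permCongr_zpow_apply {V W : Type*} (e : V ≃ W) (σ : Perm V) (n : ℤ) (x : V) :
    (e.permCongr σ ^ n) (e x) = e ((σ ^ n) x) := by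
  have h := map_zpow e.permCongrHom σ n
  have h2 : e.permCongr σ ^ n = e.permCongr (σ ^ n) := h.symm
  rw [h2]
  simp

lemma cycLen_permCongr (e : V ≃ W) (σ : Perm V) (x : V) :
    cycLen (e.permCongr σ) (e x) = cycLen σ x := by
  have : orb (e.permCongr σ) (e x) = (orb σ x).map e.toEmbedding := by
    ext y
    rw [mem_orb, mem_map]
    simp only [mem_orb]
    constructor
    · rintro ⟨n, rfl⟩
      exact ⟨(σ ^ n) x, ⟨n, rfl⟩, by rw [permCongr_zpow_apply]; rfl⟩
    · rintro ⟨_, ⟨n, rfl⟩, rfl⟩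
      exact ⟨n, by rw [permCongr_zpow_apply]; rfl⟩
  rw [cycLen, this, card_map]
  rfl

lemma cycParts_permCongr (e : V ≃ W) (σ : Perm V) : cycParts (e.permCongr σ) = cycParts σ := by
  apply eq_of_mul_count_eq (zero_notMem_cycParts _) (zero_notMem_cycParts _)
  intro i
  rw [mul_count_cycParts, mul_count_cycParts, card_filter, card_filter,
    ← Equiv.sum_comp e]
  simp only [cycLen_permCongr]

end Monomials

end HurwitzGenusOne

namespace HurwitzGenusOne

open Finset Equiv Equiv.Perm

section Indicator

variable {M N : Type*} [AddCommMonoid M] [AddCommMonoid N]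

open Classical in
/-- The value `x` if `p` holds and `0` otherwise. -/
noncomputable def ind (p : Prop) (x : M) : M := if p then x else 0

lemma ind_pos {p : Prop} (h : p) (x : M) : ind p x = x := by rw [ind, if_pos h]

lemma ind_neg {p : Prop} (h : ¬ p) (x : M) : ind p x = 0 := by rw [ind, if_neg h]

lemma ind_and (p q : Prop) (x : M) : ind (p ∧ q) x = ind p (ind q x) := by
  by_cases hp : p <;> by_cases hq : q <;> simp [ind, hp, hq]

lemma ind_congr {p q : Prop} (h : p ↔ q) (x : M) : ind p x = ind q x := by
  rw [propext h]

lemma map_ind (g : M →+ N) (p : Prop) (x : M) : g (ind p x) = ind p (g x) := by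
  by_cases hp : p <;> simp [ind, hp]

lemma ind_sum {ι : Type*} (p : Prop) (s : Finset ι) (f : ι → M) :
    ind p (∑ i ∈ s, f i) = ∑ i ∈ s, ind p (f i) := by
  by_cases hp : p <;> simp [ind, hp]

end Indicator

section Connected

variable {V : Type*}

/-- A set is stable if no pair in the list leaves it. -/
def Stable (A : Set V) (L : List (V × V)) : Prop := ∀ e ∈ L, e.1 ∈ A ↔ e.2 ∈ A

/-- The graph with the given edges is connected. -/
def Conn (L : List (V × V)) : Prop := ∀ A : Set V, Stable A L → A = ∅ ∨ A = Set.univ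

/-- The graph with the given edges is the disjoint union of connected graphs on `A` and `Aᶜ`. -/
def SplitConn (A : Set V) (L : List (V × V)) : Prop :=
  Stable A L ∧ (∀ B ⊆ A, Stable B L → B = ∅ ∨ B = A) ∧
    ∀ B ⊆ Aᶜ, Stable B L → B = ∅ ∨ B = Aᶜ

lemma stable_cons {A : Set V} {e : V × V} {L : List (V × V)} :
    Stable A (e :: L) ↔ (e.1 ∈ A ↔ e.2 ∈ A) ∧ Stable A L := by
  simp [Stable]

lemma Stable.compl {A : Set V} {L : List (V × V)} (h : Stable A L) : Stable Aᶜ L :=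
  fun e he => not_congr (h e he)

lemma Stable.inter {A B : Set V} {L : List (V × V)} (h : Stable A L) (h' : Stable B L) :
    Stable (A ∩ B) L := fun e he => and_congr (h e he) (h' e he)

lemma splitConn_of_conn_cons {a b : V} {L : List (V × V)} (h : Conn ((a, b) :: L)) {T : Set V}
    (hT : Stable T L) (ha : a ∈ T) (hb : b ∉ T) : SplitConn T L := by
  refine ⟨hT, fun B hB hs => ?_, fun B hB hs => ?_⟩
  · by_cases haB : a ∈ B
    · right
      rcases h (T ∩ Bᶜ) (stable_cons.2 ⟨by simp [haB, hb], hT.inter hs.compl⟩) with h | h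
      · refine hB.antisymm fun x hx => ?_
        by_contra hxB
        exact (Set.eq_empty_iff_forall_notMem.1 h x) ⟨hx, hxB⟩
      · exact absurd haB (h ▸ Set.mem_univ a : a ∈ T ∩ Bᶜ).2
    · left
      have hbB : b ∉ B := fun h => hb (hB h)
      rcases h B (stable_cons.2 ⟨by simp [haB, hbB], hs⟩) with h | h
      · exact h
      · exact absurd (h ▸ Set.mem_univ a) haB
  · have haB : a ∉ B := fun h => hB h ha
    by_cases hbB : b ∈ B
    · right
      rcases h (Tᶜ ∩ Bᶜ) (stable_cons.2 ⟨by simp [ha, hbB], hT.compl.inter hs.compl⟩)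
        with h | h
      · refine hB.antisymm fun x hx => ?_
        by_contra hxB
        exact (Set.eq_empty_iff_forall_notMem.1 h x) ⟨hx, hxB⟩
      · exact absurd hbB (h ▸ Set.mem_univ b : b ∈ Tᶜ ∩ Bᶜ).2
    · left
      rcases h B (stable_cons.2 ⟨by simp [haB, hbB], hs⟩) with h | h
      · exact h
      · exact absurd (h ▸ Set.mem_univ a) haB

lemma conn_cons_iff {a b : V} {L : List (V × V)} :
    Conn ((a, b) :: L) ↔ Conn L ∨ ∃ A : Set V, (a ∈ A ∧ b ∉ A) ∧ SplitConn A L := by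
  constructor
  · intro h
    by_cases hL : Conn L
    · exact Or.inl hL
    right
    rw [Conn] at hL
    push Not at hL
    obtain ⟨T, hT, hne, hnu⟩ := hL
    have hab : ¬ (a ∈ T ↔ b ∈ T) := fun hab => by
      rcases h T (stable_cons.2 ⟨hab, hT⟩) with h | h
      exacts [hne.ne_empty h, hnu h]
    by_cases ha : a ∈ T
    · have hb : b ∉ T := fun hb => hab ⟨fun _ => hb, fun _ => ha⟩
      exact ⟨T, ⟨ha, hb⟩, splitConn_of_conn_cons h hT ha hb⟩
    · have hb : b ∈ T := by
        by_contra hb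
        exact hab ⟨fun h => absurd h ha, fun h => absurd h hb⟩
      exact ⟨Tᶜ, ⟨ha, fun h => h hb⟩, splitConn_of_conn_cons h hT.compl ha fun h => h hb⟩
  · rintro (h | ⟨A, ⟨ha, hb⟩, hA, hA1, hA2⟩) B hB
    · exact h B (stable_cons.1 hB).2
    · obtain ⟨hab, hB⟩ := stable_cons.1 hB
      have h1 := hA1 (A ∩ B) Set.inter_subset_left (hA.inter hB)
      have h2 := hA2 (Aᶜ ∩ B) Set.inter_subset_left (hA.compl.inter hB)
      simp only at hab
      by_cases haB : a ∈ B
      · right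
        have h1 := h1.resolve_left fun h => Set.eq_empty_iff_forall_notMem.1 h a ⟨ha, haB⟩
        have h2 := h2.resolve_left fun h =>
          Set.eq_empty_iff_forall_notMem.1 h b ⟨hb, hab.1 haB⟩
        refine Set.eq_univ_of_forall fun x => ?_
        by_cases hx : x ∈ A
        · exact (Set.inter_eq_left.1 h1) hx
        · exact (Set.inter_eq_left.1 h2) hx
      · left
        have hbB : b ∉ B := fun h => haB (hab.2 h)
        have h1 := h1.resolve_right fun h => haB (Set.inter_eq_left.1 h ha)
        have h2 := h2.resolve_right fun h => hbB (Set.inter_eq_left.1 h hb)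
        refine Set.eq_empty_of_forall_notMem fun x hxB => ?_
        by_cases hx : x ∈ A
        · exact Set.eq_empty_iff_forall_notMem.1 h1 x ⟨hx, hxB⟩
        · exact Set.eq_empty_iff_forall_notMem.1 h2 x ⟨hx, hxB⟩

lemma not_conn_of_splitConn {a b : V} {L : List (V × V)} {A : Set V} (hab : a ∈ A ∧ b ∉ A)
    (h : SplitConn A L) : ¬ Conn L := by
  intro hL
  rcases hL A h.1 with h | h
  · exact Set.eq_empty_iff_forall_notMem.1 h a hab.1
  · exact hab.2 (h ▸ Set.mem_univ b)

lemma splitConn_unique {a b : V} {L : List (V × V)} {A B : Set V} (hA : a ∈ A ∧ b ∉ A)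
    (hB : a ∈ B ∧ b ∉ B) (h : SplitConn A L) (h' : SplitConn B L) : A = B := by
  have hne : A ∩ B ≠ ∅ := fun h => Set.eq_empty_iff_forall_notMem.1 h a ⟨hA.1, hB.1⟩
  have h1 := (h.2.1 _ Set.inter_subset_left (h.1.inter h'.1)).resolve_left hne
  have h2 := (h'.2.1 _ Set.inter_subset_right (h.1.inter h'.1)).resolve_left hne
  exact h1.symm.trans h2

variable [Fintype V] {M : Type*} [AddCommMonoid M]

lemma ind_conn_cons (a b : V) (L : List (V × V)) (x : M) :
    ind (Conn ((a, b) :: L)) x = ind (Conn L) x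
      + ∑ A : Finset V, ind (SplitConn (A : Set V) L) (ind (a ∈ A ∧ b ∉ A) x) := by
  by_cases hL : Conn L
  · rw [ind_pos (conn_cons_iff.2 (Or.inl hL)), ind_pos hL, sum_eq_zero, add_zero]
    intro A _
    rw [← ind_and]
    exact ind_neg (fun h => not_conn_of_splitConn h.2 h.1 hL) x
  rw [ind_neg hL, zero_add]
  by_cases h : ∃ A : Set V, (a ∈ A ∧ b ∉ A) ∧ SplitConn A L
  · rw [ind_pos (conn_cons_iff.2 (Or.inr h))]
    obtain ⟨A, hab, hA⟩ := h
    have hc : ((Set.toFinite A).toFinset : Set V) = A := (Set.toFinite A).coe_toFinset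
    rw [sum_eq_single (Set.toFinite A).toFinset]
    · rw [hc, ind_pos hA, ind_pos]
      simpa using hab
    · intro B _ hB
      rw [← ind_and]
      refine ind_neg (fun h => hB ?_) x
      rw [← coe_inj, hc]
      exact splitConn_unique h.2 hab h.1 hA
    · simp
  · rw [ind_neg fun h' => (conn_cons_iff.1 h').elim hL h, sum_eq_zero]
    intro A _
    rw [← ind_and]
    exact ind_neg (fun h' => h ⟨A, h'.2, h'.1⟩) x

lemma sum_offDiag_eq [DecidableEq V] (G : V × V → M) :
    ∑ e ∈ univ.offDiag, G e = ∑ a, ∑ b, if a ≠ b then G (a, b) else 0 := by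
  have h : (univ : Finset V).offDiag = (univ ×ˢ univ).filter fun e : V × V => e.1 ≠ e.2 := by
    ext e; simp
  rw [h, sum_filter, sum_product]

lemma sum_offDiag_ind_conn_cons [DecidableEq V] (L : List (V × V)) (g : V × V → M) :
    ∑ e ∈ univ.offDiag, ind (Conn (e :: L)) (g e)
      = ind (Conn L) (∑ e ∈ univ.offDiag, g e)
        + ∑ A : Finset V, ind (SplitConn (A : Set V) L)
            (∑ a : {x // x ∈ A}, ∑ b : {x // x ∉ A}, g (a, b)) := by
  simp_rw [fun e : V × V => ind_conn_cons e.1 e.2 L (g e)]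
  rw [sum_add_distrib, ← ind_sum, sum_comm]
  congr 1
  refine sum_congr rfl fun A _ => ?_
  rw [← ind_sum]
  congr 1
  have h : ∀ e : V × V, ind (e.1 ∈ A ∧ e.2 ∉ A) (g e)
      = if e.1 ∈ A ∧ e.2 ∉ A then g e else 0 := fun e => by
        by_cases he : e.1 ∈ A ∧ e.2 ∉ A
        · rw [ind_pos he, if_pos he]
        · rw [ind_neg he, if_neg he]
  simp_rw [h]
  rw [← sum_filter]
  have h2 : (univ : Finset V).offDiag.filter (fun e => e.1 ∈ A ∧ e.2 ∉ A) = A ×ˢ Aᶜ := by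
    ext e
    simp only [mem_filter, mem_offDiag, mem_univ, true_and, mem_product, mem_compl,
      and_iff_right_iff_imp]
    rintro ⟨h1, h2⟩ h
    exact h2 (h ▸ h1)
  rw [h2, sum_product, sum_subtype A (fun _ => Iff.rfl)]
  refine sum_congr rfl fun a _ => ?_
  rw [sum_subtype Aᶜ (fun _ => mem_compl)]

end Connected

section SwapProd

variable {V W : Type*} [DecidableEq V] [DecidableEq W]

/-- The product of the transpositions in a list, in reverse order. -/
def swapProd : List (V × V) → Perm V
  | [] => 1
  | e :: L => swapProd L * swap e.1 e.2

lemma swapProd_map (e : V ≃ W) (L : List (V × V)) :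
    swapProd (L.map (Prod.map e e)) = e.permCongr (swapProd L) := by
  induction L with
  | nil => exact (map_one e.permCongrHom).symm
  | cons p L ih =>
    rw [List.map_cons, swapProd, swapProd, ih]
    have h := map_mul e.permCongrHom (swapProd L) (swap p.1 p.2)
    refine Eq.trans ?_ h.symm
    congr 1
    ext x
    simp [swap_apply_def, apply_ite e, Equiv.symm_apply_eq]

end SwapProd

section Sequences

variable {V W : Type*} [Fintype V] [Fintype W]
  {M N : Type*} [AddCommMonoid M] [AddCommMonoid N]

/-- The sum of a function over all sequences of `r` ordered pairs of distinct points. -/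
def seqSum : ℕ → (List (V × V) → M) → M
  | 0, Φ => Φ []
  | r + 1, Φ => ∑ e ∈ univ.offDiag, seqSum r fun L => Φ (e :: L)

lemma seqSum_zero (Φ : List (V × V) → M) : seqSum 0 Φ = Φ [] := rfl

lemma seqSum_succ (r : ℕ) (Φ : List (V × V) → M) :
    seqSum (r + 1) Φ = ∑ e ∈ univ.offDiag, seqSum r fun L => Φ (e :: L) := rfl

lemma seqSum_sum {ι : Type*} (s : Finset ι) (r : ℕ) (Φ : ι → List (V × V) → M) :
    seqSum r (fun L => ∑ i ∈ s, Φ i L) = ∑ i ∈ s, seqSum r (Φ i) := by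
  induction r generalizing Φ with
  | zero => rfl
  | succ r ih =>
    simp only [seqSum_succ]
    rw [sum_comm]
    exact sum_congr rfl fun e _ => ih _

lemma seqSum_add (r : ℕ) (Φ Ψ : List (V × V) → M) :
    seqSum r (fun L => Φ L + Ψ L) = seqSum r Φ + seqSum r Ψ := by
  have := seqSum_sum (univ : Finset Bool) r fun b => if b then Φ else Ψ
  simpa using this

@[simp] lemma seqSum_const_zero (r : ℕ) : seqSum r (fun _ : List (V × V) => (0 : M)) = 0 := by
  simpa using seqSum_sum (∅ : Finset Unit) r fun _ (_ : List (V × V)) => (0 : M)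

lemma map_seqSum (g : M →+ N) (r : ℕ) (Φ : List (V × V) → M) :
    g (seqSum r Φ) = seqSum r fun L => g (Φ L) := by
  induction r generalizing Φ with
  | zero => rfl
  | succ r ih =>
    simp only [seqSum_succ]
    rw [map_sum]
    exact sum_congr rfl fun e _ => ih _

lemma seqSum_equiv (e : V ≃ W) (r : ℕ) (Φ : List (W × W) → M) :
    seqSum r Φ = seqSum r fun L : List (V × V) => Φ (L.map (Prod.map e e)) := by
  induction r generalizing Φ with
  | zero => rfl
  | succ r ih =>
    simp only [seqSum_succ]
    refine (sum_equiv (e.prodCongr e) (fun p => by simp) fun p _ => ?_).symm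
    rw [ih]
    rfl

/-- The pairs of points of the left summand. -/
def leftPairs (L : List ((V ⊕ W) × (V ⊕ W))) : List (V × V) :=
  L.filterMap fun e => match e with
    | (Sum.inl a, Sum.inl b) => some (a, b)
    | _ => none

/-- The pairs of points of the right summand. -/
def rightPairs (L : List ((V ⊕ W) × (V ⊕ W))) : List (W × W) :=
  L.filterMap fun e => match e with
    | (Sum.inr a, Sum.inr b) => some (a, b)
    | _ => none

/-- Splitting a sequence of pairs in a disjoint union. -/
lemma seqSum_split [DecidableEq V] [DecidableEq W] (r : ℕ) (Φ : List (V × V) → List (W × W) → M) :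
    seqSum r (fun L : List ((V ⊕ W) × (V ⊕ W)) =>
        ind (Stable (Set.range Sum.inl) L) (Φ (leftPairs L) (rightPairs L)))
      = ∑ p ∈ antidiagonal r, r.choose p.1 •
          seqSum p.1 fun L => seqSum p.2 fun L' => Φ L L' := by
  induction r generalizing Φ with
  | zero =>
    simp only [Finset.Nat.antidiagonal_zero, sum_singleton, Nat.choose_self, one_smul, seqSum_zero]
    exact ind_pos (fun e he => by simp at he) _
  | succ r ih =>
    rw [sum_antidiagonal_choose_succ_nsmul (fun i j => seqSum i fun L => seqSum j fun L' => Φ L L'),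
      seqSum_succ, add_comm]
    have hll : ∀ a b L, ind (Stable (Set.range Sum.inl) ((Sum.inl a, Sum.inl b) :: L))
        (Φ (leftPairs ((Sum.inl a, Sum.inl b) :: L)) (rightPairs ((Sum.inl a, Sum.inl b) :: L)))
        = ind (Stable (Set.range Sum.inl) L) (Φ ((a, b) :: leftPairs L) (rightPairs L)) :=
      fun a b L => ind_congr (by rw [stable_cons]; simp) _
    have hrr : ∀ a b L, ind (Stable (Set.range Sum.inl) ((Sum.inr a, Sum.inr b) :: L))
        (Φ (leftPairs ((Sum.inr a, Sum.inr b) :: L)) (rightPairs ((Sum.inr a, Sum.inr b) :: L)))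
        = ind (Stable (Set.range Sum.inl) L) (Φ (leftPairs L) ((a, b) :: rightPairs L)) :=
      fun a b L => ind_congr (by rw [stable_cons]; simp) _
    have hlr : ∀ a b L (x : M), ind (Stable (Set.range (Sum.inl : V → V ⊕ W))
        ((Sum.inl a, Sum.inr b) :: L)) x = 0 :=
      fun a b L x => ind_neg (by rw [stable_cons]; simp) _
    have hrl : ∀ a b L (x : M), ind (Stable (Set.range (Sum.inl : V → V ⊕ W))
        ((Sum.inr a, Sum.inl b) :: L)) x = 0 :=
      fun a b L x => ind_neg (by rw [stable_cons]; simp) _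
    have hoff : ∀ F : (V ⊕ W) × (V ⊕ W) → M, (∀ a b, F (Sum.inl a, Sum.inr b) = 0) →
        (∀ a b, F (Sum.inr a, Sum.inl b) = 0) →
        ∑ e ∈ univ.offDiag, F e = (∑ e ∈ univ.offDiag, F (Sum.inl e.1, Sum.inl e.2))
          + ∑ e ∈ univ.offDiag, F (Sum.inr e.1, Sum.inr e.2) := by
      intro F h1 h2
      rw [sum_offDiag_eq, sum_offDiag_eq, sum_offDiag_eq, Fintype.sum_sum_type]
      simp [Fintype.sum_sum_type, h1, h2]
    rw [hoff]
    · simp only [hll, hrr]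
      congr 1
      · simp_rw [fun e : V × V => ih fun L L' => Φ (e :: L) L']
        rw [sum_comm]
        refine sum_congr rfl fun p hp => ?_
        rw [← smul_sum, seqSum_succ]
        congr 1
        rw [HasAntidiagonal.mem_antidiagonal] at hp
        exact Nat.choose_symm_of_eq_add (by omega)
      · simp_rw [fun e : W × W => ih fun L L' => Φ L (e :: L')]
        rw [sum_comm]
        refine sum_congr rfl fun p _ => ?_
        simp_rw [seqSum_succ, seqSum_sum]
        rw [← smul_sum]
    · intro a b
      simp [hlr]
    · intro a b
      simp [hrl]

end Sequences

end HurwitzGenusOne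

namespace HurwitzGenusOne

open Finset Equiv Equiv.Perm

section Split

variable {V W : Type*}

lemma mem_leftPairs {L : List ((V ⊕ W) × (V ⊕ W))} {e : V × V} :
    e ∈ leftPairs L ↔ (Sum.inl e.1, Sum.inl e.2) ∈ L := by
  rw [leftPairs, List.mem_filterMap]
  constructor
  · rintro ⟨⟨a | a, b | b⟩, h, h'⟩ <;> simp at h'
    rw [← h']
    exact h
  · exact fun h => ⟨_, h, rfl⟩

lemma mem_rightPairs {L : List ((V ⊕ W) × (V ⊕ W))} {e : W × W} :
    e ∈ rightPairs L ↔ (Sum.inr e.1, Sum.inr e.2) ∈ L := by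
  rw [rightPairs, List.mem_filterMap]
  constructor
  · rintro ⟨⟨a | a, b | b⟩, h, h'⟩ <;> simp at h'
    rw [← h']
    exact h
  · exact fun h => ⟨_, h, rfl⟩

lemma stable_image_inl {L : List ((V ⊕ W) × (V ⊕ W))} (hL : Stable (Set.range Sum.inl) L)
    (A : Set V) : Stable (Sum.inl '' A) L ↔ Stable A (leftPairs L) := by
  constructor
  · intro h e he
    simpa using h _ (mem_leftPairs.1 he)
  · rintro h ⟨a | a, b | b⟩ he
    · simpa using h (a, b) (mem_leftPairs.2 he)
    · simpa using hL _ he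
    · simpa using hL _ he
    · simp

lemma stable_image_inr {L : List ((V ⊕ W) × (V ⊕ W))} (hL : Stable (Set.range Sum.inl) L)
    (A : Set W) : Stable (Sum.inr '' A) L ↔ Stable A (rightPairs L) := by
  constructor
  · intro h e he
    simpa using h _ (mem_rightPairs.1 he)
  · rintro h ⟨a | a, b | b⟩ he
    · simp
    · simpa using hL _ he
    · simpa using hL _ he
    · simpa using h (a, b) (mem_rightPairs.2 he)

lemma splitConn_range_inl (L : List ((V ⊕ W) × (V ⊕ W))) :
    SplitConn (Set.range Sum.inl) L
      ↔ Stable (Set.range Sum.inl) L ∧ Conn (leftPairs L) ∧ Conn (rightPairs L) := by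
  refine and_congr_right fun hL => and_congr ?_ ?_
  · constructor
    · intro h A hA
      have := h (Sum.inl '' A) (Set.image_subset_range _ _) ((stable_image_inl hL A).2 hA)
      rwa [Set.image_eq_empty, ← Set.image_univ,
        (Set.image_injective.2 Sum.inl_injective).eq_iff] at this
    · intro h B hB hs
      obtain ⟨A, rfl⟩ := Set.subset_range_iff_exists_image_eq.1 hB
      rw [Set.image_eq_empty, ← Set.image_univ,
        (Set.image_injective.2 Sum.inl_injective).eq_iff]
      exact h A ((stable_image_inl hL A).1 hs)
  · rw [Set.compl_range_inl]
    constructor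
    · intro h A hA
      have := h (Sum.inr '' A) (Set.image_subset_range _ _) ((stable_image_inr hL A).2 hA)
      rwa [Set.image_eq_empty, ← Set.image_univ,
        (Set.image_injective.2 Sum.inr_injective).eq_iff] at this
    · intro h B hB hs
      obtain ⟨A, rfl⟩ := Set.subset_range_iff_exists_image_eq.1 hB
      rw [Set.image_eq_empty, ← Set.image_univ,
        (Set.image_injective.2 Sum.inr_injective).eq_iff]
      exact h A ((stable_image_inr hL A).1 hs)

lemma stable_map (e : V ≃ W) (A : Set W) (L : List (V × V)) :
    Stable A (L.map (Prod.map e e)) ↔ Stable (e ⁻¹' A) L := by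
  simp only [Stable, List.forall_mem_map, Prod.map_fst, Prod.map_snd, Set.mem_preimage]

lemma conn_map (e : V ≃ W) (L : List (V × V)) : Conn (L.map (Prod.map e e)) ↔ Conn L := by
  constructor
  · intro h A hA
    have := h (e.symm ⁻¹' A) (by rw [stable_map]; simpa [← Set.preimage_comp] using hA)
    simpa [Set.preimage_eq_empty_iff, Set.preimage_eq_univ_iff] using this
  · intro h A hA
    have := h (e ⁻¹' A) ((stable_map e A L).1 hA)
    simpa [Set.preimage_eq_empty_iff, Set.preimage_eq_univ_iff] using this

lemma splitConn_map (e : V ≃ W) (A : Set W) (L : List (V × V)) :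
    SplitConn A (L.map (Prod.map e e)) ↔ SplitConn (e ⁻¹' A) L := by
  have key : ∀ C : Set W, (∀ B ⊆ C, Stable B (L.map (Prod.map e e)) → B = ∅ ∨ B = C)
      ↔ ∀ B ⊆ e ⁻¹' C, Stable B L → B = ∅ ∨ B = e ⁻¹' C := by
    intro C
    constructor
    · intro h B hB hs
      have := h (e '' B) (Set.image_subset_iff.2 hB)
        ((stable_map e _ L).2 (by rwa [Set.preimage_image_eq _ e.injective]))
      rw [Set.image_eq_empty] at this
      exact this.imp_right fun h => by rw [← h, Set.preimage_image_eq _ e.injective]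
    · intro h B hB hs
      have := h (e ⁻¹' B) (Set.preimage_mono hB) ((stable_map e _ L).1 hs)
      refine this.imp (fun h => ?_) fun h => e.surjective.preimage_injective h
      exact e.surjective.preimage_injective (by rw [h, Set.preimage_empty])
  rw [SplitConn, SplitConn, stable_map, key, key, Set.preimage_compl]

variable [DecidableEq V] [DecidableEq W]

lemma swapProd_split (L : List ((V ⊕ W) × (V ⊕ W))) (hL : Stable (Set.range Sum.inl) L) :
    swapProd L = Perm.sumCongr (swapProd (leftPairs L)) (swapProd (rightPairs L)) := by
  induction L with
  | nil => exact Perm.sumCongr_one.symm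
  | cons e L ih =>
    obtain ⟨he, hs⟩ := stable_cons.1 hL
    rcases e with ⟨a | a, b | b⟩
    · have h1 : leftPairs ((Sum.inl a, Sum.inl b) :: L) = (a, b) :: leftPairs L := rfl
      have h2 : rightPairs ((Sum.inl a, Sum.inl b) :: L) = rightPairs L := rfl
      rw [h1, h2, swapProd, swapProd, ih hs, ← Perm.sumCongr_swap_one, Perm.sumCongr_mul, mul_one]
    · simp at he
    · simp at he
    · have h1 : leftPairs ((Sum.inr a, Sum.inr b) :: L) = leftPairs L := rfl
      have h2 : rightPairs ((Sum.inr a, Sum.inr b) :: L) = (a, b) :: rightPairs L := rfl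
      rw [h1, h2, swapProd, swapProd, ih hs, ← Perm.sumCongr_one_swap, Perm.sumCongr_mul, mul_one]

end Split

section ConnGen

local notation "𝓡" => MvPolynomial ℕ ℚ

/-- The generating polynomial of connected sequences of transpositions by cycle type. -/
noncomputable def connGen (V : Type*) [Fintype V] [DecidableEq V] (n : ℕ) : 𝓡 :=
  seqSum n fun L : List (V × V) => ind (Conn L) (mono (cycParts (swapProd L)))

variable {V W : Type*} [Fintype V] [DecidableEq V] [Fintype W] [DecidableEq W]

lemma connGen_congr (e : V ≃ W) (n : ℕ) : connGen W n = connGen V n := by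
  rw [connGen, seqSum_equiv e]
  simp only [swapProd_map, cycParts_permCongr, ind_congr (conn_map e _)]
  rfl

lemma connGen_eq_fin {k : ℕ} (h : Fintype.card V = k) (n : ℕ) :
    connGen V n = connGen (Fin k) n :=
  connGen_congr (Fintype.equivFinOfCardEq h).symm n

/-- The cut operator as an additive homomorphism. -/
noncomputable def cutHom (N : ℕ) : 𝓡 →+ 𝓡 := AddMonoidHom.mk' (cutOp N) fun f g => by
  simp only [cutOp, map_add, mul_add, sum_add_distrib]

/-- The join operator as an additive homomorphism. -/
noncomputable def joinHom (N : ℕ) : 𝓡 →+ 𝓡 := AddMonoidHom.mk' (joinOp N) fun f g => by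
  simp only [joinOp, map_add, mul_add, sum_add_distrib]

/-- The bilinear operator as a biadditive map. -/
noncomputable def bilHom (N : ℕ) : 𝓡 →+ 𝓡 →+ 𝓡 :=
  AddMonoidHom.mk' (fun f => AddMonoidHom.mk' (bilOp N f) fun g h => by
    simp only [bilOp, map_add, mul_add, sum_add_distrib]) fun f g => by
      refine AddMonoidHom.ext fun h => ?_
      change bilOp N (f + g) h = bilOp N f h + bilOp N g h
      simp only [bilOp, map_add, mul_add, add_mul, sum_add_distrib]

lemma cutHom_apply (N : ℕ) (f : 𝓡) : cutHom N f = cutOp N f := rfl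

lemma joinHom_apply (N : ℕ) (f : 𝓡) : joinHom N f = joinOp N f := rfl

lemma bilHom_apply (N : ℕ) (f g : 𝓡) : bilHom N f g = bilOp N f g := rfl

lemma seqSum_splitConn (n : ℕ) (A : Finset V) :
    seqSum n (fun L : List (V × V) => ind (SplitConn (A : Set V) L)
        (∑ a : {x // x ∈ A}, ∑ b : {x // x ∉ A}, mono (cycParts (swapProd L * swap (a : V) b))))
      = ∑ p ∈ antidiagonal n, n.choose p.1 •
          bilOp (Fintype.card V) (connGen {x // x ∈ A} p.1) (connGen {x // x ∉ A} p.2) := by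
  set e : {x // x ∈ A} ⊕ {x // x ∉ A} ≃ V := Equiv.sumCompl (· ∈ A) with he
  have hcard : Fintype.card {x // x ∈ A} + Fintype.card {x // x ∉ A} = Fintype.card V := by
    rw [← Fintype.card_sum, Fintype.card_congr e]
  have hpre : e ⁻¹' (A : Set V) = Set.range Sum.inl := by
    ext x
    rcases x with ⟨x, hx⟩ | ⟨x, hx⟩ <;> simp [he, hx]
  obtain ⟨G, hG⟩ : ∃ G : List ({x // x ∈ A} × {x // x ∈ A}) →
      List ({x // x ∉ A} × {x // x ∉ A}) → 𝓡, G = fun L₁ L₂ =>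
        ind (Conn L₁) (ind (Conn L₂) (bilOp (Fintype.card V) (mono (cycParts (swapProd L₁)))
          (mono (cycParts (swapProd L₂))))) := ⟨_, rfl⟩
  have hpt : ∀ L : List (({x // x ∈ A} ⊕ {x // x ∉ A}) × ({x // x ∈ A} ⊕ {x // x ∉ A})),
      ind (SplitConn (A : Set V) (L.map (Prod.map e e))) (∑ a : {x // x ∈ A}, ∑ b : {x // x ∉ A},
        mono (cycParts (swapProd (L.map (Prod.map e e)) * swap (a : V) b)))
      = ind (Stable (Set.range Sum.inl) L) (G (leftPairs L) (rightPairs L)) := by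
    intro L
    simp only [hG]
    rw [ind_congr (splitConn_map e A L), hpre, ind_congr (splitConn_range_inl L), ind_and, ind_and]
    by_cases hL : Stable (Set.range Sum.inl) L
    · rw [← hcard, ← sum_swap_sumCongr_mono, ← swapProd_split L hL, swapProd_map]
      have hs : ∀ (a : {x // x ∈ A}) (b : {x // x ∉ A}),
          e.permCongr (swapProd L) * swap (a : V) b
            = e.permCongr (swapProd L * swap (Sum.inl a) (Sum.inr b)) := by
        intro a b
        refine Eq.trans ?_ (map_mul e.permCongrHom _ _).symm
        congr 1
        exact (Equiv.symm_trans_swap_trans (Sum.inl a) (Sum.inr b) e).symm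
      simp_rw [hs, cycParts_permCongr]
    · rw [ind_neg hL, ind_neg hL]
  rw [seqSum_equiv e]
  simp_rw [hpt]
  rw [seqSum_split]
  refine sum_congr rfl fun p _ => ?_
  congr 1
  refine Eq.trans ?_ (map_seqSum ((bilHom (Fintype.card V)).flip (connGen {x // x ∉ A} p.2)) p.1
    fun L => ind (Conn L) (mono (cycParts (swapProd L)))).symm
  congr 1
  funext L
  rw [map_ind, AddMonoidHom.flip_apply, connGen, map_seqSum]
  simp_rw [hG, map_ind, bilHom_apply]
  by_cases hL : Conn L
  · simp only [ind_pos hL]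
  · simp only [ind_neg hL, seqSum_const_zero]

lemma connGen_succ (n : ℕ) :
    connGen V (n + 1) = cutOp (Fintype.card V) (connGen V n)
      + joinOp (Fintype.card V) (connGen V n)
      + ∑ A : Finset V, ∑ p ∈ antidiagonal n, n.choose p.1 •
          bilOp (Fintype.card V) (connGen {x // x ∈ A} p.1) (connGen {x // x ∉ A} p.2) := by
  have h : connGen V (n + 1) = seqSum n fun L : List (V × V) =>
      ∑ e ∈ univ.offDiag, ind (Conn (e :: L))
        (mono (cycParts (swapProd L * swap e.1 e.2))) := by
    rw [connGen, seqSum_succ, seqSum_sum]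
    rfl
  rw [h]
  simp_rw [fun L : List (V × V) => sum_offDiag_ind_conn_cons L
    fun e => mono (cycParts (swapProd L * swap e.1 e.2)), sum_offDiag_mono]
  rw [seqSum_add, seqSum_sum]
  simp_rw [seqSum_splitConn]
  rw [← cutHom_apply, ← joinHom_apply, ← AddMonoidHom.add_apply, connGen, map_seqSum]
  simp_rw [map_ind]
  rfl

end ConnGen

end HurwitzGenusOne

namespace HurwitzGenusOne

open Finset

section NormGen

local notation "𝓡" => MvPolynomial ℕ ℚ

/-- The normalising constant of the connected generating polynomials. -/
noncomputable def normConst (k n : ℕ) : ℚ := 1 / (k.factorial * n.factorial * 2 ^ n)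

/-- The normalised generating polynomial of connected factorisations. -/
noncomputable def normGen (k n : ℕ) : 𝓡 := normConst k n • connGen (Fin k) n

lemma normConst_succ (k n : ℕ) : (2 * (n + 1) : ℚ) * normConst k (n + 1) = normConst k n := by
  rw [normConst, normConst, Nat.factorial_succ, pow_succ]
  have h1 : (k.factorial : ℚ) ≠ 0 := by exact_mod_cast k.factorial_ne_zero
  have h2 : (n.factorial : ℚ) ≠ 0 := by exact_mod_cast n.factorial_ne_zero
  have h3 : (n : ℚ) + 1 ≠ 0 := by positivity
  push_cast
  field_simp

lemma normConst_choose (a b i j : ℕ) :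
    normConst (a + b) (i + j) * ((a + b).choose a * (i + j).choose i)
      = normConst a i * normConst b j := by
  rw [normConst, normConst, normConst, Nat.choose_symm_add (a := a), Nat.choose_symm_add (a := i),
    Nat.add_choose, Nat.add_choose,
    Nat.cast_div_charZero (Nat.factorial_mul_factorial_dvd_factorial_add _ _),
    Nat.cast_div_charZero (Nat.factorial_mul_factorial_dvd_factorial_add _ _), pow_add]
  have h : ∀ n : ℕ, (n.factorial : ℚ) ≠ 0 := fun n => by exact_mod_cast n.factorial_ne_zero
  have := h a
  have := h b
  have := h i
  have := h j
  have := h (a + b)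
  have := h (i + j)
  push_cast
  field_simp

lemma sum_finset_bilOp (k n : ℕ) :
    ∑ A : Finset (Fin k), ∑ p ∈ antidiagonal n, n.choose p.1 •
        bilOp k (connGen {x // x ∈ A} p.1) (connGen {x // x ∉ A} p.2)
      = ∑ q ∈ antidiagonal k, k.choose q.1 • ∑ p ∈ antidiagonal n, n.choose p.1 •
        bilOp k (connGen (Fin q.1) p.1) (connGen (Fin q.2) p.2) := by
  have h : ∀ A : Finset (Fin k), (∑ p ∈ antidiagonal n, n.choose p.1 •
        bilOp k (connGen {x // x ∈ A} p.1) (connGen {x // x ∉ A} p.2))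
      = (fun m => ∑ p ∈ antidiagonal n, n.choose p.1 •
        bilOp k (connGen (Fin m) p.1) (connGen (Fin (k - m)) p.2)) #A := by
    intro A
    refine sum_congr rfl fun p _ => ?_
    have hA : Fintype.card {x // x ∉ A} = k - #A := by
      rw [Fintype.card_subtype_compl (· ∈ A), Fintype.card_fin, Fintype.card_coe]
    rw [connGen_eq_fin (Fintype.card_coe A), connGen_eq_fin hA]
  rw [sum_congr rfl fun A _ => h A, ← powerset_univ,
    sum_powerset_apply_card (fun m => ∑ p ∈ antidiagonal n, n.choose p.1 •
      bilOp k (connGen (Fin m) p.1) (connGen (Fin (k - m)) p.2)),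
    Finset.Nat.sum_antidiagonal_eq_sum_range_succ_mk, card_univ, Fintype.card_fin]

lemma normGen_succ (k n : ℕ) :
    (2 * (n + 1) : ℚ) • normGen k (n + 1) = cutOp k (normGen k n) + joinOp k (normGen k n)
      + ∑ q ∈ antidiagonal k, ∑ p ∈ antidiagonal n,
          bilOp k (normGen q.1 p.1) (normGen q.2 p.2) := by
  rw [normGen, smul_smul, normConst_succ, connGen_succ, Fintype.card_fin, sum_finset_bilOp,
    smul_add, smul_add, smul_sum]
  congr 1
  · rw [normGen, ← cutHom_apply, ← cutHom_apply, ← joinHom_apply, ← joinHom_apply,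
      map_rat_smul, map_rat_smul]
  · refine sum_congr rfl fun q hq => ?_
    rw [smul_sum, smul_sum]
    refine sum_congr rfl fun p hp => ?_
    rw [HasAntidiagonal.mem_antidiagonal] at hq hp
    rw [normGen, normGen, ← bilHom_apply, ← bilHom_apply, map_rat_smul, map_rat_smul,
      AddMonoidHom.smul_apply, smul_smul (normConst q.2 _), mul_comm (normConst q.2 _),
      ← normConst_choose, hq, hp, ← Nat.cast_smul_eq_nsmul ℚ, ← Nat.cast_smul_eq_nsmul ℚ,
      smul_smul, smul_smul, mul_assoc]

end NormGen

end HurwitzGenusOne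

namespace HurwitzGenusOne

open Finset

section Components

local notation "𝓡" => MvPolynomial ℕ ℚ
local notation "π" => MvPolynomial.homogeneousComponent

lemma isHomogeneous_pvar (n : ℕ) : (pvar n).IsHomogeneous 1 := by
  rw [pvar]
  split_ifs
  · exact MvPolynomial.isHomogeneous_zero _ _ _
  · exact MvPolynomial.isHomogeneous_X _ _

lemma isHomogeneous_wd (n : ℕ) {f : 𝓡} {i : ℕ} (hf : f.IsHomogeneous i) :
    (wd n f).IsHomogeneous (i - 1) := by
  have : wd n f = MvPolynomial.C (n : ℚ) * MvPolynomial.pderiv n f := by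
    rw [wd_apply, map_natCast]
  rw [this]
  exact hf.pderiv.C_mul _

lemma wd_eq_zero_of_isHomogeneous_zero (n : ℕ) {f : 𝓡} (hf : f.IsHomogeneous 0) : wd n f = 0 := by
  rw [← MvPolynomial.totalDegree_zero_iff_isHomogeneous,
    MvPolynomial.totalDegree_eq_zero_iff_eq_C] at hf
  rw [hf, wd_apply, MvPolynomial.pderiv_C, mul_zero]

lemma isHomogeneous_cutOp (N : ℕ) {f : 𝓡} {i : ℕ} (hf : f.IsHomogeneous (i + 1)) :
    (cutOp N f).IsHomogeneous (i + 2) := by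
  refine MvPolynomial.IsHomogeneous.sum _ _ _ fun n _ => ?_
  have h := (MvPolynomial.IsHomogeneous.sum (antidiagonal n) (fun p => pvar p.1 * pvar p.2) 2
    fun p _ => (isHomogeneous_pvar p.1).mul (isHomogeneous_pvar p.2)).mul (isHomogeneous_wd n hf)
  rwa [Nat.add_sub_cancel, add_comm] at h

lemma cutOp_eq_zero (N : ℕ) {f : 𝓡} (hf : f.IsHomogeneous 0) : cutOp N f = 0 :=
  sum_eq_zero fun n _ => by rw [wd_eq_zero_of_isHomogeneous_zero n hf, mul_zero]

lemma isHomogeneous_joinOp (N : ℕ) {f : 𝓡} {i : ℕ} (hf : f.IsHomogeneous (i + 2)) :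
    (joinOp N f).IsHomogeneous (i + 1) := by
  refine MvPolynomial.IsHomogeneous.sum _ _ _ fun n _ => ?_
  have h := (isHomogeneous_pvar n).mul (MvPolynomial.IsHomogeneous.sum (antidiagonal n)
    (fun p => wd p.1 (wd p.2 f)) i fun p _ => isHomogeneous_wd p.1 (isHomogeneous_wd p.2 hf))
  rwa [add_comm] at h

lemma joinOp_eq_zero (N : ℕ) {f : 𝓡} {i : ℕ} (hf : f.IsHomogeneous i) (hi : i ≤ 1) :
    joinOp N f = 0 := by
  refine sum_eq_zero fun n _ => ?_
  rw [sum_eq_zero, mul_zero]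
  intro p _
  refine wd_eq_zero_of_isHomogeneous_zero _ ?_
  have := isHomogeneous_wd p.2 hf
  rwa [Nat.sub_eq_zero_of_le hi] at this

lemma bilOp_comm (N : ℕ) (f g : 𝓡) : bilOp N f g = bilOp N g f := by
  refine sum_congr rfl fun n _ => ?_
  rw [← Finset.Nat.sum_antidiagonal_swap]
  simp only [Prod.fst_swap, Prod.snd_swap, mul_comm]

lemma isHomogeneous_bilOp (N : ℕ) {f g : 𝓡} {i j : ℕ} (hf : f.IsHomogeneous (i + 1))
    (hg : g.IsHomogeneous (j + 1)) : (bilOp N f g).IsHomogeneous (i + j + 1) := by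
  refine MvPolynomial.IsHomogeneous.sum _ _ _ fun n _ => ?_
  have h := (isHomogeneous_pvar n).mul (MvPolynomial.IsHomogeneous.sum (antidiagonal n)
    (fun p => wd p.1 f * wd p.2 g) (i + j) fun p _ =>
      (isHomogeneous_wd p.1 hf).mul (isHomogeneous_wd p.2 hg))
  rwa [add_comm] at h

lemma bilOp_eq_zero_left (N : ℕ) {f : 𝓡} (g : 𝓡) (hf : f.IsHomogeneous 0) : bilOp N f g = 0 := by
  refine sum_eq_zero fun n _ => ?_
  rw [sum_eq_zero, mul_zero]
  intro p _
  rw [wd_eq_zero_of_isHomogeneous_zero _ hf, zero_mul]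

lemma bilOp_eq_zero_right (N : ℕ) (f : 𝓡) {g : 𝓡} (hg : g.IsHomogeneous 0) : bilOp N f g = 0 := by
  rw [bilOp_comm, bilOp_eq_zero_left N f hg]

lemma homogeneousComponent_of_isHomogeneous_ne {f : 𝓡} {i m : ℕ} (hf : f.IsHomogeneous i)
    (h : m ≠ i) : π m f = 0 := by
  rw [MvPolynomial.homogeneousComponent_of_mem hf, if_neg h]

lemma sum_homogeneousComponent_range (f : 𝓡) {N : ℕ} (hN : f.totalDegree < N) :
    ∑ i ∈ range N, π i f = f := by
  conv_rhs => rw [← MvPolynomial.sum_homogeneousComponent f]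
  symm
  refine sum_subset (range_subset_range.2 hN) fun i _ hi => ?_
  rw [Finset.mem_range, not_lt] at hi
  exact MvPolynomial.homogeneousComponent_eq_zero _ _ hi

lemma homogeneousComponent_map (D : 𝓡 →+ 𝓡) (m i : ℕ)
    (h1 : ∀ f : 𝓡, f.IsHomogeneous i → (D f).IsHomogeneous m)
    (h2 : ∀ j, j ≠ i → ∀ f : 𝓡, f.IsHomogeneous j → π m (D f) = 0) (f : 𝓡) :
    π m (D f) = D (π i f) := by
  conv_lhs => rw [← MvPolynomial.sum_homogeneousComponent f]
  rw [map_sum, map_sum, sum_eq_single i]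
  · exact MvPolynomial.homogeneousComponent_eq_self
      (h1 _ (MvPolynomial.homogeneousComponent_isHomogeneous _ _))
  · exact fun j _ hj => h2 j hj _ (MvPolynomial.homogeneousComponent_isHomogeneous _ _)
  · intro hi
    rw [Finset.mem_range, not_lt] at hi
    rw [MvPolynomial.homogeneousComponent_eq_zero _ _ hi, map_zero, map_zero]

lemma homogeneousComponent_cutOp (N m : ℕ) (f : 𝓡) :
    π (m + 1) (cutOp N f) = cutOp N (π m f) := by
  refine homogeneousComponent_map (cutHom N) (m + 1) m (fun f hf => ?_) (fun j hj f hf => ?_) f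
  · rcases m with _ | m
    · rw [cutHom_apply, cutOp_eq_zero N hf]
      exact MvPolynomial.isHomogeneous_zero _ _ _
    · exact isHomogeneous_cutOp N hf
  · rcases j with _ | j
    · rw [cutHom_apply, cutOp_eq_zero N hf, map_zero]
    · exact homogeneousComponent_of_isHomogeneous_ne (isHomogeneous_cutOp N hf) (by omega)

lemma homogeneousComponent_zero_cutOp (N : ℕ) (f : 𝓡) : π 0 (cutOp N f) = 0 := by
  have hc : MvPolynomial.constantCoeff (cutOp N f) = 0 := by
    have hp : ∀ n, MvPolynomial.constantCoeff (pvar n) = 0 := by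
      intro n
      rw [pvar]
      split_ifs <;> simp
    simp [cutOp, hp]
  rw [MvPolynomial.homogeneousComponent_zero, ← MvPolynomial.constantCoeff_eq, hc, map_zero]

lemma homogeneousComponent_joinOp (N m : ℕ) (f : 𝓡) :
    π m (joinOp N f) = joinOp N (π (m + 1) f) := by
  refine homogeneousComponent_map (joinHom N) m (m + 1) (fun f hf => ?_) (fun j hj f hf => ?_) f
  · rcases m with _ | m
    · rw [joinHom_apply, joinOp_eq_zero N hf le_rfl]
      exact MvPolynomial.isHomogeneous_zero _ _ _
    · exact isHomogeneous_joinOp N hf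
  · rcases j with _ | _ | j
    · rw [joinHom_apply, joinOp_eq_zero N hf (by omega), map_zero]
    · rw [joinHom_apply, joinOp_eq_zero N hf (by omega), map_zero]
    · exact homogeneousComponent_of_isHomogeneous_ne (isHomogeneous_joinOp N hf) (by omega)

lemma homogeneousComponent_bilOp_of_isHomogeneous (N m : ℕ) {i : ℕ} {f : 𝓡}
    (hf : f.IsHomogeneous i) (hi : i ≤ m + 1) (g : 𝓡) :
    π m (bilOp N f g) = bilOp N f (π (m + 1 - i) g) := by
  refine homogeneousComponent_map (bilHom N f) m (m + 1 - i) (fun g hg => ?_)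
    (fun j hj g hg => ?_) g
  · rcases i with _ | i
    · rw [bilHom_apply, bilOp_eq_zero_left N g hf]
      exact MvPolynomial.isHomogeneous_zero _ _ _
    · obtain ⟨j, rfl⟩ : ∃ j, m = i + j := ⟨m - i, by omega⟩
      rw [show i + j + 1 - (i + 1) = j by omega] at hg
      rcases j with _ | j
      · rw [bilHom_apply, bilOp_eq_zero_right N f hg]
        exact MvPolynomial.isHomogeneous_zero _ _ _
      · exact isHomogeneous_bilOp N hf hg
  · rcases i with _ | i
    · rw [bilHom_apply, bilOp_eq_zero_left N g hf, map_zero]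
    · rcases j with _ | j
      · rw [bilHom_apply, bilOp_eq_zero_right N f hg, map_zero]
      · exact homogeneousComponent_of_isHomogeneous_ne (isHomogeneous_bilOp N hf hg) (by omega)

lemma homogeneousComponent_bilOp_of_lt (N m : ℕ) {i : ℕ} {f : 𝓡}
    (hf : f.IsHomogeneous i) (hi : m + 1 < i) (g : 𝓡) : π m (bilOp N f g) = 0 := by
  have h := homogeneousComponent_map (bilHom N f) m 0 (fun g hg => ?_) (fun j hj g hg => ?_) g
  · rw [bilHom_apply, bilHom_apply] at h
    rw [h, bilOp_eq_zero_right N f (MvPolynomial.homogeneousComponent_isHomogeneous _ _)]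
  · rw [bilHom_apply, bilOp_eq_zero_right N f hg]
    exact MvPolynomial.isHomogeneous_zero _ _ _
  · obtain ⟨i, rfl⟩ : ∃ i', i = i' + 1 := ⟨i - 1, by omega⟩
    obtain ⟨j, rfl⟩ : ∃ j', j = j' + 1 := ⟨j - 1, by omega⟩
    exact homogeneousComponent_of_isHomogeneous_ne (isHomogeneous_bilOp N hf hg) (by omega)

lemma homogeneousComponent_bilOp (N m : ℕ) (f g : 𝓡) :
    π m (bilOp N f g) = ∑ c ∈ antidiagonal (m + 1), bilOp N (π c.1 f) (π c.2 g) := by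
  rw [Finset.Nat.sum_antidiagonal_eq_sum_range_succ_mk]
  conv_lhs => rw [← sum_homogeneousComponent_range f
    (N := max (f.totalDegree + 1) (m + 2)) (lt_max_of_lt_left (Nat.lt_succ_self _)),
    ← bilHom_apply, map_sum, AddMonoidHom.finsetSum_apply, map_sum]
  symm
  refine Eq.trans (sum_congr rfl fun i hi => ?_)
    (sum_subset (range_subset_range.2 (le_max_right _ _)) fun i _ hi => ?_)
  · rw [Finset.mem_range] at hi
    exact (homogeneousComponent_bilOp_of_isHomogeneous N m
      (MvPolynomial.homogeneousComponent_isHomogeneous _ _) (by omega) g).symm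
  · rw [Finset.mem_range] at hi
    exact homogeneousComponent_bilOp_of_lt N m
      (MvPolynomial.homogeneousComponent_isHomogeneous _ _) (by omega) g

lemma coeff_X_mul_pderiv (n : ℕ) (f : 𝓡) (d : ℕ →₀ ℕ) :
    MvPolynomial.coeff d (MvPolynomial.X n * MvPolynomial.pderiv n f)
      = d n * MvPolynomial.coeff d f := by
  induction f using MvPolynomial.induction_on' with
  | monomial e c =>
    rw [MvPolynomial.X_mul_pderiv_monomial, MvPolynomial.coeff_smul, MvPolynomial.coeff_monomial]
    split_ifs with h
    · rw [h, nsmul_eq_mul]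
    · simp
  | add f g hf hg => rw [map_add, mul_add, MvPolynomial.coeff_add, hf, hg, MvPolynomial.coeff_add,
      mul_add]

lemma homogeneousComponent_degOp (k m : ℕ) {f : 𝓡}
    (hf : ∀ n, n = 0 ∨ k < n → MvPolynomial.pderiv n f = 0) :
    π m (degOp k f) = m * π m f := by
  have hz : ∀ n, n = 0 ∨ k < n → ∀ d : ℕ →₀ ℕ, (d n : ℚ) * MvPolynomial.coeff d f = 0 := by
    intro n hn d
    rw [← coeff_X_mul_pderiv, hf n hn, mul_zero, MvPolynomial.coeff_zero]
  ext d
  rw [← map_natCast (MvPolynomial.C (σ := ℕ) (R := ℚ)), MvPolynomial.coeff_C_mul,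
    MvPolynomial.coeff_homogeneousComponent, MvPolynomial.coeff_homogeneousComponent]
  split_ifs with hd
  · have h1 : MvPolynomial.coeff d (degOp k f)
        = ∑ n ∈ range (k + 1), (d n : ℚ) * MvPolynomial.coeff d f := by
      rw [degOp, MvPolynomial.coeff_sum]
      refine sum_congr rfl fun n _ => ?_
      rcases eq_or_ne n 0 with rfl | hn
      · rw [hz 0 (Or.inl rfl), pvar_zero, zero_mul, MvPolynomial.coeff_zero]
      · rw [pvar, if_neg hn, coeff_X_mul_pderiv]
    rw [h1, ← hd, Finsupp.degree_apply, Nat.cast_sum, sum_mul]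
    by_cases h0 : MvPolynomial.coeff d f = 0
    · simp [h0]
    · symm
      refine sum_subset (fun n hn => ?_) fun n _ hn => ?_
      · by_contra hk
        rw [Finset.mem_range, not_lt] at hk
        have := hz n (Or.inr hk) d
        rw [mul_eq_zero, or_iff_left h0, Nat.cast_eq_zero] at this
        exact (Finsupp.mem_support_iff.1 hn) this
      · rw [Finsupp.notMem_support_iff.1 hn, Nat.cast_zero, zero_mul]
  · rw [mul_zero]

end Components

end HurwitzGenusOne

namespace HurwitzGenusOne

open PowerSeries Finset

section Candidates

local notation "𝓡" => MvPolynomial ℕ ℚ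
local notation "u" => treeCoeff
local notation "π" => MvPolynomial.homogeneousComponent

lemma subCoeff_eq_zero_of_dvd {k n : ℕ} (hn : k < n) {g : 𝓡⟦X⟧} (hg : X ^ n ∣ g) :
    subCoeff k g = 0 :=
  X_pow_dvd_iff.1 (lagrange_X_pow_dvd hg) k hn

lemma pderiv_candZero_eq_zero {k n : ℕ} (hk : k ≠ 0) (hn : n = 0 ∨ k < n) :
    MvPolynomial.pderiv n (candZero k) = 0 := by
  apply mul_left_cancel₀ (show (k : 𝓡) ≠ 0 by exact_mod_cast hk)
  rw [natCast_mul_pderiv_candZero hk, mul_zero]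
  rcases hn with rfl | hn
  · simp [subCoeff_zero]
  · exact subCoeff_eq_zero_of_dvd hn (Dvd.intro_left _ rfl)

lemma pderiv_candOne_eq_zero {k n : ℕ} (hn : n = 0 ∨ k < n) :
    MvPolynomial.pderiv n (candOne k) = 0 := by
  rw [pderiv_candOne]
  rcases hn with rfl | hn
  · simp [subCoeff_zero, treeCoeff_zero]
  · rw [subCoeff_eq_zero_of_dvd hn, mul_zero]
    exact (((Dvd.intro_left _ rfl).mul_right _).mul_right _)

lemma candOne_zero : candOne 0 = 0 := by
  rw [candOne, subCoeff_of_index_zero, map_sub, constantCoeff_logPsi, constantCoeff_psi, sub_zero,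
    mul_zero]

lemma natCast_sq_mul_candZero_eq_sum {k : ℕ} (hk : k ≠ 0) :
    (k : 𝓡) * (k * candZero k)
      = ∑ n ∈ range (k + 1), pvar n * subCoeff k (ratC (n ^ 0 * u n) * X ^ n) := by
  rw [natCast_sq_mul_candZero hk, ← mul_one (psi 0), psi, subCoeff_linSeries_mul]
  simp only [mul_one]

lemma candZero_one : candZero 1 = pvar 1 := by
  have h := natCast_sq_mul_candZero_eq_sum one_ne_zero
  have h1 : subCoeff 1 (X ^ 1) = 1 := coeff_lagrange_X_pow_self constantCoeff_expPsi 1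
  rw [sum_range_succ, sum_range_one, pvar_zero, zero_mul, zero_add, subCoeff_ratC_mul, h1,
    treeCoeff_of_ne_zero one_ne_zero] at h
  simpa using h

lemma constantCoeff_pvar (n : ℕ) : MvPolynomial.constantCoeff (pvar n) = 0 := by
  rw [pvar]
  split_ifs <;> simp

lemma homogeneousComponent_zero_candZero (k : ℕ) : π 0 (candZero k) = 0 := by
  rcases eq_or_ne k 0 with rfl | hk
  · rw [candZero_zero, map_zero]
  have h := congrArg MvPolynomial.constantCoeff (natCast_sq_mul_candZero_eq_sum hk)
  rw [map_sum, map_mul, map_mul, map_natCast, sum_eq_zero] at h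
  · have hk' : (k : ℚ) ≠ 0 := by exact_mod_cast hk
    simp only [mul_eq_zero, hk', false_or] at h
    rw [MvPolynomial.homogeneousComponent_zero, ← MvPolynomial.constantCoeff_eq, h, map_zero]
  · intro n _
    rw [map_mul, constantCoeff_pvar, zero_mul]

end Candidates

section Solve

local notation "𝓡" => MvPolynomial ℕ ℚ
local notation "π" => MvPolynomial.homogeneousComponent

/-- The expected homogeneous components of the normalised generating polynomials. -/
noncomputable def expected (k m n : ℕ) : 𝓡 :=
  if n + 2 = k + m then π m (candZero k) else if n = k + m then π m (candOne k) else 0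

lemma cycParts_eq_zero (σ : Equiv.Perm (Fin 0)) : cycParts σ = 0 := by
  have h := sum_cycParts σ
  rw [Fintype.card_fin, Multiset.sum_eq_zero_iff] at h
  refine Multiset.eq_zero_of_forall_notMem fun x hx => zero_notMem_cycParts σ ?_
  obtain rfl := h x hx
  exact hx

lemma isHomogeneous_normGen_zero (n : ℕ) : (normGen 0 n).IsHomogeneous 0 := by
  rw [normGen, MvPolynomial.smul_eq_C_mul]
  refine MvPolynomial.IsHomogeneous.C_mul ?_ _
  rw [connGen]
  rcases n with _ | n
  · rw [seqSum_zero, cycParts_eq_zero, mono_zero, ind]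
    split_ifs
    · exact MvPolynomial.isHomogeneous_one _ _
    · exact MvPolynomial.isHomogeneous_zero _ _ _
  · rw [seqSum_succ]
    exact MvPolynomial.isHomogeneous_zero _ _ _

lemma normGen_one_zero : normGen 1 0 = pvar 1 := by
  have h : Conn ([] : List (Fin 1 × Fin 1)) := fun A _ => by
    rcases A.eq_empty_or_nonempty with h | ⟨x, hx⟩
    · exact Or.inl h
    · exact Or.inr (Set.eq_univ_of_forall fun y => Subsingleton.elim x y ▸ hx)
  rw [normGen, connGen, seqSum_zero, ind_pos h, swapProd, cycParts]
  simp [normConst, mono]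

lemma normGen_zero_of_two_le {k : ℕ} (hk : 2 ≤ k) : normGen k 0 = 0 := by
  have h : ¬ Conn ([] : List (Fin k × Fin k)) := fun h => by
    have h0 : ({⟨0, by omega⟩} : Set (Fin k)) ≠ Set.univ := by
      intro h1
      have : (⟨1, by omega⟩ : Fin k) ∈ ({⟨0, by omega⟩} : Set (Fin k)) := h1 ▸ Set.mem_univ _
      simp at this
    exact (h {⟨0, by omega⟩} fun e he => by simp at he).elim (Set.singleton_ne_empty _) h0
  rw [normGen, connGen, seqSum_zero, ind_neg h, smul_zero]

lemma sum_antidiagonal_of_support (B : 𝓡 →+ 𝓡 →+ 𝓡) (a b : ℕ → 𝓡) (s t n : ℕ)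
    (A₀ A₁ B₀ B₁ : 𝓡)
    (ha : ∀ p ≤ n, p ≤ s + 2 → a p = if p = s then A₀ else if p = s + 2 then A₁ else 0)
    (hb : ∀ p ≤ n, p ≤ t + 2 → b p = if p = t then B₀ else if p = t + 2 then B₁ else 0)
    (hn : n ≤ s + t + 2) :
    ∑ p ∈ antidiagonal n, B (a p.1) (b p.2)
      = if n = s + t then B A₀ B₀ else if n = s + t + 2 then B A₀ B₁ + B A₁ B₀ else 0 := by
  have h : ∀ p ∈ antidiagonal n, B (a p.1) (b p.2)
      = (if p = (s, t) then B A₀ B₀ else 0) + (if p = (s, t + 2) then B A₀ B₁ else 0)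
        + (if p = (s + 2, t) then B A₁ B₀ else 0) := by
    rintro ⟨p, q⟩ hp
    rw [HasAntidiagonal.mem_antidiagonal] at hp
    dsimp only at hp ⊢
    simp only [Prod.mk.injEq]
    by_cases h1 : s + 2 < p
    · have h2 := hb q (by omega) (by omega)
      rw [if_neg (by omega), if_neg (by omega)] at h2
      rw [h2, map_zero, if_neg (by omega), if_neg (by omega), if_neg (by omega)]
      simp
    by_cases h1' : t + 2 < q
    · have h2 := ha p (by omega) (by omega)
      rw [if_neg (by omega), if_neg (by omega)] at h2
      rw [h2, map_zero, if_neg (by omega), if_neg (by omega), if_neg (by omega)]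
      simp
    rw [ha p (by omega) (by omega), hb q (by omega) (by omega)]
    by_cases hs : p = s
    · subst hs
      by_cases ht : q = t
      · simp [ht]
      · by_cases ht' : q = t + 2 <;> simp [ht, ht']
    · by_cases hs' : p = s + 2
      · subst hs'
        by_cases ht : q = t
        · simp [ht]
        · rw [if_neg ht, if_neg (show ¬ q = t + 2 by omega), map_zero]
          simp [ht]
      · simp [hs, hs']
  rw [sum_congr rfl h, sum_add_distrib, sum_add_distrib, sum_ite_eq', sum_ite_eq', sum_ite_eq']
  simp only [HasAntidiagonal.mem_antidiagonal]
  by_cases h1 : n = s + t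
  · rw [if_pos h1.symm, if_neg (by omega), if_neg (by omega), if_pos h1]
    simp
  · rw [if_neg (Ne.symm h1), if_neg h1]
    by_cases h2 : n = s + t + 2
    · rw [if_pos (by omega), if_pos (by omega), if_pos h2, zero_add]
    · rw [if_neg (by omega), if_neg (by omega), if_neg h2]
      simp

lemma sum_bilOp_component {n : ℕ}
    (ih : ∀ p ≤ n, ∀ k m, k ≠ 0 → p ≤ k + m → π m (normGen k p) = expected k m p)
    (N : ℕ) {q₁ q₂ i j : ℕ} (h₁ : q₁ ≠ 0) (h₂ : q₂ ≠ 0) (hn : n + 2 ≤ q₁ + q₂ + (i + j)) :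
    ∑ p ∈ antidiagonal n, bilOp N (π i (normGen q₁ p.1)) (π j (normGen q₂ p.2))
      = if n + 4 = q₁ + q₂ + (i + j) then bilOp N (π i (candZero q₁)) (π j (candZero q₂))
        else if n + 2 = q₁ + q₂ + (i + j) then
          bilOp N (π i (candZero q₁)) (π j (candOne q₂))
            + bilOp N (π i (candOne q₁)) (π j (candZero q₂))
        else 0 := by
  rcases eq_or_ne i 0 with rfl | hi
  · simp only [fun f g => bilOp_eq_zero_left N g (MvPolynomial.homogeneousComponent_isHomogeneous
      0 (f : 𝓡)), sum_const_zero, add_zero, ite_self]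
  rcases eq_or_ne j 0 with rfl | hj
  · simp only [fun f g => bilOp_eq_zero_right N f (MvPolynomial.homogeneousComponent_isHomogeneous
      0 (g : 𝓡)), sum_const_zero, add_zero, ite_self]
  obtain ⟨s, hs⟩ : ∃ s, q₁ + i = s + 2 := ⟨q₁ + i - 2, by omega⟩
  obtain ⟨t, ht⟩ : ∃ t, q₂ + j = t + 2 := ⟨q₂ + j - 2, by omega⟩
  have h := sum_antidiagonal_of_support (bilHom N) (fun p => π i (normGen q₁ p))
    (fun p => π j (normGen q₂ p)) s t n (π i (candZero q₁)) (π i (candOne q₁))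
    (π j (candZero q₂)) (π j (candOne q₂)) (fun p hp hps => ?_) (fun p hp hpt => ?_) (by omega)
  · refine h.trans ?_
    have e1 : n = s + t ↔ n + 4 = q₁ + q₂ + (i + j) := by omega
    have e2 : n = s + t + 2 ↔ n + 2 = q₁ + q₂ + (i + j) := by omega
    simp only [e1, e2]
    rfl
  · have e : p + 2 = s + 2 ↔ p = s := by omega
    simp only [ih p hp q₁ i h₁ (by omega), expected, hs, e]
  · have e : p + 2 = t + 2 ↔ p = t := by omega
    simp only [ih p hp q₂ j h₂ (by omega), expected, ht, e]

lemma component_sum_bilOp {n : ℕ}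
    (ih : ∀ p ≤ n, ∀ k m, k ≠ 0 → p ≤ k + m → π m (normGen k p) = expected k m p)
    (N k m : ℕ) (hn : n + 1 ≤ k + m) :
    π m (∑ q ∈ antidiagonal k, ∑ p ∈ antidiagonal n,
        bilOp N (normGen q.1 p.1) (normGen q.2 p.2))
      = if n + 3 = k + m then π m (∑ q ∈ antidiagonal k, bilOp N (candZero q.1) (candZero q.2))
        else if n + 1 = k + m then
          π m (2 * ∑ q ∈ antidiagonal k, bilOp N (candZero q.1) (candOne q.2))
        else 0 := by
  have hsymm : 2 * ∑ q ∈ antidiagonal k, bilOp N (candZero q.1) (candOne q.2)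
      = ∑ q ∈ antidiagonal k, (bilOp N (candZero q.1) (candOne q.2)
        + bilOp N (candOne q.1) (candZero q.2)) := by
    have h := Finset.Nat.sum_antidiagonal_swap (n := k)
      (f := fun q => bilOp N (candZero q.1) (candOne q.2))
    simp only [Prod.fst_swap, Prod.snd_swap] at h
    rw [sum_add_distrib, two_mul, add_right_inj, ← h]
    exact sum_congr rfl fun q _ => bilOp_comm _ _ _
  have key : ∀ q ∈ antidiagonal k, π m (∑ p ∈ antidiagonal n,
        bilOp N (normGen q.1 p.1) (normGen q.2 p.2))
      = if n + 3 = k + m then π m (bilOp N (candZero q.1) (candZero q.2))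
        else if n + 1 = k + m then π m (bilOp N (candZero q.1) (candOne q.2)
          + bilOp N (candOne q.1) (candZero q.2))
        else 0 := by
    rintro ⟨q₁, q₂⟩ hq
    rw [HasAntidiagonal.mem_antidiagonal] at hq
    dsimp only at hq ⊢
    have hzero : (0 : 𝓡).IsHomogeneous 0 := MvPolynomial.isHomogeneous_zero _ _ _
    rcases eq_or_ne q₁ 0 with rfl | h₁
    · simp only [bilOp_eq_zero_left N _ (isHomogeneous_normGen_zero _), candZero_zero,
        candOne_zero, bilOp_eq_zero_left N _ hzero, sum_const_zero, map_zero, add_zero, ite_self]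
    rcases eq_or_ne q₂ 0 with rfl | h₂
    · simp only [bilOp_eq_zero_right N _ (isHomogeneous_normGen_zero _), candZero_zero,
        candOne_zero, bilOp_eq_zero_right N _ hzero, sum_const_zero, map_zero, add_zero, ite_self]
    simp only [map_sum, map_add, homogeneousComponent_bilOp]
    rw [sum_comm]
    have h : ∀ c ∈ antidiagonal (m + 1), ∑ p ∈ antidiagonal n,
        bilOp N (π c.1 (normGen q₁ p.1)) (π c.2 (normGen q₂ p.2))
      = if n + 3 = k + m then bilOp N (π c.1 (candZero q₁)) (π c.2 (candZero q₂))
        else if n + 1 = k + m then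
          bilOp N (π c.1 (candZero q₁)) (π c.2 (candOne q₂))
            + bilOp N (π c.1 (candOne q₁)) (π c.2 (candZero q₂))
        else 0 := by
      intro c hc
      rw [HasAntidiagonal.mem_antidiagonal] at hc
      rw [sum_bilOp_component ih N h₁ h₂ (by omega), hc, hq]
      have e1 : n + 4 = k + (m + 1) ↔ n + 3 = k + m := by omega
      have e2 : n + 2 = k + (m + 1) ↔ n + 1 = k + m := by omega
      simp only [e1, e2]
    rw [sum_congr rfl h]
    split_ifs
    · rfl
    · rw [sum_add_distrib]
    · rw [sum_const_zero]
  rw [map_sum, sum_congr rfl key, hsymm, map_sum, map_sum]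
  split_ifs
  · rfl
  · rfl
  · rw [sum_const_zero]

lemma component_candZero {k : ℕ} (hk : k ≠ 0) {n m : ℕ} (hn : n + 3 = k + m) :
    (2 * (n + 1) : ℚ) • π m (candZero k) = π m (cutOp k (candZero k))
      + π m (∑ q ∈ antidiagonal k, bilOp k (candZero q.1) (candZero q.2)) := by
  have h := congrArg (π m) (candZero_cutJoin hk)
  rw [map_add] at h
  rw [← h]
  have e : 2 * ((k : 𝓡) * candZero k + degOp k (candZero k) - 2 * candZero k)
      = (2 : ℚ) • ((k : ℚ) • candZero k + degOp k (candZero k) - (2 : ℚ) • candZero k) := by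
    simp only [MvPolynomial.smul_eq_C_mul, map_ofNat, map_natCast]
  rw [e, map_smul, map_sub, map_add, map_smul, map_smul,
    homogeneousComponent_degOp k m fun n hn => pderiv_candZero_eq_zero hk hn]
  have hc : (n : 𝓡) + 3 = k + m := by exact_mod_cast congrArg (Nat.cast (R := 𝓡)) hn
  simp only [MvPolynomial.smul_eq_C_mul, map_ofNat, map_natCast, map_mul, map_add, map_one]
  linear_combination (2 * π m (candZero k)) * hc

lemma component_candOne {k : ℕ} (hk : k ≠ 0) {n m : ℕ} (hn : n + 1 = k + m) :
    (2 * (n + 1) : ℚ) • π m (candOne k) = π m (cutOp k (candOne k)) + π m (joinOp k (candZero k))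
      + π m (2 * ∑ q ∈ antidiagonal k, bilOp k (candZero q.1) (candOne q.2)) := by
  have h := congrArg (π m) (candOne_cutJoin hk)
  rw [map_add, map_add] at h
  rw [← h]
  have e : 2 * ((k : 𝓡) * candOne k + degOp k (candOne k))
      = (2 : ℚ) • ((k : ℚ) • candOne k + degOp k (candOne k)) := by
    simp only [MvPolynomial.smul_eq_C_mul, map_ofNat, map_natCast]
  rw [e, map_smul, map_add, map_smul,
    homogeneousComponent_degOp k m fun n hn => pderiv_candOne_eq_zero hn]
  have hc : (n : 𝓡) + 1 = k + m := by exact_mod_cast congrArg (Nat.cast (R := 𝓡)) hn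
  simp only [MvPolynomial.smul_eq_C_mul, map_ofNat, map_natCast, map_mul, map_add, map_one]
  linear_combination (2 * π m (candOne k)) * hc

theorem component_normGen (n : ℕ) :
    ∀ k m, k ≠ 0 → n ≤ k + m → π m (normGen k n) = expected k m n := by
  induction n using Nat.strong_induction_on with
  | _ n ih =>
    intro k m hk hn
    rcases n with _ | n
    · rw [expected]
      rcases Nat.lt_or_ge k 2 with h | h
      · obtain rfl : k = 1 := by omega
        rw [normGen_one_zero, candZero_one]
        split_ifs with h1 h2
        · rfl
        · omega
        · exact homogeneousComponent_of_isHomogeneous_ne (isHomogeneous_pvar 1) (by omega)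
      · rw [normGen_zero_of_two_le h, map_zero]
        split_ifs with h1 h2
        · obtain rfl : m = 0 := by omega
          rw [homogeneousComponent_zero_candZero]
        · omega
        · rfl
    · have ih' : ∀ p ≤ n, ∀ k m, k ≠ 0 → p ≤ k + m → π m (normGen k p) = expected k m p :=
        fun p hp => ih p (by omega)
      have hc : (2 * (n + 1) : ℚ) ≠ 0 := by positivity
      have hcut : π m (cutOp k (normGen k n)) = if n + 3 = k + m then π m (cutOp k (candZero k))
          else if n + 1 = k + m then π m (cutOp k (candOne k)) else 0 := by
        rcases m with _ | m
        · simp only [homogeneousComponent_zero_cutOp, ite_self]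
        · rw [homogeneousComponent_cutOp, homogeneousComponent_cutOp, homogeneousComponent_cutOp,
            ih' n le_rfl k m hk (by omega), expected]
          have e1 : n + 3 = k + (m + 1) ↔ n + 2 = k + m := by omega
          have e2 : n + 1 = k + (m + 1) ↔ n = k + m := by omega
          simp only [e1, e2]
          split_ifs
          · rfl
          · rfl
          · exact (cutHom k).map_zero
      have hjoin : π m (joinOp k (normGen k n)) = if n + 1 = k + m then
          π m (joinOp k (candZero k)) else 0 := by
        rw [homogeneousComponent_joinOp, homogeneousComponent_joinOp,
            ih' n le_rfl k (m + 1) hk (by omega), expected]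
        have e1 : n + 2 = k + (m + 1) ↔ n + 1 = k + m := by omega
        rw [if_neg (show ¬ n = k + (m + 1) by omega)]
        simp only [e1]
        split_ifs
        · rfl
        · exact (joinHom k).map_zero
      have key : (2 * (n + 1) : ℚ) • π m (normGen k (n + 1))
          = (2 * (n + 1) : ℚ) • expected k m (n + 1) := by
        rw [← map_smul, normGen_succ, map_add, map_add, hcut, hjoin,
          component_sum_bilOp ih' k k m hn, expected]
        by_cases h1 : n + 3 = k + m
        · rw [if_pos h1, if_neg (by omega), if_pos h1, if_pos (by omega),
            component_candZero hk h1, add_zero]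
        · rw [if_neg h1, if_neg h1, if_neg (show ¬ n + 1 + 2 = k + m by omega)]
          by_cases h2 : n + 1 = k + m
          · rw [if_pos h2, if_pos h2, if_pos h2, if_pos h2, component_candOne hk h2]
          · rw [if_neg h2, if_neg h2, if_neg h2, if_neg h2, smul_zero, add_zero, add_zero]
      exact smul_right_injective _ hc key

lemma component_normGen_genusOne {k : ℕ} (hk : k ≠ 0) (m : ℕ) :
    π m (normGen k (k + m)) = π m (candOne k) := by
  rw [component_normGen (k + m) k m hk le_rfl, expected, if_neg (by omega), if_pos rfl]

end Solve

end HurwitzGenusOne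

namespace HurwitzGenusOne

open Finset Equiv Equiv.Perm

section Counting

variable {V : Type*} {M : Type*} [AddCommMonoid M]

local notation "𝓡" => MvPolynomial ℕ ℚ

lemma card_filter_swap_eq [Fintype V] [DecidableEq V] {t : Perm V} (ht : t.IsSwap) :
    #{e ∈ (univ : Finset V).offDiag | swap e.1 e.2 = t} = 2 := by
  obtain ⟨x, y, hxy, rfl⟩ := ht
  have h : {e ∈ (univ : Finset V).offDiag | swap e.1 e.2 = swap x y}
      = ({(x, y), (y, x)} : Finset (V × V)) := by
    ext ⟨a, b⟩
    simp only [Finset.mem_filter, mem_offDiag, mem_univ, true_and, mem_insert, mem_singleton,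
      Prod.mk.injEq]
    constructor
    · rintro ⟨hab, h⟩
      have ha : swap x y a = b := by rw [← h, swap_apply_left]
      by_cases h1 : a = x
      · subst h1
        rw [swap_apply_left] at ha
        exact Or.inl ⟨rfl, ha.symm⟩
      · by_cases h2 : a = y
        · subst h2
          rw [swap_apply_right] at ha
          exact Or.inr ⟨rfl, ha.symm⟩
        · rw [swap_apply_of_ne_of_ne h1 h2] at ha
          exact absurd ha hab
    · rintro (⟨rfl, rfl⟩ | ⟨rfl, rfl⟩)
      · exact ⟨hxy, rfl⟩
      · exact ⟨hxy.symm, swap_comm _ _⟩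
  rw [h, card_pair]
  simp [hxy]

lemma sum_offDiag_swap [Fintype V] [DecidableEq V] (g : Perm V → M) :
    ∑ e ∈ (univ : Finset V).offDiag, g (swap e.1 e.2) = 2 • ∑ t, ind t.IsSwap (g t) := by
  rw [← sum_fiberwise' _ (fun e : V × V => swap e.1 e.2), smul_sum]
  refine sum_congr rfl fun t _ => ?_
  rw [sum_const]
  by_cases ht : t.IsSwap
  · rw [card_filter_swap_eq ht, ind_pos ht]
  · rw [ind_neg ht, smul_zero, filter_false_of_mem, card_empty, zero_smul]
    rintro e he rfl
    exact ht ⟨e.1, e.2, (mem_offDiag.1 he).2.2, rfl⟩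

lemma seqSum_map_swap [Fintype V] [DecidableEq V] (n : ℕ) (Ψ : List (Perm V) → M) :
    seqSum n (fun L : List (V × V) => Ψ (L.map fun e => swap e.1 e.2))
      = 2 ^ n • ∑ T : Fin n → Perm V, ind (∀ i, (T i).IsSwap) (Ψ (List.ofFn T)) := by
  induction n generalizing Ψ with
  | zero =>
    rw [seqSum_zero, Fintype.sum_unique, ind_pos fun i => i.elim0]
    simp
  | succ n ih =>
    rw [seqSum_succ]
    simp only [List.map_cons]
    rw [sum_offDiag_swap fun t : Perm V =>
        seqSum n fun L : List (V × V) => Ψ (t :: L.map fun e => swap e.1 e.2),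
      ← (Fin.consEquiv fun _ => Perm V).sum_comp, Fintype.sum_prod_type, pow_succ', mul_smul]
    congr 1
    rw [smul_sum]
    refine sum_congr rfl fun t _ => ?_
    rw [ih fun P : List (Perm V) => Ψ (t :: P)]
    by_cases ht : t.IsSwap
    · rw [ind_pos ht]
      congr 1
      refine sum_congr rfl fun T _ => ?_
      have h : Fin.consEquiv (fun _ => Perm V) (t, T) = Fin.cons t T := rfl
      rw [h, List.ofFn_cons]
      refine ind_congr ?_ _
      rw [Fin.forall_fin_succ]
      simp [ht]
    · rw [ind_neg ht, sum_eq_zero, smul_zero]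
      intro T _
      exact ind_neg (fun h => ht (h 0)) _

lemma conn_iff_transitive [DecidableEq V] (L : List (V × V)) :
    Conn L ↔ ∀ x y : V, ∃ g ∈ Subgroup.closure {t | t ∈ L.map fun e => swap e.1 e.2}, g x = y := by
  set G := Subgroup.closure {t | t ∈ L.map fun e => swap e.1 e.2} with hG
  have hmem : ∀ e ∈ L, swap e.1 e.2 ∈ G := fun e he =>
    Subgroup.subset_closure (List.mem_map.2 ⟨e, he, rfl⟩)
  constructor
  · intro h x y
    have hs : Stable {z | ∃ g ∈ G, g x = z} L := by
      intro e he
      constructor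
      · rintro ⟨g, hg, hgx⟩
        exact ⟨swap e.1 e.2 * g, G.mul_mem (hmem e he) hg, by simp [hgx]⟩
      · rintro ⟨g, hg, hgx⟩
        exact ⟨swap e.1 e.2 * g, G.mul_mem (hmem e he) hg, by simp [hgx]⟩
    rcases h _ hs with h0 | h0
    · have hx : x ∈ {z | ∃ g ∈ G, g x = z} := ⟨1, G.one_mem, rfl⟩
      rw [h0] at hx
      exact hx.elim
    · have hy : y ∈ {z | ∃ g ∈ G, g x = z} := h0 ▸ Set.mem_univ y
      exact hy
  · intro h A hA
    rcases A.eq_empty_or_nonempty with h0 | ⟨x, hx⟩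
    · exact Or.inl h0
    refine Or.inr (Set.eq_univ_of_forall fun y => ?_)
    obtain ⟨g, hg, rfl⟩ := h x y
    have key : ∀ g ∈ G, ∀ z, g z ∈ A ↔ z ∈ A := by
      intro g hg
      induction hg using Subgroup.closure_induction with
      | mem t ht =>
        obtain ⟨e, he, rfl⟩ := List.mem_map.1 ht
        intro z
        have := hA e he
        by_cases h1 : z = e.1
        · rw [h1, swap_apply_left, this]
        · by_cases h2 : z = e.2
          · rw [h2, swap_apply_right, this]
          · rw [swap_apply_of_ne_of_ne h1 h2]
      | one => exact fun z => Iff.rfl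
      | mul a b _ _ ha hb => exact fun z => by rw [Perm.mul_apply, ha, hb]
      | inv a _ ha => exact fun z => by rw [← ha (a⁻¹ z)]; simp
    exact (key g hg x).2 hx

lemma swapProd_eq [DecidableEq V] (L : List (V × V)) :
    swapProd L = (L.map fun e => swap e.1 e.2).reverse.prod := by
  induction L with
  | nil => rfl
  | cons e L ih => rw [swapProd, ih]; simp

lemma mono_eq_monomial {s : Multiset ℕ} (hs : 0 ∉ s) :
    mono s = MvPolynomial.monomial (Multiset.toFinsupp s) 1 := by
  induction s using Multiset.induction_on with
  | empty => simp
  | cons a s ih =>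
    rw [Multiset.mem_cons, not_or] at hs
    rw [mono_cons, ih hs.2, pvar, if_neg (Ne.symm hs.1), ← Multiset.singleton_add,
      Multiset.toFinsupp_add, Multiset.toFinsupp_singleton, MvPolynomial.X,
      MvPolynomial.monomial_mul, one_mul]

lemma coeff_mono {s : Multiset ℕ} (hs : 0 ∉ s) (α : Multiset ℕ) :
    MvPolynomial.coeff (Multiset.toFinsupp α) (mono s) = ind (s = α) 1 := by
  classical
  rw [mono_eq_monomial hs, MvPolynomial.coeff_monomial, ind]
  simp only [EmbeddingLike.apply_eq_iff_eq]
  congr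

lemma coeff_connGen [Fintype V] [DecidableEq V] (n : ℕ) (α : Multiset ℕ) :
    MvPolynomial.coeff (Multiset.toFinsupp α) (connGen V n)
      = 2 ^ n * ∑ T : Fin n → Perm V, ind (∀ i, (T i).IsSwap)
          (ind (∀ x y : V, ∃ g ∈ Subgroup.closure (Set.range T), g x = y)
            (ind (cycParts (List.ofFn T).reverse.prod = α) (1 : ℚ))) := by
  have h := map_seqSum (MvPolynomial.coeffAddMonoidHom (R := ℚ) (Multiset.toFinsupp α)) n
    fun L : List (V × V) => ind (Conn L) (mono (cycParts (swapProd L)))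
  refine h.trans ?_
  have h1 : ∀ L : List (V × V), MvPolynomial.coeffAddMonoidHom (R := ℚ) (Multiset.toFinsupp α)
      (ind (Conn L) (mono (cycParts (swapProd L))))
      = (fun P : List (Perm V) =>
          ind (∀ x y : V, ∃ g ∈ Subgroup.closure {t | t ∈ P}, g x = y)
            (ind (cycParts P.reverse.prod = α) (1 : ℚ))) (L.map fun e => swap e.1 e.2) := by
    intro L
    dsimp only
    rw [map_ind, ind_congr (conn_iff_transitive L), ← swapProd_eq]
    congr 1
    exact coeff_mono (zero_notMem_cycParts _) α
  simp only [h1]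
  rw [seqSum_map_swap n fun P : List (Perm V) =>
          ind (∀ x y : V, ∃ g ∈ Subgroup.closure {t | t ∈ P}, g x = y)
            (ind (cycParts P.reverse.prod = α) (1 : ℚ)), nsmul_eq_mul]
  push_cast
  congr 1
  refine sum_congr rfl fun T _ => ?_
  have h2 : {t | t ∈ List.ofFn T} = Set.range T := by
    ext t
    simp [List.mem_ofFn]
  rw [h2]

lemma prod_inv_of_isSwap {n : ℕ} [DecidableEq V] {T : Fin n → Perm V} (hT : ∀ i, (T i).IsSwap) :
    (List.ofFn T).prod⁻¹ = (List.ofFn T).reverse.prod := by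
  rw [List.prod_inv_reverse, List.map_ofFn]
  congr 3
  funext i
  obtain ⟨x, y, -, h⟩ := hT i
  rw [Function.comp_apply, h, swap_inv]

lemma closure_range_union {n : ℕ} (T : Fin n → Perm V) :
    Subgroup.closure (Set.range T ∪ {(List.ofFn T).prod⁻¹}) = Subgroup.closure (Set.range T) := by
  refine le_antisymm ((Subgroup.closure_le _).2 (Set.union_subset Subgroup.subset_closure ?_))
    (Subgroup.closure_mono Set.subset_union_left)
  rw [Set.singleton_subset_iff, SetLike.mem_coe]
  refine Subgroup.inv_mem _ (Subgroup.list_prod_mem _ fun t ht => ?_)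
  exact Subgroup.subset_closure ((List.mem_ofFn' T t).1 ht)

lemma fullCycleType_eq {k : ℕ} (σ : Perm (Fin k)) : fullCycleType σ = cycParts σ := by
  rw [fullCycleType, cycParts, Fintype.card_fin]

lemma coeff_connGen_fin (k n : ℕ) (α : Multiset ℕ) :
    MvPolynomial.coeff (Multiset.toFinsupp α) (connGen (Fin k) n)
      = 2 ^ n * hurwitzCount0 k n α := by
  classical
  rw [coeff_connGen]
  congr 1
  let e : {T : (Fin n → Perm (Fin k)) × Perm (Fin k) //
      (∀ i, (T.1 i).IsSwap) ∧ fullCycleType T.2 = α ∧ (List.ofFn T.1).prod * T.2 = 1 ∧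
      ∀ x y : Fin k, ∃ g ∈ Subgroup.closure (Set.range T.1 ∪ {T.2}), g x = y} ≃
    {T : Fin n → Perm (Fin k) // (∀ i, (T i).IsSwap) ∧
      (∀ x y : Fin k, ∃ g ∈ Subgroup.closure (Set.range T), g x = y) ∧
      cycParts (List.ofFn T).reverse.prod = α} :=
    { toFun := fun T => ⟨T.1.1, by
        obtain ⟨⟨T, σ⟩, h1, h2, h3, h4⟩ := T
        obtain rfl : σ = (List.ofFn T).prod⁻¹ := eq_inv_of_mul_eq_one_right h3
        rw [closure_range_union] at h4
        rw [fullCycleType_eq, prod_inv_of_isSwap h1] at h2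
        exact ⟨h1, h4, h2⟩⟩
      invFun := fun T => ⟨(T.1, (List.ofFn T.1).prod⁻¹), by
        obtain ⟨T, h1, h4, h2⟩ := T
        refine ⟨h1, ?_, mul_inv_cancel _, ?_⟩
        · rw [fullCycleType_eq, prod_inv_of_isSwap h1, h2]
        · rw [closure_range_union]
          exact h4⟩
      left_inv := by
        rintro ⟨⟨T, σ⟩, h1, h2, h3, h4⟩
        obtain rfl : σ = (List.ofFn T).prod⁻¹ := eq_inv_of_mul_eq_one_right h3
        rfl
      right_inv := fun T => rfl }
  rw [hurwitzCount0, Nat.card_congr e, Nat.card_eq_fintype_card, Fintype.card_subtype,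
    Finset.card_filter, Nat.cast_sum]
  refine sum_congr rfl fun T _ => ?_
  rw [← ind_and, ← ind_and, ind, Nat.cast_ite, Nat.cast_one, Nat.cast_zero]
  congr 1
  rw [and_assoc]

end Counting

section Final

lemma hurwitzSphere_one {k : ℕ} (hk : k ≠ 0) {α : Multiset ℕ} (hα : α ≠ 0) :
    hurwitzSphere 1 k α = (k + α.card).factorial *
      MvPolynomial.coeff (Multiset.toFinsupp α) (candOne k) := by
  have hd : (Multiset.toFinsupp α).degree = α.card := by
    rw [← Multiset.toFinsupp_sum_eq]
    rfl
  have h := congrArg (MvPolynomial.coeff (Multiset.toFinsupp α))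
    (component_normGen_genusOne hk α.card)
  rw [MvPolynomial.coeff_homogeneousComponent, MvPolynomial.coeff_homogeneousComponent,
    if_pos hd, if_pos hd, normGen, MvPolynomial.coeff_smul, coeff_connGen_fin] at h
  have hc : α.card ≠ 0 := by rwa [Ne, Multiset.card_eq_zero]
  rw [← h, hurwitzSphere, normConst, smul_eq_mul,
    show k + α.card - 2 + 2 * 1 = k + α.card by omega]
  have h1 : (k.factorial : ℚ) ≠ 0 := by positivity
  have h2 : ((k + α.card).factorial : ℚ) ≠ 0 := by positivity
  field_simp

lemma prod_map_treeCoeff {α : Multiset ℕ} (hα : 0 ∉ α) :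
    α.prod * (α.map treeCoeff).prod
      = (α.map fun a : ℕ => (a : ℚ) ^ a / ((a - 1).factorial : ℚ)).prod := by
  induction α using Multiset.induction_on with
  | empty => simp
  | cons a s ih =>
    rw [Multiset.mem_cons, not_or] at hα
    obtain ⟨b, rfl⟩ := Nat.exists_eq_succ_of_ne_zero (Ne.symm hα.1)
    simp only [Multiset.prod_cons, Multiset.map_cons, ← ih hα.2]
    rw [treeCoeff_of_ne_zero b.succ_ne_zero, Nat.succ_eq_add_one, Nat.factorial_succ,
      Nat.add_sub_cancel]
    push_cast
    have h1 : (b.factorial : ℚ) ≠ 0 := by positivity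
    have h2 : (b : ℚ) + 1 ≠ 0 := by positivity
    field_simp

end Final

end HurwitzGenusOne

/-- **Formula (1.8).** For `k ≥ 1` and a partition `α = (α₁,…,α_m)` of `k`,
`μ_{0,m}^{1,k}(α) = (|c_α|/(24·k!))·(k+m)!·(Π_{i=1}^m α_i^{α_i}/(α_i-1)!)·
(k^m - k^{m-1} - Σ_{i=2}^m (i-2)!·e_i·k^{m-i})`, where `e_i` is the `i`-th
elementary symmetric polynomial in `α₁,…,α_m`. -/
theorem hurwitz_genus_one_formula (k : ℕ) (hk : 1 ≤ k) (α : Multiset ℕ)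
    (hpos : ∀ a ∈ α, 0 < a) (hsum : α.sum = k) :
    hurwitzSphere 1 k α =
      conjClassCard k α / (24 * (k.factorial : ℚ)) * ((k + α.card).factorial : ℚ) *
        (α.map fun (a : ℕ) => (a : ℚ) ^ a / ((a - 1).factorial : ℚ)).prod *
        ((k : ℚ) ^ α.card - (k : ℚ) ^ (α.card - 1) -
          ∑ i ∈ Finset.Icc 2 α.card,
            ((i - 2).factorial : ℚ) * (α.map (fun (a : ℕ) => (a : ℚ))).esymm i *
              (k : ℚ) ^ (α.card - i)) := by
  have hk0 : α.sum ≠ 0 := by omega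
  have h0 : 0 ∉ α := fun h => (hpos 0 h).false
  have hα : α ≠ 0 := by
    rintro rfl
    exact hk0 rfl
  subst hsum
  have hmult : (∏ j ∈ α.toFinset, ((α.count j).factorial : ℚ)) ≠ 0 := by positivity
  have hprod : (α.prod : ℚ) ≠ 0 := by
    exact_mod_cast Multiset.prod_ne_zero h0
  have hfac : (α.sum.factorial : ℚ) ≠ 0 := by positivity
  rw [HurwitzGenusOne.hurwitzSphere_one hk0 hα,
    eq_div_of_mul_eq hmult (HurwitzGenusOne.coeff_candOne α hk0),
    ← HurwitzGenusOne.prod_map_treeCoeff h0, conjClassCard]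
  field_simp
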